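/- Let d ≥ 3. There exist positive constants c_7, c_1, c_2 depending only on d with the following property. Let L_0 ≥ c_7 be an integer, set u_0 = (4/c_2)(log L_0)²·L_0^{−(d−2)}, and define u_{n+1} = (1 + 1/log L_n)^{−1}·u_n. If c_1·ℓ_0²·q_0(u_0) ≤ L_0^{−1}, then c_1·ℓ_n²·q_n(u_n) ≤ L_n^{−1} for all n ≥ 0, where each q_n(u_n) is taken with respect to any vacant-set law at level u_n; moreover u_∞ := u_0·Π_{n≥0}(1 + 1/log L_n)^{−1} belongs to (0, 1]. -/

import Mathlib

open MeasureTheory Filter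

namespace RI

/-- Points of `ℤ^d`. -/
abbrev Zd (d : ℕ) := Fin d → ℤ

/-- `x` and `y` are nearest neighbours: `|x - y| = 1`. -/
def adj {d : ℕ} (x y : Zd d) : Prop := (∑ i, |x i - y i|) = 1

/-- `x` and `y` are `*`-neighbours: `|x - y|_∞ = 1`. -/
def starAdj {d : ℕ} (x y : Zd d) : Prop := x ≠ y ∧ ∀ i, |x i - y i| ≤ 1

/-- `x` belongs to the plane `ℤ e₁ + ℤ e₂ ⊆ ℤ^d`. -/
def inPlane {d : ℕ} (x : Zd d) : Prop := ∀ i : Fin d, 2 ≤ (i : ℕ) → x i = 0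

/-- The `k`-th coordinate of `x`, with value `0` for out-of-range indices. -/
def coord {d : ℕ} (x : Zd d) (k : ℕ) : ℤ := if h : k < d then x ⟨k, h⟩ else 0

/-- `P` is the family of laws of the simple random walks on `ℤ^d` started at the points of
`ℤ^d`: each `P x` is a probability measure on the path space `ℕ → ℤ^d`, and the cylinder
probabilities are those of the walk with i.i.d. increments uniform on `{± e_i}`. -/
def IsSRW (d : ℕ) (P : Zd d → Measure (ℕ → Zd d)) : Prop :=
  (∀ x, IsProbabilityMeasure (P x)) ∧
  (∀ (x : Zd d) (n : ℕ) (w : ℕ → Zd d),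
      (w 0 = x ∧ ∀ k < n, adj (w k) (w (k + 1))) →
        P x {ω | ∀ k ≤ n, ω k = w k} = ((2 * d : ENNReal))⁻¹ ^ n) ∧
  (∀ (x : Zd d) (n : ℕ) (w : ℕ → Zd d),
      ¬(w 0 = x ∧ ∀ k < n, adj (w k) (w (k + 1))) →
        P x {ω | ∀ k ≤ n, ω k = w k} = 0)

/-- The equilibrium measure of a set `V ⊆ ℤ^d`:
`e_V(x) = P_x[H̃_V = ∞]` for `x ∈ V`, and `0` otherwise. -/
noncomputable def eqm {d : ℕ} (P : Zd d → Measure (ℕ → Zd d)) (V : Set (Zd d)) : Zd d → ℝ :=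
  V.indicator fun x => (P x {ω | ∀ n, 1 ≤ n → ω n ∉ V}).toReal

/-- The capacity of a finite set `K ⊆ ℤ^d`. -/
noncomputable def capa {d : ℕ} (P : Zd d → Measure (ℕ → Zd d)) (K : Finset (Zd d)) : ℝ :=
  ∑ x ∈ K, eqm P (↑K) x

/-- `Q` is a vacant-set law at level `u`: a probability measure on `{0,1}^{ℤ^d}`
(with `true = 1` standing for "vacant") such that
`Q[Y_x = 1 ∀ x ∈ K] = exp(-u cap K)` for every finite `K`. -/
def IsVacantLaw {d : ℕ} (P : Zd d → Measure (ℕ → Zd d)) (u : ℝ)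
    (Q : Measure (Zd d → Bool)) : Prop :=
  IsProbabilityMeasure Q ∧
  ∀ K : Finset (Zd d),
    Q {Y | ∀ x ∈ K, Y x = true} = ENNReal.ofReal (Real.exp (-(u * capa P K)))

/-- There is a `*`-path starting in `S`, ending in `T`, all of whose points lie in `A`. -/
def HasStarPath {d : ℕ} (S T A : Set (Zd d)) : Prop :=
  ∃ (N : ℕ) (w : ℕ → Zd d), w 0 ∈ S ∧ w N ∈ T ∧ (∀ k ≤ N, w k ∈ A) ∧
    ∀ k < N, starAdj (w k) (w (k + 1))

/-- Interior boundary `∂_int U`. -/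
def intBdry {d : ℕ} (U : Set (Zd d)) : Set (Zd d) := {x | x ∈ U ∧ ∃ y, y ∉ U ∧ adj x y}

/-- (Exterior) boundary `∂U`. -/
def bdry {d : ℕ} (U : Set (Zd d)) : Set (Zd d) := {x | x ∉ U ∧ ∃ y ∈ U, adj x y}

/-- `ℓ = 100 ⌊L^{1/100}⌋ + 1`. -/
noncomputable def ellOf (L : ℕ) : ℕ := 100 * ⌊(L : ℝ) ^ ((1 : ℝ) / 100)⌋₊ + 1

/-- The scales `L_{n+1} = ℓ_n L_n`. -/
noncomputable def Lseq (L0 : ℕ) : ℕ → ℕ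
  | 0 => L0
  | n + 1 => ellOf (Lseq L0 n) * Lseq L0 n

/-- The levels `u_{n+1} = (1 + 1/log L_n)⁻¹ u_n`. -/
noncomputable def useq (L0 : ℕ) (u0 : ℝ) : ℕ → ℝ
  | 0 => u0
  | n + 1 => (1 + 1 / Real.log (Lseq L0 n))⁻¹ * useq L0 u0 n

/-- The event (on the configuration space `{0,1}^{ℤ^d}`) that there is a `*`-path from
`[-L,L]² ∩ ℤ²` to `∂_int ([-3L,3L]^d ∩ ℤ^d)` all of whose points lie in `{x ∈ ℤ² : Y_x = 0}`. -/
def qEvent (d : ℕ) (L : ℕ) : Set (Zd d → Bool) :=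
  {Y | HasStarPath
    {x : Zd d | inPlane x ∧ ∀ i, |x i| ≤ (L : ℤ)}
    (intBdry {x : Zd d | ∀ i, |x i| ≤ (3 * L : ℤ)})
    {x : Zd d | inPlane x ∧ Y x = false}}


end RI

set_option linter.unusedSectionVars false

namespace RI

lemma hasSum_of_eq {f g : ℕ → ℝ} {s : ℝ} (h : HasSum f s) (e : ∀ n, f n = g n) : HasSum g s :=
  funext e ▸ h

section Convolution

variable {α : Type*} [Fintype α] [SemilatticeSup α] [OrderBot α]

/-- Continuous linear operators on functions on a finite type. -/
abbrev Op (α : Type*) [Fintype α] := (α → ℝ) →L[ℝ] (α → ℝ)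

/-- The shift operator `F ↦ F (· ⊔ s)`. -/
noncomputable def shift (s : α) : Op α :=
  ContinuousLinearMap.pi fun a => ContinuousLinearMap.proj (R := ℝ) (a ⊔ s)

@[simp] lemma shift_apply (s : α) (F : α → ℝ) (a : α) : shift s F a = F (a ⊔ s) := rfl

lemma shift_commute (s t : α) : Commute (shift s) (shift t) := by
  ext F a
  simp [sup_right_comm]

/-- Nonnegative combinations of shifts, characterized by positivity and shift-commutation. -/
structure IsConv (U : Op α) : Prop where
  nonneg : ∀ F : α → ℝ, 0 ≤ F → 0 ≤ U F
  comm : ∀ s : α, Commute U (shift s)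

lemma apply_eq_bot {U : Op α} (hU : ∀ s : α, Commute U (shift s)) (F : α → ℝ) (a : α) :
    U F a = U (fun b => F (a ⊔ b)) ⊥ := by
  have h := congrFun (congrArg (fun V : Op α => V F) (hU a)) ⊥
  have e : shift a F = fun b => F (a ⊔ b) := by
    funext b; simp [sup_comm]
  simp only [ContinuousLinearMap.mul_def, ContinuousLinearMap.comp_apply, shift_apply, bot_sup_eq] at h
  rw [← h, e]

lemma apply_eq_sum {U : Op α} (hU : ∀ s : α, Commute U (shift s)) :
    ∃ c : α → ℝ, ∀ F : α → ℝ, U F = ∑ s, c s • shift s F := by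
  classical
  refine ⟨fun s => U (Pi.single s 1) ⊥, fun F => ?_⟩
  funext a
  rw [apply_eq_bot hU]
  have h : (fun b => F (a ⊔ b)) = ∑ s, F (a ⊔ s) • (Pi.single s 1 : α → ℝ) := by
    funext b
    simp [Finset.sum_apply, Pi.single_apply]
  rw [h, map_sum]
  simp [Finset.sum_apply, mul_comm]

lemma commute_of_comm {U V : Op α} (hU : ∀ s : α, Commute U (shift s))
    (hV : ∀ s : α, Commute V (shift s)) : Commute U V := by
  obtain ⟨c, hc⟩ := apply_eq_sum hU
  have hV' : ∀ s F, V (shift s F) = shift s (V F) := fun s F =>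
    congrArg (fun W : Op α => W F) (hV s)
  refine ContinuousLinearMap.ext fun F => ?_
  simp only [ContinuousLinearMap.mul_def, ContinuousLinearMap.comp_apply, hc, map_sum, map_smul, hV']

namespace IsConv

lemma one : IsConv (1 : Op α) := ⟨fun _ h => h, fun _ => Commute.one_left _⟩

lemma zero : IsConv (0 : Op α) := ⟨fun _ _ => le_rfl, fun _ => Commute.zero_left _⟩

protected lemma shift (s : α) : IsConv (RI.shift s) := ⟨fun _ h a => h (a ⊔ s), shift_commute s⟩

lemma add {U V : Op α} (hU : IsConv U) (hV : IsConv V) : IsConv (U + V) :=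
  ⟨fun F h => add_nonneg (hU.nonneg F h) (hV.nonneg F h),
    fun s => (hU.comm s).add_left (hV.comm s)⟩

lemma smul {U : Op α} (hU : IsConv U) {c : ℝ} (hc : 0 ≤ c) : IsConv (c • U) :=
  ⟨fun F h => smul_nonneg hc (hU.nonneg F h), fun s => (hU.comm s).smul_left c⟩

lemma mul {U V : Op α} (hU : IsConv U) (hV : IsConv V) : IsConv (U * V) :=
  ⟨fun F h => hU.nonneg _ (hV.nonneg F h), fun s => (hU.comm s).mul_left (hV.comm s)⟩

lemma pow {U : Op α} (hU : IsConv U) (n : ℕ) : IsConv (U ^ n) := by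
  induction n with
  | zero => simpa using IsConv.one
  | succ n ih => rw [pow_succ]; exact ih.mul hU

lemma sum {ι : Type*} (s : Finset ι) {U : ι → Op α} (hU : ∀ i ∈ s, IsConv (U i)) :
    IsConv (∑ i ∈ s, U i) := by
  classical
  induction s using Finset.induction_on with
  | empty => simpa using IsConv.zero
  | insert i s hi ih =>
    rw [Finset.sum_insert hi]
    exact (hU i (by simp)).add (ih fun j hj => hU j (by simp [hj]))

lemma commute {U V : Op α} (hU : IsConv U) (hV : IsConv V) : Commute U V :=
  commute_of_comm hU.comm hV.comm

lemma mono {U : Op α} (hU : IsConv U) {F G : α → ℝ} (h : F ≤ G) : U F ≤ U G := by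
  have := hU.nonneg (G - F) (sub_nonneg.2 h)
  rwa [map_sub, sub_nonneg] at this

lemma monotone {U : Op α} (hU : IsConv U) {F : α → ℝ} (h : Monotone F) : Monotone (U F) := by
  intro a b hab
  rw [apply_eq_bot hU.comm F a, apply_eq_bot hU.comm F b]
  exact hU.mono (fun c => h (sup_le_sup_right hab c)) ⊥

lemma map_const {U : Op α} (h1 : U 1 = 1) (c : ℝ) : U (fun _ => c) = fun _ => c := by
  have : (fun _ : α => c) = c • (1 : α → ℝ) := by funext; simp
  rw [this, map_smul, h1]

/-- A Markov convolution operator increases increasing functions. -/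
lemma le_apply {U : Op α} (hU : IsConv U) (h1 : U 1 = 1) {F : α → ℝ} (h : Monotone F) :
    F ≤ U F := by
  intro a
  rw [apply_eq_bot hU.comm F a]
  have := hU.mono (F := fun _ => F a) (G := fun b => F (a ⊔ b)) (fun b => h le_sup_left) ⊥
  rwa [map_const h1] at this

lemma apply_le_one {U : Op α} (hU : IsConv U) (h1 : U 1 = 1) {F : α → ℝ} (h : F ≤ 1) :
    U F ≤ 1 := h1 ▸ hU.mono h

lemma one_pow {U : Op α} (h1 : U 1 = 1) (n : ℕ) : (U ^ n) 1 = 1 := by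
  induction n with
  | zero => rfl
  | succ n ih => rw [pow_succ]; simp [h1, ih]

lemma pow_mono {U : Op α} (hU : IsConv U) (h1 : U 1 = 1) {F : α → ℝ} (h : Monotone F) {m n : ℕ}
    (hmn : m ≤ n) : (U ^ m) F ≤ (U ^ n) F := by
  obtain ⟨k, rfl⟩ := Nat.exists_eq_add_of_le hmn
  rw [pow_add]
  exact (hU.pow m).mono ((hU.pow k).le_apply (one_pow h1 k) h)

lemma exp_hasSum (U : Op α) (F : α → ℝ) (a : α) :
    HasSum (fun n : ℕ => ((n.factorial : ℝ)⁻¹) * (U ^ n) F a) (NormedSpace.exp U F a) := by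
  have h := NormedSpace.exp_series_hasSum_exp' (𝕂 := ℝ) U
  have h2 := h.mapL (ContinuousLinearMap.apply ℝ (α → ℝ) F)
  have h3 := (Pi.hasSum.1 h2) a
  simpa using h3

protected lemma exp {U : Op α} (hU : IsConv U) : IsConv (NormedSpace.exp U) := by
  refine ⟨fun F hF a => ?_, fun s => Commute.exp_left (hU.comm s)⟩
  refine (exp_hasSum U F a).nonneg fun n => mul_nonneg (by positivity) ((hU.pow n).nonneg F hF a)

lemma exp_le {U V : Op α} (hU : IsConv U) (hV : IsConv V)
    (h : ∀ F : α → ℝ, Monotone F → U F ≤ V F) {F : α → ℝ} (hF : Monotone F) :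
    NormedSpace.exp U F ≤ NormedSpace.exp V F := by
  have key : ∀ n : ℕ, (U ^ n) F ≤ (V ^ n) F := by
    intro n
    induction n with
    | zero => simp
    | succ n ih =>
      rw [pow_succ', pow_succ']
      exact (hU.mono ih).trans (h _ ((hV.pow n).monotone hF))
  intro a
  refine hasSum_le (fun n => ?_) (exp_hasSum U F a) (exp_hasSum V F a)
  exact mul_le_mul_of_nonneg_left (key n a) (by positivity)

end IsConv

lemma op_exp_add {X Y : Op α} (h : Commute X Y) :
    NormedSpace.exp (X + Y) = NormedSpace.exp X * NormedSpace.exp Y := by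
  let _ : NormedAlgebra ℚ (Op α) := NormedAlgebra.restrictScalars ℚ ℝ (Op α)
  exact NormedSpace.exp_add_of_commute h

lemma op_exp_smul_one (c : ℝ) : NormedSpace.exp (c • (1 : Op α)) = Real.exp c • (1 : Op α) := by
  have := NormedSpace.algebraMap_exp_comm (𝕂 := ℝ) (𝔸 := Op α) c
  rw [Algebra.algebraMap_eq_smul_one, Algebra.algebraMap_eq_smul_one] at this
  rw [← this, Real.exp_eq_exp_ℝ]

/-- Generators of Markov convolution semigroups. -/
structure IsGen (X : Op α) : Prop where
  conv : ∃ m : ℝ, IsConv (X + m • 1)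
  one : X 1 = 0

namespace IsGen

lemma comm {X : Op α} (hX : IsGen X) (s : α) : Commute X (shift s) := by
  obtain ⟨m, hm⟩ := hX.conv
  have := (hm.comm s).sub_left ((Commute.one_left (shift s)).smul_left m)
  simpa using this

lemma commute {X Y : Op α} (hX : IsGen X) (hY : IsGen Y) : Commute X Y :=
  commute_of_comm hX.comm hY.comm

lemma add {X Y : Op α} (hX : IsGen X) (hY : IsGen Y) : IsGen (X + Y) := by
  obtain ⟨m, hm⟩ := hX.conv
  obtain ⟨n, hn⟩ := hY.conv
  refine ⟨⟨m + n, ?_⟩, by simp [hX.one, hY.one]⟩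
  have := hm.add hn
  convert this using 1
  module

lemma smul {X : Op α} (hX : IsGen X) {c : ℝ} (hc : 0 ≤ c) : IsGen (c • X) := by
  obtain ⟨m, hm⟩ := hX.conv
  refine ⟨⟨c * m, ?_⟩, by simp [hX.one]⟩
  have := hm.smul hc
  convert this using 1
  module

lemma of_conv {U : Op α} (hU : IsConv U) {m : ℝ} (h1 : U 1 = m • 1) : IsGen (U - m • 1) :=
  ⟨⟨m, by simpa using hU⟩, by simp [h1]⟩

lemma of_markov {T : Op α} (hT : IsConv T) (h1 : T 1 = 1) : IsGen (T - 1) := by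
  simpa using of_conv hT (m := 1) (by simpa using h1)

lemma exp_eq (X : Op α) (m : ℝ) :
    NormedSpace.exp X = Real.exp (-m) • NormedSpace.exp (X + m • 1) := by
  rw [op_exp_add ((Commute.one_right X).smul_right m), op_exp_smul_one, mul_smul_comm, mul_one,
    smul_smul, ← Real.exp_add]
  simp

lemma exp_conv {X : Op α} (hX : IsGen X) : IsConv (NormedSpace.exp X) := by
  obtain ⟨m, hm⟩ := hX.conv
  rw [exp_eq X m]
  exact hm.exp.smul (Real.exp_pos _).le

lemma exp_one {X : Op α} (hX : IsGen X) : NormedSpace.exp X 1 = 1 := by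
  funext a
  have h := IsConv.exp_hasSum X 1 a
  have h2 : HasSum (fun n : ℕ => ((n.factorial : ℝ)⁻¹) * (X ^ n) 1 a) 1 := by
    have := hasSum_single (f := fun n : ℕ => ((n.factorial : ℝ)⁻¹) * (X ^ n) 1 a) 0 (by
      intro n hn
      obtain ⟨k, rfl⟩ := Nat.exists_eq_succ_of_ne_zero hn
      simp [pow_succ, hX.one])
    simpa using this
  exact h.unique h2

lemma exp_le {X Y : Op α} (hX : IsGen X) (hY : IsGen Y)
    (h : ∀ F : α → ℝ, Monotone F → X F ≤ Y F) {F : α → ℝ} (hF : Monotone F) :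
    NormedSpace.exp X F ≤ NormedSpace.exp Y F := by
  obtain ⟨m, hm⟩ := hX.conv
  obtain ⟨n, hn⟩ := hY.conv
  have hX' : IsConv (X + (|m| + |n|) • (1 : Op α)) := by
    have := hm.add (IsConv.one.smul (c := |m| - m + |n|) (by
      have := le_abs_self m; have := abs_nonneg n; linarith))
    convert this using 1
    module
  have hY' : IsConv (Y + (|m| + |n|) • (1 : Op α)) := by
    have := hn.add (IsConv.one.smul (c := |n| - n + |m|) (by
      have := le_abs_self n; have := abs_nonneg m; linarith))
    convert this using 1
    module
  rw [exp_eq X (|m| + |n|), exp_eq Y (|m| + |n|)]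
  intro a
  have := IsConv.exp_le hX' hY' (fun F hF a => by
    have := h F hF a
    simpa using this) hF a
  simpa using mul_le_mul_of_nonneg_left this (Real.exp_pos _).le

/-- The exponential of `t (T - 1)` is a Poisson mixture of the powers of `T`. -/
lemma poisson_hasSum (T : Op α) (t : ℝ) (F : α → ℝ) (a : α) :
    HasSum (fun n : ℕ => Real.exp (-t) * (t ^ n / n.factorial) * (T ^ n) F a)
      (NormedSpace.exp (t • (T - 1)) F a) := by
  have h := (IsConv.exp_hasSum (t • T) F a).mul_left (Real.exp (-t))
  have e : NormedSpace.exp (t • (T - 1)) F a = Real.exp (-t) * NormedSpace.exp (t • T) F a := by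
    rw [exp_eq (t • (T - 1)) t]
    have : t • (T - 1) + t • 1 = t • T := by module
    rw [this]; simp
  rw [e]
  refine hasSum_of_eq h fun n => ?_
  rw [smul_pow]
  simp
  ring

lemma hasSum_poisson_exp (t s : ℝ) :
    HasSum (fun n : ℕ => Real.exp (-t) * (t ^ n / n.factorial) * Real.exp (s * n))
      (Real.exp (t * (Real.exp s - 1))) := by
  have h := (NormedSpace.expSeries_div_hasSum_exp (t * Real.exp s)).mul_left (Real.exp (-t))
  rw [← Real.exp_eq_exp_ℝ, ← Real.exp_add] at h
  have e : -t + t * Real.exp s = t * (Real.exp s - 1) := by ring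
  rw [e] at h
  refine hasSum_of_eq h fun n => ?_
  rw [mul_pow, ← Real.exp_nat_mul, mul_comm s]
  ring

lemma poisson_le {T : Op α} (hT : IsConv T) (h1 : T 1 = 1) {t : ℝ} (ht : 0 ≤ t) {F : α → ℝ}
    (hF : Monotone F) (hF0 : 0 ≤ F) (hF1 : F ≤ 1) (m : ℕ) (a : α) :
    NormedSpace.exp (t • (T - 1)) F a ≤ (T ^ m) F a + Real.exp (2 * t - m) := by
  have h0 := hasSum_poisson_exp t 0
  have h2 := hasSum_poisson_exp t 1
  have hs : HasSum (fun n : ℕ => Real.exp (-t) * (t ^ n / n.factorial) *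
      ((T ^ m) F a + Real.exp (-m) * Real.exp (1 * n)))
      (1 * (T ^ m) F a + Real.exp (-m) * Real.exp (t * (Real.exp 1 - 1))) := by
    have := (h0.mul_right ((T ^ m) F a)).add (h2.mul_left (Real.exp (-m)))
    simp only [Real.exp_zero, sub_self, mul_zero, zero_mul, mul_one] at this
    refine hasSum_of_eq this fun n => ?_
    ring
  have hle := hasSum_le (fun n => ?_) (poisson_hasSum T t F a) hs
  · refine hle.trans ?_
    rw [one_mul, ← Real.exp_add]
    gcongr
    have : Real.exp 1 ≤ 3 := Real.exp_one_lt_d9.le.trans (by norm_num)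
    nlinarith
  · refine mul_le_mul_of_nonneg_left ?_ (by positivity)
    rw [← Real.exp_add]
    rcases le_total n m with h | h
    · exact (hT.pow_mono h1 hF h a).trans (by linarith [Real.exp_pos (-(m : ℝ) + 1 * n)])
    · have hb : (T ^ n) F a ≤ 1 := (hT.pow n).apply_le_one (IsConv.one_pow h1 n) hF1 a
      have hc : 0 ≤ (T ^ m) F a := (hT.pow m).nonneg F hF0 a
      have hd : 1 ≤ Real.exp (-(m : ℝ) + 1 * n) := by
        apply Real.one_le_exp
        have : (m : ℝ) ≤ n := by exact_mod_cast h
        linarith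
      linarith

lemma le_poisson {T : Op α} (hT : IsConv T) (h1 : T 1 = 1) {t : ℝ} (ht : 0 ≤ t) {F : α → ℝ}
    (hF : Monotone F) (hF0 : 0 ≤ F) (hF1 : F ≤ 1) (m : ℕ) (a : α) :
    (T ^ m) F a ≤ NormedSpace.exp (t • (T - 1)) F a + Real.exp (m - t / 2) := by
  have h0 := hasSum_poisson_exp t 0
  have h2 := hasSum_poisson_exp t (-1)
  have hs : HasSum (fun n : ℕ => Real.exp (-t) * (t ^ n / n.factorial) *
      ((T ^ m) F a - Real.exp m * Real.exp (-1 * n)))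
      (1 * (T ^ m) F a - Real.exp m * Real.exp (t * (Real.exp (-1) - 1))) := by
    have := (h0.mul_right ((T ^ m) F a)).sub (h2.mul_left (Real.exp m))
    simp only [Real.exp_zero, sub_self, mul_zero, zero_mul, mul_one] at this
    refine hasSum_of_eq this fun n => ?_
    ring
  have hle := hasSum_le (fun n => ?_) hs (poisson_hasSum T t F a)
  · have h3 : Real.exp m * Real.exp (t * (Real.exp (-1) - 1)) ≤ Real.exp (m - t / 2) := by
      rw [← Real.exp_add]
      gcongr
      have : Real.exp (-1) ≤ 1 / 2 := by
        rw [Real.exp_neg]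
        have : (2 : ℝ) ≤ Real.exp 1 := (by norm_num : (2 : ℝ) ≤ 2.7182818283).trans
          Real.exp_one_gt_d9.le
        rw [inv_le_comm₀ (by positivity) (by norm_num)]
        linarith
      nlinarith
    linarith
  · refine mul_le_mul_of_nonneg_left ?_ (by positivity)
    rw [← Real.exp_add]
    rcases le_total m n with h | h
    · exact (by linarith [Real.exp_pos ((m : ℝ) + -1 * n)] : _ ≤ (T ^ m) F a).trans
        (hT.pow_mono h1 hF h a)
    · have hb : (T ^ m) F a ≤ 1 := (hT.pow m).apply_le_one (IsConv.one_pow h1 m) hF1 a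
      have hc : 0 ≤ (T ^ n) F a := (hT.pow n).nonneg F hF0 a
      have hd : 1 ≤ Real.exp ((m : ℝ) + -1 * n) := by
        apply Real.one_le_exp
        have : (n : ℝ) ≤ m := by exact_mod_cast h
        linarith
      linarith

lemma poisson_le_add {T : Op α} (hT : IsConv T) (h1 : T 1 = 1) {t : ℝ} (ht : 0 ≤ t) {F : α → ℝ}
    (hF0 : 0 ≤ F) (hF1 : F ≤ 1) (a : α) :
    NormedSpace.exp (t • (T - 1)) F a ≤ F a + t := by
  have h0 := hasSum_poisson_exp t 0
  simp only [Real.exp_zero, sub_self, mul_zero, zero_mul, mul_one] at h0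
  have hs := (h0.sub (hasSum_single (f := fun n : ℕ => if n = 0 then Real.exp (-t) else 0) 0
    (by intro n hn; simp [hn]))).add (hasSum_single (f := fun n : ℕ => if n = 0 then
      Real.exp (-t) * F a else 0) 0 (by intro n hn; simp [hn]))
  have hle := hasSum_le (fun n => ?_) (poisson_hasSum T t F a) hs
  · simp only [if_true] at hle
    have h3 : 1 - t ≤ Real.exp (-t) := by linarith [Real.add_one_le_exp (-t)]
    have h4 : Real.exp (-t) ≤ 1 := Real.exp_le_one_iff.2 (by linarith)
    have := hF0 a
    simp only [Pi.zero_apply] at this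
    nlinarith
  · by_cases hn : n = 0
    · subst hn; simp
    · simp only [hn, if_false, sub_zero, add_zero]
      exact mul_le_of_le_one_right (by positivity)
        ((hT.pow n).apply_le_one (IsConv.one_pow h1 n) hF1 a)

end IsGen

/-- `U` only involves shifts by elements of `J`. -/
def ActsOn (J : Set α) (U : Op α) : Prop :=
  ∀ F : α → ℝ, (∀ s ∈ J, shift s F = F) → ∀ G : α → ℝ, U (G * F) = U G * F

namespace ActsOn

variable {J : Set α}

lemma one : ActsOn J (1 : Op α) := fun _ _ _ => rfl

protected lemma shift {s : α} (hs : s ∈ J) : ActsOn J (RI.shift s) := by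
  intro F hF G
  funext a
  have := congrFun (hF s hs) a
  simp only [shift_apply] at this
  simp [this]

lemma sub {U V : Op α} (hU : ActsOn J U) (hV : ActsOn J V) : ActsOn J (U - V) := by
  intro F hF G
  simp [hU F hF G, hV F hF G, sub_mul]

lemma smul {U : Op α} (hU : ActsOn J U) (c : ℝ) : ActsOn J (c • U) := by
  intro F hF G
  simp [hU F hF G]

lemma mul {U V : Op α} (hU : ActsOn J U) (hV : ActsOn J V) : ActsOn J (U * V) := by
  intro F hF G
  simp [hU F hF, hV F hF]

lemma pow {U : Op α} (hU : ActsOn J U) (n : ℕ) : ActsOn J (U ^ n) := by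
  induction n with
  | zero => simpa using ActsOn.one
  | succ n ih => rw [pow_succ]; exact ih.mul hU

lemma sum {ι : Type*} (s : Finset ι) {U : ι → Op α} (hU : ∀ i ∈ s, ActsOn J (U i)) :
    ActsOn J (∑ i ∈ s, U i) := by
  intro F hF G
  simp only [sum_apply, Finset.sum_mul]
  exact Finset.sum_congr rfl fun i hi => hU i hi F hF G

protected lemma exp {U : Op α} (hU : ActsOn J U) : ActsOn J (NormedSpace.exp U) := by
  intro F hF G
  funext a
  refine (IsConv.exp_hasSum U (G * F) a).unique ?_
  have := (IsConv.exp_hasSum U G a).mul_right (F a)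
  refine hasSum_of_eq this fun n => ?_
  rw [hU.pow n F hF G]
  simp [mul_assoc]

end ActsOn

lemma inv_apply {U : Op α} (hU : ∀ s, Commute U (shift s)) {J : Set α} {F : α → ℝ}
    (hF : ∀ s ∈ J, shift s F = F) : ∀ s ∈ J, shift s (U F) = U F := by
  intro s hs
  have := congrArg (fun W : Op α => W F) (hU s)
  simp only [ContinuousLinearMap.mul_def, ContinuousLinearMap.comp_apply] at this
  rw [← this, hF s hs]

/-- Decoupling of a compound Poisson law dominated by independent excursions on two sides,
simultaneous excursions, and a rare remainder. -/
theorem decouple_operator [OrderTop α] {T₁ T₂ X : Op α} (hT₁ : IsConv T₁) (h₁ : T₁ 1 = 1)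
    (hT₂ : IsConv T₂) (h₂ : T₂ 1 = 1) {J₁ J₂ : Set α} (hJ₁ : ActsOn J₁ T₁) (hJ₂ : ActsOn J₂ T₂)
    {F₁ F₂ : α → ℝ} (hF₁ : ∀ s ∈ J₂, shift s F₁ = F₁) (hF₂ : ∀ s ∈ J₁, shift s F₂ = F₂)
    (m₁ : Monotone F₁) (m₂ : Monotone F₂) (p₁ : 0 ≤ F₁) (p₂ : 0 ≤ F₂) (q₁ : F₁ ≤ 1) (q₂ : F₂ ≤ 1)
    (hX : IsGen X) {c b ρ : ℝ} (hc : 0 ≤ c) (hb : 0 ≤ b) (hρ : 0 ≤ ρ) (r : ℕ)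
    (hXle : ∀ F : α → ℝ, Monotone F → X F ≤
      (c • (T₁ - 1) + c • (T₂ - 1) + b • ((T₁ * T₂) ^ r - 1) + ρ • (shift ⊤ - 1) : Op α) F)
    {u' u : ℝ} (hu' : 0 ≤ u') (huu : u' ≤ u) (k : ℕ) (a : α) :
    NormedSpace.exp (u' • X) (F₁ * F₂) a ≤
      NormedSpace.exp ((u * c) • (T₁ - 1)) F₁ a * NormedSpace.exp ((u * c) • (T₂ - 1)) F₂ a
        + (Real.exp (2 * (u' * b) - k) + 2 * Real.exp ((r * k : ℕ) - (u - u') * c / 2)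
          + u' * ρ) := by
  have g₁ := IsGen.of_markov hT₁ h₁
  have g₂ := IsGen.of_markov hT₂ h₂
  have hPi : IsConv ((T₁ * T₂) ^ r) := (hT₁.mul hT₂).pow r
  have hPi1 : ((T₁ * T₂) ^ r) (1 : α → ℝ) = 1 := IsConv.one_pow (by simp [h₁, h₂]) r
  have gPi := IsGen.of_markov hPi hPi1
  have htop : (shift (⊤ : α)) (1 : α → ℝ) = 1 := rfl
  have gt := IsGen.of_markov (IsConv.shift (⊤ : α)) htop
  have huc : 0 ≤ u' * c := mul_nonneg hu' hc
  have hub : 0 ≤ u' * b := mul_nonneg hu' hb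
  have hur : 0 ≤ u' * ρ := mul_nonneg hu' hρ
  set lam := (u - u') * c with hlam
  have hlam0 : 0 ≤ lam := mul_nonneg (sub_nonneg.2 huu) hc
  set A₁ := NormedSpace.exp ((u' * c) • (T₁ - 1)) with hA₁
  set A₂ := NormedSpace.exp ((u' * c) • (T₂ - 1)) with hA₂
  set Bx := NormedSpace.exp ((u' * b) • ((T₁ * T₂) ^ r - 1)) with hBx
  set Cx := NormedSpace.exp ((u' * ρ) • (shift (⊤ : α) - 1)) with hCx
  have cA₁ : IsConv A₁ := (g₁.smul huc).exp_conv
  have cA₂ : IsConv A₂ := (g₂.smul huc).exp_conv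
  have cB : IsConv Bx := (gPi.smul hub).exp_conv
  have cC : IsConv Cx := (gt.smul hur).exp_conv
  have oA₁ : A₁ 1 = 1 := (g₁.smul huc).exp_one
  have oA₂ : A₂ 1 = 1 := (g₂.smul huc).exp_one
  have oB : Bx 1 = 1 := (gPi.smul hub).exp_one
  have mF : Monotone (F₁ * F₂) := fun x y hxy =>
    mul_le_mul (m₁ hxy) (m₂ hxy) (p₂ x) (p₁ y)
  have pF : 0 ≤ F₁ * F₂ := fun x => mul_nonneg (p₁ x) (p₂ x)
  have qF : F₁ * F₂ ≤ 1 := fun x => mul_le_one₀ (q₁ x) (p₂ x) (q₂ x)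
  have step1 : NormedSpace.exp (u' • X) (F₁ * F₂) ≤ (A₁ * A₂ * Bx * Cx) (F₁ * F₂) := by
    have e : A₁ * A₂ * Bx * Cx = NormedSpace.exp ((u' * c) • (T₁ - 1) + (u' * c) • (T₂ - 1) +
        (u' * b) • ((T₁ * T₂) ^ r - 1) + (u' * ρ) • (shift (⊤ : α) - 1)) := by
      have G₁ := g₁.smul huc
      have G₂ := g₂.smul huc
      have G₃ := gPi.smul hub
      have G₄ := gt.smul hur
      rw [op_exp_add (((G₁.add G₂).add G₃).commute G₄), op_exp_add ((G₁.add G₂).commute G₃),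
        op_exp_add (G₁.commute G₂)]
    rw [e]
    refine IsGen.exp_le (hX.smul hu') ((((g₁.smul huc).add (g₂.smul huc)).add
      (gPi.smul hub)).add (gt.smul hur)) (fun F hF x => ?_) mF
    have := mul_le_mul_of_nonneg_left (hXle F hF x) hu'
    simp only [smul_apply, add_apply, Pi.smul_apply,
      Pi.add_apply, smul_eq_mul] at this ⊢
    linarith
  -- the k-fold excursions on each side
  set n := r * k with hn
  set G₁ := (T₁ ^ n) F₁ with hG₁
  set G₂ := (T₂ ^ n) F₂ with hG₂
  have hsplit : (((T₁ * T₂) ^ r) ^ k) (F₁ * F₂) = G₁ * G₂ := by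
    rw [← pow_mul, (hT₁.commute hT₂).mul_pow]
    change (T₁ ^ n) ((T₂ ^ n) (F₁ * F₂)) = G₁ * G₂
    rw [mul_comm F₁ F₂, hJ₂.pow n F₁ hF₁ F₂, mul_comm,
      hJ₁.pow n _ (inv_apply (hT₂.pow n).comm hF₂) F₁]
  set H₁ := NormedSpace.exp (lam • (T₁ - 1)) F₁ with hH₁
  set H₂ := NormedSpace.exp (lam • (T₂ - 1)) F₂ with hH₂
  have cE₁ := (g₁.smul hlam0).exp_conv
  have cE₂ := (g₂.smul hlam0).exp_conv
  set ε := Real.exp ((n : ℕ) - lam / 2) with hε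
  have hGH : G₁ * G₂ ≤ H₁ * H₂ + fun _ => 2 * ε := by
    intro x
    have i1 : G₁ x ≤ H₁ x + ε := IsGen.le_poisson hT₁ h₁ hlam0 m₁ p₁ q₁ n x
    have i2 : G₂ x ≤ H₂ x + ε := IsGen.le_poisson hT₂ h₂ hlam0 m₂ p₂ q₂ n x
    have j1 : 0 ≤ G₁ x := (hT₁.pow n).nonneg _ p₁ x
    have j2 : G₂ x ≤ 1 := (hT₂.pow n).apply_le_one (IsConv.one_pow h₂ n) q₂ x
    have j2' : 0 ≤ G₂ x := (hT₂.pow n).nonneg _ p₂ x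
    have j3 : H₁ x ≤ 1 := cE₁.apply_le_one (g₁.smul hlam0).exp_one q₁ x
    have j4 : 0 ≤ H₁ x := cE₁.nonneg _ p₁ x
    have j5 : 0 < ε := Real.exp_pos _
    simp only [Pi.mul_apply, Pi.add_apply]
    nlinarith
  set η := Real.exp (2 * (u' * b) - k) with hη
  have step2 : (A₁ * A₂ * Bx * Cx) (F₁ * F₂) a ≤
      (A₁ * A₂) (H₁ * H₂) a + (η + 2 * ε + u' * ρ) := by
    have s1 : Cx (F₁ * F₂) ≤ F₁ * F₂ + fun _ => u' * ρ := fun x =>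
      IsGen.poisson_le_add (IsConv.shift ⊤) htop hur pF qF x
    have s2 : Bx (F₁ * F₂) ≤ G₁ * G₂ + fun _ => η := fun x => by
      have := IsGen.poisson_le hPi hPi1 hub mF pF qF k x
      rwa [hsplit] at this
    have s3 : Bx (Cx (F₁ * F₂)) ≤ H₁ * H₂ + fun _ => (η + 2 * ε + u' * ρ) := by
      refine (cB.mono s1).trans ?_
      rw [map_add, IsConv.map_const oB]
      intro x
      have := s2 x
      have := hGH x
      simp only [Pi.add_apply] at *
      linarith
    have s4 := (cA₁.mul cA₂).mono s3 a
    have o : (A₁ * A₂) (1 : α → ℝ) = 1 := by simp [oA₁, oA₂]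
    rw [map_add, IsConv.map_const o] at s4
    exact s4
  have step3 : (A₁ * A₂) (H₁ * H₂) = NormedSpace.exp ((u * c) • (T₁ - 1)) F₁ *
      NormedSpace.exp ((u * c) • (T₂ - 1)) F₂ := by
    have aA₁ : ActsOn J₁ A₁ := by
      exact ((hJ₁.sub ActsOn.one).smul (u' * c)).exp
    have aA₂ : ActsOn J₂ A₂ := by
      exact ((hJ₂.sub ActsOn.one).smul (u' * c)).exp
    have e₁ : NormedSpace.exp ((u * c) • (T₁ - 1)) = A₁ * NormedSpace.exp (lam • (T₁ - 1)) := by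
      rw [← op_exp_add ((g₁.smul huc).commute (g₁.smul hlam0))]
      congr 1
      rw [hlam]; module
    have e₂ : NormedSpace.exp ((u * c) • (T₂ - 1)) = A₂ * NormedSpace.exp (lam • (T₂ - 1)) := by
      rw [← op_exp_add ((g₂.smul huc).commute (g₂.smul hlam0))]
      congr 1
      rw [hlam]; module
    rw [e₁, e₂]
    change A₁ (A₂ (H₁ * H₂)) = A₁ H₁ * A₂ H₂
    rw [mul_comm H₁ H₂, aA₂ H₁ (inv_apply cE₁.comm hF₁) H₂, mul_comm,
      aA₁ (A₂ H₂) (inv_apply cA₂.comm (inv_apply cE₂.comm hF₂)) H₁]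
  have := step1 a
  rw [step3] at step2
  simp only [Pi.mul_apply] at step2
  linarith

end Convolution

section Average

variable {d : ℕ}

/-- The average of a function over the neighbours of a point. -/
noncomputable def avg {E : Type*} [AddCommGroup E] [Module ℝ E] (f : Zd d → E) (x : Zd d) : E :=
  (2 * d : ℝ)⁻¹ • ∑ i : Fin d, (f (x + Pi.single i 1) + f (x - Pi.single i 1))

section Module

variable {E : Type*} [AddCommGroup E] [Module ℝ E]

lemma avg_add (f g : Zd d → E) (x : Zd d) : avg (fun y => f y + g y) x = avg f x + avg g x := by
  simp only [avg, ← smul_add, ← Finset.sum_add_distrib]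
  congr 1
  exact Finset.sum_congr rfl fun i _ => by abel

lemma avg_sub (f g : Zd d → E) (x : Zd d) : avg (fun y => f y - g y) x = avg f x - avg g x := by
  simp only [avg, ← smul_sub, ← Finset.sum_sub_distrib]
  congr 1
  exact Finset.sum_congr rfl fun i _ => by abel

lemma avg_smul (c : ℝ) (f : Zd d → E) (x : Zd d) : avg (fun y => c • f y) x = c • avg f x := by
  simp only [avg, ← smul_add, ← Finset.smul_sum]
  exact smul_comm _ _ _

lemma avg_sum {ι : Type*} (s : Finset ι) (f : ι → Zd d → E) (x : Zd d) :
    avg (fun y => ∑ j ∈ s, f j y) x = ∑ j ∈ s, avg (f j) x := by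
  simp only [avg, ← Finset.smul_sum, ← Finset.sum_add_distrib]
  rw [Finset.sum_comm]

lemma avg_const (hd : 0 < d) (c : E) (x : Zd d) : avg (fun _ => c) x = c := by
  have : (d : ℝ) ≠ 0 := by positivity
  have e : c + c = (2 : ℝ) • c := (two_smul ℝ c).symm
  simp only [avg, Finset.sum_const, Finset.card_univ, Fintype.card_fin, e]
  rw [← Nat.cast_smul_eq_nsmul ℝ, smul_smul, smul_smul]
  rw [show (2 * (d : ℝ))⁻¹ * d * 2 = 1 by field_simp, one_smul]

lemma avg_translate (f : Zd d → E) (z x : Zd d) : avg (fun y => f (y + z)) x = avg f (x + z) := by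
  simp only [avg]
  congr 1
  refine Finset.sum_congr rfl fun i _ => ?_
  rw [add_right_comm, sub_add_eq_add_sub]

lemma map_avg {F : Type*} [AddCommGroup F] [Module ℝ F] (φ : E →ₗ[ℝ] F) (f : Zd d → E)
    (x : Zd d) : φ (avg f x) = avg (fun y => φ (f y)) x := by
  simp [avg]

end Module

lemma avg_mul (c : ℝ) (f : Zd d → ℝ) (x : Zd d) : avg (fun y => c * f y) x = c * avg f x :=
  avg_smul c f x

lemma avg_mono_nb {f g : Zd d → ℝ} {x : Zd d}
    (h : ∀ i, f (x + Pi.single i 1) ≤ g (x + Pi.single i 1))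
    (h' : ∀ i, f (x - Pi.single i 1) ≤ g (x - Pi.single i 1)) : avg f x ≤ avg g x := by
  refine smul_le_smul_of_nonneg_left (Finset.sum_le_sum fun i _ => ?_) (by positivity)
  exact add_le_add (h i) (h' i)

lemma avg_mono {f g : Zd d → ℝ} (h : ∀ y, f y ≤ g y) (x : Zd d) : avg f x ≤ avg g x :=
  avg_mono_nb (fun _ => h _) fun _ => h _

lemma avg_nonneg {f : Zd d → ℝ} (h : ∀ y, 0 ≤ f y) (x : Zd d) : 0 ≤ avg f x :=
  smul_nonneg (by positivity) (Finset.sum_nonneg fun _ _ => add_nonneg (h _) (h _))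

lemma avg_le_const {f : Zd d → ℝ} {c : ℝ} (hd : 0 < d) (h : ∀ y, f y ≤ c) (x : Zd d) :
    avg f x ≤ c := (avg_mono h x).trans_eq (avg_const hd c x)

lemma tendsto_avg {f : ℕ → Zd d → ℝ} {g : Zd d → ℝ}
    (h : ∀ y, Tendsto (fun n => f n y) atTop (nhds (g y))) (x : Zd d) :
    Tendsto (fun n => avg (f n) x) atTop (nhds (avg g x)) := by
  unfold avg
  exact (tendsto_finsetSum _ fun i _ => (h _).add (h _)).const_smul _

end Average

section Escape

variable {d : ℕ}

/-- The probability that the walk started at `x` avoids `V` during the times `1, …, N`. -/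
noncomputable def esc (V : Set (Zd d)) : ℕ → Zd d → ℝ
  | 0 => fun _ => 1
  | N + 1 => avg (Vᶜ.indicator (esc V N))

variable {V : Set (Zd d)}

lemma esc_succ (N : ℕ) (x : Zd d) : esc V (N + 1) x = avg (Vᶜ.indicator (esc V N)) x := rfl

lemma esc_nonneg (V : Set (Zd d)) (N : ℕ) (x : Zd d) : 0 ≤ esc V N x := by
  induction N generalizing x with
  | zero => exact zero_le_one
  | succ N ih => exact avg_nonneg (fun y => Set.indicator_nonneg (fun z _ => ih z) y) x

lemma esc_succ_le (hd : 0 < d) (V : Set (Zd d)) (N : ℕ) (x : Zd d) :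
    esc V (N + 1) x ≤ esc V N x := by
  induction N generalizing x with
  | zero =>
    refine avg_le_const hd (fun y => ?_) x
    exact Set.indicator_le_self' (fun _ _ => zero_le_one) y
  | succ N ih =>
    exact avg_mono (fun y => Set.indicator_le_indicator (ih y)) x

lemma esc_antitone (hd : 0 < d) (V : Set (Zd d)) (x : Zd d) : Antitone fun N => esc V N x :=
  antitone_nat_of_succ_le fun N => esc_succ_le hd V N x

/-- The probability that the walk started at `x` avoids `V` at all positive times. -/
noncomputable def Esc (V : Set (Zd d)) (x : Zd d) : ℝ := ⨅ N, esc V N x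

lemma esc_tendsto (hd : 0 < d) (V : Set (Zd d)) (x : Zd d) :
    Tendsto (fun N => esc V N x) atTop (nhds (Esc V x)) :=
  tendsto_atTop_ciInf (esc_antitone hd V x) ⟨0, by rintro _ ⟨N, rfl⟩; exact esc_nonneg V N x⟩

lemma Esc_nonneg (V : Set (Zd d)) (x : Zd d) : 0 ≤ Esc V x :=
  Real.iInf_nonneg fun N => esc_nonneg V N x

lemma Esc_le_esc (hd : 0 < d) (V : Set (Zd d)) (N : ℕ) (x : Zd d) : Esc V x ≤ esc V N x :=
  (esc_antitone hd V x).le_of_tendsto (esc_tendsto hd V x) N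

lemma Esc_le_one (hd : 0 < d) (V : Set (Zd d)) (x : Zd d) : Esc V x ≤ 1 := Esc_le_esc hd V 0 x

lemma Esc_eq (hd : 0 < d) (V : Set (Zd d)) (x : Zd d) : Esc V x = avg (Vᶜ.indicator (Esc V)) x := by
  refine tendsto_nhds_unique ((esc_tendsto hd V x).comp (tendsto_add_atTop_nat 1)) ?_
  refine tendsto_avg (fun y => ?_) x
  by_cases hy : y ∈ Vᶜ
  · simpa [Set.indicator_of_mem hy] using esc_tendsto hd V y
  · simp [Set.indicator_of_notMem hy]

lemma esc_anti {V W : Set (Zd d)} (h : V ⊆ W) (N : ℕ) (x : Zd d) : esc W N x ≤ esc V N x := by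
  induction N generalizing x with
  | zero => exact le_rfl
  | succ N ih =>
    refine avg_mono (fun y => ?_) x
    refine (Set.indicator_le_indicator (ih y)).trans ?_
    exact Set.indicator_le_indicator_of_subset (Set.compl_subset_compl.2 h)
      (fun z => esc_nonneg V N z) y

lemma Esc_anti (hd : 0 < d) {V W : Set (Zd d)} (h : V ⊆ W) (x : Zd d) : Esc W x ≤ Esc V x :=
  le_of_tendsto_of_tendsto' (esc_tendsto hd W x) (esc_tendsto hd V x) fun N => esc_anti h N x

lemma esc_translate (V : Set (Zd d)) (z : Zd d) (N : ℕ) (x : Zd d) :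
    esc ((· + z) ⁻¹' V) N x = esc V N (x + z) := by
  induction N generalizing x with
  | zero => rfl
  | succ N ih =>
    rw [esc_succ, esc_succ, ← avg_translate]
    congr 1
    funext y
    by_cases hy : y + z ∈ V <;> simp [Set.indicator, hy, ih]

lemma Esc_translate (hd : 0 < d) (V : Set (Zd d)) (z x : Zd d) :
    Esc ((· + z) ⁻¹' V) x = Esc V (x + z) := by
  refine tendsto_nhds_unique (esc_tendsto hd _ x) ?_
  simpa only [esc_translate] using esc_tendsto hd V (x + z)

/-- The equilibrium measure, expressed through escape probabilities. -/
noncomputable def eqv (V : Set (Zd d)) : Zd d → ℝ := V.indicator (Esc V)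

/-- The probability of ever hitting `V`. -/
noncomputable def hit (V : Set (Zd d)) (x : Zd d) : ℝ := 1 - Vᶜ.indicator (Esc V) x

lemma eqv_nonneg (V : Set (Zd d)) (x : Zd d) : 0 ≤ eqv V x :=
  Set.indicator_nonneg (fun y _ => Esc_nonneg V y) x

lemma hit_of_mem {x : Zd d} (h : x ∈ V) : hit V x = 1 := by simp [hit, h]

lemma hit_nonneg (hd : 0 < d) (V : Set (Zd d)) (x : Zd d) : 0 ≤ hit V x := by
  have : Vᶜ.indicator (Esc V) x ≤ 1 :=
    Set.indicator_apply_le' (fun _ => Esc_le_one hd V x) fun _ => zero_le_one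
  unfold hit
  linarith

lemma hit_le_one (V : Set (Zd d)) (x : Zd d) : hit V x ≤ 1 := by
  have : 0 ≤ Vᶜ.indicator (Esc V) x := Set.indicator_nonneg (fun y _ => Esc_nonneg V y) x
  unfold hit
  linarith

lemma hit_sub_avg (hd : 0 < d) (V : Set (Zd d)) (x : Zd d) :
    hit V x - avg (hit V) x = eqv V x := by
  have : avg (hit V) x = 1 - Esc V x := by
    unfold hit
    rw [avg_sub, avg_const hd, ← Esc_eq hd]
  rw [this]
  by_cases hx : x ∈ V <;> simp [hit, eqv, hx]

/-- The capacity, expressed through escape probabilities. -/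
noncomputable def capv (K : Finset (Zd d)) : ℝ := ∑ x ∈ K, eqv (K : Set (Zd d)) x

lemma capv_nonneg (K : Finset (Zd d)) : 0 ≤ capv K := Finset.sum_nonneg fun x _ => eqv_nonneg _ x

end Escape

section Link

variable {d : ℕ}

/-- The neighbours of a point, indexed by a coordinate and a sign. -/
def nb (x : Zd d) (p : Fin d × Bool) : Zd d :=
  if p.2 then x + Pi.single p.1 1 else x - Pi.single p.1 1

lemma nb_injective (x : Zd d) : Function.Injective (nb x) := by
  rintro ⟨i, a⟩ ⟨j, b⟩ h
  have h1 := congrFun h i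
  have h2 := congrFun h j
  by_cases hij : i = j
  · subst hij
    cases a <;> cases b <;> simp [nb] at h1 ⊢ <;> omega
  · cases a <;> cases b <;> simp [nb, hij] at h1

lemma adj_iff (x y : Zd d) : adj x y ↔ ∃ p, nb x p = y := by
  constructor
  · intro h
    have hne : ∃ i, x i ≠ y i := by
      by_contra! hc
      simp [adj, hc] at h
    obtain ⟨i, hi⟩ := hne
    have hsplit := Finset.add_sum_erase Finset.univ (fun j => |x j - y j|) (Finset.mem_univ i)
    rw [show ∑ j, |x j - y j| = 1 from h] at hsplit
    have hpos : 0 < |x i - y i| := abs_pos.2 (sub_ne_zero.2 hi)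
    have hnn : 0 ≤ ∑ j ∈ Finset.univ.erase i, |x j - y j| :=
      Finset.sum_nonneg fun j _ => abs_nonneg _
    have h0 : ∑ j ∈ Finset.univ.erase i, |x j - y j| = 0 := by omega
    have h1 : |x i - y i| = 1 := by omega
    have hj : ∀ j, j ≠ i → y j = x j := by
      intro j hj
      have := (Finset.sum_eq_zero_iff_of_nonneg fun j _ => abs_nonneg _).1 h0 j (by simp [hj])
      have := sub_eq_zero.1 (abs_eq_zero.1 this)
      exact this.symm
    rcases (abs_eq zero_le_one).1 h1 with h2 | h2
    · refine ⟨(i, false), funext fun j => ?_⟩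
      by_cases e : j = i
      · subst e; simp [nb]; omega
      · simp [nb, e, hj j e]
    · refine ⟨(i, true), funext fun j => ?_⟩
      by_cases e : j = i
      · subst e; simp [nb]; omega
      · simp [nb, e, hj j e]
  · rintro ⟨⟨i, a⟩, rfl⟩
    unfold adj
    rw [Finset.sum_eq_single i]
    · cases a <;> simp [nb]
    · intro j _ hj
      cases a <;> simp [nb, hj]
    · simp

lemma avg_eq_nb {E : Type*} [AddCommGroup E] [Module ℝ E] (f : Zd d → E) (x : Zd d) :
    avg f x = (2 * d : ℝ)⁻¹ • ∑ p : Fin d × Bool, f (nb x p) := by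
  simp [avg, nb, Fintype.sum_prod_type]

variable {P : Zd d → Measure (ℕ → Zd d)}

lemma cyl_measurable (n : ℕ) (w : ℕ → Zd d) : MeasurableSet {ω : ℕ → Zd d | ∀ k ≤ n, ω k = w k} := by
  measurability

lemma avoid_measurable (V : Set (Zd d)) (n N : ℕ) :
    MeasurableSet {ω : ℕ → Zd d | ∀ k, n < k → k ≤ N → ω k ∉ V} := by
  have : {ω : ℕ → Zd d | ∀ k, n < k → k ≤ N → ω k ∉ V} =
      ⋂ k : ℕ, ⋂ (_ : n < k), ⋂ (_ : k ≤ N), (fun ω : ℕ → Zd d => ω k) ⁻¹' Vᶜ := by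
    ext ω; simp
  rw [this]
  refine MeasurableSet.iInter fun k => MeasurableSet.iInter fun _ => MeasurableSet.iInter fun _ => ?_
  exact measurable_pi_apply k (MeasurableSet.of_discrete)

lemma cyl_extend (hP : IsSRW d P) (x : Zd d) (n : ℕ) (w : ℕ → Zd d) (y : Zd d) [Decidable (adj (w n) y)] :
    P x {ω | (∀ k ≤ n, ω k = w k) ∧ ω (n + 1) = y} =
      P x {ω | ∀ k ≤ n, ω k = w k} * (if adj (w n) y then (2 * d : ENNReal)⁻¹ else 0) := by
  set w' : ℕ → Zd d := fun k => if k = n + 1 then y else w k with hw'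
  have e1 : {ω : ℕ → Zd d | (∀ k ≤ n, ω k = w k) ∧ ω (n + 1) = y} =
      {ω | ∀ k ≤ n + 1, ω k = w' k} := by
    ext ω
    simp only [Set.mem_ofPred_eq, hw']
    constructor
    · rintro ⟨h1, h2⟩ k hk
      by_cases e : k = n + 1
      · simp [e, h2]
      · simp [e, h1 k (by omega)]
    · intro h
      refine ⟨fun k hk => ?_, ?_⟩
      · have := h k (by omega)
        rwa [if_neg (by omega)] at this
      · simpa using h (n + 1) le_rfl
  have hw : ∀ k ≤ n, w' k = w k := fun k hk => by simp [hw']; intro; omega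
  have hw1 : w' (n + 1) = y := by simp [hw']
  have hvalid : (w' 0 = x ∧ ∀ k < n + 1, adj (w' k) (w' (k + 1))) ↔
      (w 0 = x ∧ ∀ k < n, adj (w k) (w (k + 1))) ∧ adj (w n) y := by
    rw [hw 0 (Nat.zero_le _), and_assoc]
    refine and_congr_right fun _ => ⟨fun h => ⟨fun k hk => ?_, ?_⟩, fun h k hk => ?_⟩
    · have := h k (by omega)
      rwa [hw k hk.le, hw (k + 1) hk] at this
    · have := h n (by omega)
      rwa [hw n le_rfl, hw1] at this
    · by_cases e : k = n
      · subst e; rw [hw k le_rfl, hw1]; exact h.2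
      · rw [hw k (by omega), hw (k + 1) (by omega)]; exact h.1 k (by omega)
  rw [e1]
  by_cases h1 : w 0 = x ∧ ∀ k < n, adj (w k) (w (k + 1))
  · by_cases h2 : adj (w n) y
    · rw [hP.2.1 x (n + 1) w' (hvalid.2 ⟨h1, h2⟩), hP.2.1 x n w h1, if_pos h2, pow_succ]
    · rw [hP.2.2 x (n + 1) w' (fun h => h2 (hvalid.1 h).2), if_neg h2, mul_zero]
  · rw [hP.2.2 x (n + 1) w' (fun h => h1 (hvalid.1 h).1), hP.2.2 x n w h1, zero_mul]

lemma cyl_avoid (hd : 0 < d) (hP : IsSRW d P) (V : Set (Zd d)) (x : Zd d) (N n : ℕ) (w : ℕ → Zd d) :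
    P x {ω | (∀ k ≤ n, ω k = w k) ∧ ∀ k, n < k → k ≤ n + N → ω k ∉ V} =
      P x {ω | ∀ k ≤ n, ω k = w k} * ENNReal.ofReal (esc V N (w n)) := by
  classical
  induction N generalizing n w with
  | zero =>
    have e : {ω : ℕ → Zd d | (∀ k ≤ n, ω k = w k) ∧ ∀ k, n < k → k ≤ n + 0 → ω k ∉ V} =
        {ω | ∀ k ≤ n, ω k = w k} :=
      Set.ext fun ω => and_iff_left fun k h1 h2 => absurd h1 (by omega)
    rw [e]
    simp [esc]
  | succ N ih =>
    set A : Zd d → Set (ℕ → Zd d) := fun y =>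
      {ω | ((∀ k ≤ n, ω k = w k) ∧ ω (n + 1) = y) ∧ ∀ k, n < k → k ≤ n + (N + 1) → ω k ∉ V} with hA
    have e1 : {ω : ℕ → Zd d | (∀ k ≤ n, ω k = w k) ∧ ∀ k, n < k → k ≤ n + (N + 1) → ω k ∉ V} =
        ⋃ y, A y := by
      ext ω
      simp [hA]
    have hm : ∀ y, MeasurableSet (A y) := by
      intro y
      have : A y = ({ω : ℕ → Zd d | ∀ k ≤ n, ω k = w k} ∩ (fun ω => ω (n + 1)) ⁻¹' {y}) ∩
        {ω | ∀ k, n < k → k ≤ n + (N + 1) → ω k ∉ V} := by ext; simp [hA, and_assoc]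
      rw [this]
      exact ((cyl_measurable n w).inter (measurable_pi_apply (n + 1) (MeasurableSet.of_discrete))).inter
        (avoid_measurable V n _)
    have hdis : Pairwise (Function.onFun Disjoint A) := by
      intro y z hyz
      refine Set.disjoint_left.2 fun ω h1 h2 => hyz ?_
      exact h1.1.2.symm.trans h2.1.2
    have hAy : ∀ y, P x (A y) = P x {ω | ∀ k ≤ n, ω k = w k} *
        ((if adj (w n) y then (2 * d : ENNReal)⁻¹ else 0) *
          ENNReal.ofReal (Vᶜ.indicator (esc V N) y)) := by
      intro y
      by_cases hy : y ∈ V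
      · have : A y = ∅ := by
          ext ω
          simp only [hA, Set.mem_ofPred_eq, Set.mem_empty_iff_false, iff_false]
          rintro ⟨⟨-, h⟩, h2⟩
          exact h2 (n + 1) (by omega) (by omega) (h ▸ hy)
        simp [this, hy]
      · set w' : ℕ → Zd d := fun k => if k = n + 1 then y else w k with hw'
        have hw : ∀ k ≤ n, w' k = w k := fun k hk => by simp [hw']; intro; omega
        have hw1 : w' (n + 1) = y := by simp [hw']
        have e0 : ∀ ω : ℕ → Zd d, (∀ k ≤ n + 1, ω k = w' k) ↔
            (∀ k ≤ n, ω k = w k) ∧ ω (n + 1) = y := by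
          intro ω
          refine ⟨fun h => ⟨fun k hk => (h k (by omega)).trans (hw k hk),
            (h _ le_rfl).trans hw1⟩, fun h k hk => ?_⟩
          by_cases e : k = n + 1
          · subst e; rw [hw1]; exact h.2
          · rw [hw k (by omega)]; exact h.1 k (by omega)
        have e2 : A y = {ω | (∀ k ≤ n + 1, ω k = w' k) ∧
            ∀ k, n + 1 < k → k ≤ n + 1 + N → ω k ∉ V} := by
          ext ω
          simp only [hA, Set.mem_ofPred_eq, e0]
          refine and_congr_right fun h => ⟨fun h2 k hk hk2 => h2 k (by omega) (by omega),
            fun h2 k hk hk2 => ?_⟩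
          by_cases e : k = n + 1
          · subst e; rw [h.2]; exact hy
          · exact h2 k (by omega) (by omega)
        rw [e2, ih (n + 1) w']
        simp only [e0]
        rw [cyl_extend hP, hw1, mul_assoc, Set.indicator_of_mem (by exact hy)]
    rw [e1, measure_iUnion hdis hm]
    simp only [hAy]
    rw [ENNReal.tsum_mul_left]
    congr 1
    rw [← (nb_injective (w n)).tsum_eq]
    · rw [tsum_fintype, esc_succ, avg_eq_nb, smul_eq_mul, ENNReal.ofReal_mul (by positivity),
        ENNReal.ofReal_sum_of_nonneg (fun p _ => Set.indicator_nonneg (fun z _ => esc_nonneg V N z) _),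
        Finset.mul_sum]
      refine Finset.sum_congr rfl fun p _ => ?_
      rw [if_pos ((adj_iff _ _).2 ⟨p, rfl⟩), ENNReal.ofReal_inv_of_pos (by positivity)]
      norm_num [ENNReal.ofReal_mul]
    · intro y hy
      by_contra hc
      refine hy ?_
      have : ¬ adj (w n) y := fun h => hc ((adj_iff _ _).1 h)
      simp [this]

lemma measure_avoid (hd : 0 < d) (hP : IsSRW d P) (V : Set (Zd d)) (x : Zd d) (N : ℕ) :
    P x {ω | ∀ k, 0 < k → k ≤ N → ω k ∉ V} = ENNReal.ofReal (esc V N x) := by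
  have h := cyl_avoid hd hP V x N 0 (fun _ => x)
  have h1 : P x {ω | ∀ k ≤ 0, ω k = x} = 1 := by
    simpa using hP.2.1 x 0 (fun _ => x) (by simp)
  have hp := hP.1 x
  rw [h1, one_mul, zero_add] at h
  rw [← h]
  have h2 : ∀ᵐ ω ∂(P x), ∀ k ≤ 0, ω k = x :=
    (prob_compl_eq_zero_iff (cyl_measurable 0 fun _ => x)).2 h1
  refine measure_congr ?_
  filter_upwards [h2] with ω hω
  exact propext ⟨fun h => ⟨hω, h⟩, fun h => h.2⟩

lemma eqm_eq (hd : 0 < d) (hP : IsSRW d P) (V : Set (Zd d)) : eqm P V = eqv V := by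
  funext x
  refine congrFun (congrArg V.indicator (funext fun x => ?_)) x
  have hp := hP.1 x
  have e : {ω : ℕ → Zd d | ∀ n, 1 ≤ n → ω n ∉ V} =
      ⋂ N, {ω | ∀ k, 0 < k → k ≤ N → ω k ∉ V} := by
    ext ω
    simp only [Set.mem_ofPred_eq, Set.mem_iInter]
    exact ⟨fun h N k hk _ => h k hk, fun h n hn => h n n hn le_rfl⟩
  have ht := tendsto_measure_iInter_atTop (μ := P x)
    (s := fun N => {ω : ℕ → Zd d | ∀ k, 0 < k → k ≤ N → ω k ∉ V})
    (fun N => (avoid_measurable V 0 N).nullMeasurableSet)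
    (fun M N h ω hω k hk hk2 => hω k hk (hk2.trans h)) ⟨0, measure_ne_top _ _⟩
  rw [← e] at ht
  have ht2 := (ENNReal.tendsto_toReal (measure_ne_top (P x) _)).comp ht
  refine tendsto_nhds_unique ht2 ?_
  refine (esc_tendsto hd V x).congr fun N => ?_
  simp [measure_avoid hd hP, ENNReal.toReal_ofReal (esc_nonneg V N x)]

lemma capa_eq (hd : 0 < d) (hP : IsSRW d P) (K : Finset (Zd d)) : capa P K = capv K := by
  unfold capa capv
  rw [eqm_eq hd hP]

end Link

section Radial

variable {d : ℕ}

/-- The squared Euclidean norm of a lattice point. -/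
def nsq (x : Zd d) : ℝ := ∑ i, (x i : ℝ) ^ 2

lemma nsq_nonneg (x : Zd d) : 0 ≤ nsq x := Finset.sum_nonneg fun _ _ => sq_nonneg _

lemma sq_le_nsq (x : Zd d) (i : Fin d) : (x i : ℝ) ^ 2 ≤ nsq x :=
  Finset.single_le_sum (f := fun i => (x i : ℝ) ^ 2) (fun _ _ => sq_nonneg _) (Finset.mem_univ i)

lemma nsq_le {x : Zd d} {M : ℝ} (h : ∀ i, |(x i : ℝ)| ≤ M) : nsq x ≤ d * M ^ 2 := by
  refine (Finset.sum_le_sum fun i _ => (sq_le_sq' (abs_le.1 (h i)).1 (abs_le.1 (h i)).2)).trans ?_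
  simp

lemma nsq_add_single (x : Zd d) (i : Fin d) : nsq (x + Pi.single i 1) = nsq x + 2 * x i + 1 := by
  unfold nsq
  rw [← Finset.add_sum_erase _ _ (Finset.mem_univ i), ← Finset.add_sum_erase _ _ (Finset.mem_univ i)]
  have : ∀ j ∈ Finset.univ.erase i, (((x + Pi.single i 1 : Zd d) j : ℤ) : ℝ) ^ 2 = (x j : ℝ) ^ 2 := by
    intro j hj
    simp [(Finset.mem_erase.1 hj).1]
  rw [Finset.sum_congr rfl this]
  simp
  ring

lemma nsq_sub_single (x : Zd d) (i : Fin d) : nsq (x - Pi.single i 1) = nsq x - 2 * x i + 1 := by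
  unfold nsq
  rw [← Finset.add_sum_erase _ _ (Finset.mem_univ i), ← Finset.add_sum_erase _ _ (Finset.mem_univ i)]
  have : ∀ j ∈ Finset.univ.erase i, (((x - Pi.single i 1 : Zd d) j : ℤ) : ℝ) ^ 2 = (x j : ℝ) ^ 2 := by
    intro j hj
    simp [(Finset.mem_erase.1 hj).1]
  rw [Finset.sum_congr rfl this]
  simp
  ring

/-- The radial function `(A + |x|²)^(-β)`. -/
noncomputable def radf (A β : ℝ) (x : Zd d) : ℝ := (A + nsq x) ^ (-β)

lemma radf_nonneg {A : ℝ} (hA : 0 ≤ A) (β : ℝ) (x : Zd d) : 0 ≤ radf A β x :=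
  Real.rpow_nonneg (add_nonneg hA (nsq_nonneg x)) _

lemma radf_pos {A : ℝ} (hA : 0 < A) (β : ℝ) (x : Zd d) : 0 < radf A β x :=
  Real.rpow_pos_of_pos (add_pos_of_pos_of_nonneg hA (nsq_nonneg x)) _

lemma rpow_neg_le_quadratic {β B : ℝ} (hB : β * (β + 1) / 2 < B) :
    ∃ η > 0, ∀ t : ℝ, |t| ≤ η → (1 + t) ^ (-β) ≤ 1 - β * t + B * t ^ 2 := by
  set φ : ℝ → ℝ := fun t => 1 - β * t + B * t ^ 2 - (1 + t) ^ (-β) with hφ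
  have h1 : ∀ p t : ℝ, -1 < t → HasDerivAt (fun t : ℝ => (1 + t) ^ p) (p * (1 + t) ^ (p - 1)) t := by
    intro p t ht
    have := ((hasDerivAt_id t).const_add 1).rpow_const (p := p) (Or.inl (by simp; linarith))
    simpa using this
  have hd1 : ∀ t : ℝ, -1 < t → HasDerivAt φ (-β + 2 * B * t + β * (1 + t) ^ (-β - 1)) t := by
    intro t ht
    have := (((hasDerivAt_const t (1 : ℝ)).sub ((hasDerivAt_id t).const_mul β)).add
      (((hasDerivAt_id t).pow 2).const_mul B)).sub (h1 (-β) t ht)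
    refine this.congr_deriv ?_
    simp
    ring
  have hd2 : HasDerivAt (fun t : ℝ => -β + 2 * B * t + β * (1 + t) ^ (-β - 1))
      (2 * B - β * (β + 1)) 0 := by
    have := (((hasDerivAt_id (0 : ℝ)).const_mul (2 * B)).const_add (-β)).add
      ((h1 (-β - 1) 0 (by norm_num)).const_mul β)
    refine this.congr_deriv ?_
    simp
    ring
  have he : deriv φ =ᶠ[nhds 0] fun t : ℝ => -β + 2 * B * t + β * (1 + t) ^ (-β - 1) := by
    filter_upwards [lt_mem_nhds (show (-1 : ℝ) < 0 by norm_num)] with t ht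
    exact (hd1 t ht).deriv
  have hmin : IsLocalMin φ 0 := by
    refine isLocalMin_of_deriv_deriv_pos ?_ ?_ (hd1 0 (by norm_num)).continuousAt
    · rw [he.deriv_eq, hd2.deriv]; linarith
    · rw [(hd1 0 (by norm_num)).deriv]; simp
  obtain ⟨η, hη, h⟩ := Metric.eventually_nhds_iff.1 hmin
  refine ⟨η / 2, by positivity, fun t ht => ?_⟩
  have := h (y := t) (by rw [Real.dist_eq, sub_zero]; linarith)
  simp only [hφ] at this
  norm_num at this
  linarith

lemma radf_superharmonic {β : ℝ} (hβ : 0 < β) (hd : 0 < d) (hβd : β + 1 < d / 2) :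
    ∃ A₀ ≥ 1, ∃ c > 0, ∀ A ≥ A₀, ∀ x : Zd d,
      avg (radf A β) x ≤ radf A β x - c * radf A (β + 1) x := by
  have hd' : (0 : ℝ) < d := by exact_mod_cast hd
  obtain ⟨B, hB1, hB2⟩ := exists_between (show β * (β + 1) / 2 < β * d / 4 by nlinarith)
  obtain ⟨η, hη, hquad⟩ := rpow_neg_le_quadratic hB1
  have hBpos : 0 < B := lt_of_le_of_lt (by positivity) hB1
  set g := β - 4 * B / d with hg
  have hgpos : 0 < g := by
    rw [hg, sub_pos, div_lt_iff₀ hd']; linarith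
  refine ⟨max 1 (max (2 * B / g) ((1 + 1 / η) / η)), le_max_left _ _, g / 2, by positivity,
    fun A hA x => ?_⟩
  have hA1 : 1 ≤ A := (le_max_left _ _).trans hA
  have hA2 : 2 * B / g ≤ A := (le_max_left _ _).trans ((le_max_right _ _).trans hA)
  have hA3 : (1 + 1 / η) / η ≤ A := (le_max_right _ _).trans ((le_max_right _ _).trans hA)
  set s := A + nsq x with hs
  have hn := nsq_nonneg x
  have hspos : 0 < s := by linarith
  have hsmall : ∀ i, 1 + 2 * |(x i : ℝ)| ≤ η * s := by
    intro i
    have h1 := sq_le_nsq x i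
    rw [div_le_iff₀ hη] at hA3
    have h2 : 2 * |(x i : ℝ)| ≤ η * (x i : ℝ) ^ 2 + 1 / η := by
      have : 0 ≤ η * (|(x i : ℝ)| - 1 / η) ^ 2 := by positivity
      have e : η * (|(x i : ℝ)| - 1 / η) ^ 2 = η * (x i : ℝ) ^ 2 - 2 * |(x i : ℝ)| + 1 / η := by
        rw [← sq_abs (x i : ℝ)]; field_simp
        ring
      linarith
    nlinarith
  have hstep : ∀ i, ∀ σ : ℝ, |σ| ≤ |(x i : ℝ)| → (s + (2 * σ + 1)) ^ (-β) ≤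
      s ^ (-β) * (1 - β * ((2 * σ + 1) / s) + B * ((2 * σ + 1) / s) ^ 2) := by
    intro i σ hσ
    have ht : |(2 * σ + 1) / s| ≤ η := by
      rw [abs_div, abs_of_pos hspos, div_le_iff₀ hspos]
      refine le_trans ?_ (hsmall i)
      calc |2 * σ + 1| ≤ |2 * σ| + |1| := abs_add_le _ _
        _ ≤ 1 + 2 * |(x i : ℝ)| := by rw [abs_mul]; simp; linarith
    have h1 := hquad _ ht
    by_cases hneg : 0 ≤ 1 + (2 * σ + 1) / s
    · have e : s + (2 * σ + 1) = s * (1 + (2 * σ + 1) / s) := by field_simp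
      rw [e, Real.mul_rpow hspos.le hneg]
      exact mul_le_mul_of_nonneg_left h1 (by positivity)
    · exfalso
      have h3 : |σ| ^ 2 ≤ nsq x := by
        refine le_trans ?_ (sq_le_nsq x i)
        rw [← sq_abs (x i : ℝ)]
        gcongr
      rw [sq_abs] at h3
      refine hneg ?_
      have : 0 ≤ s + (2 * σ + 1) := by nlinarith [sq_nonneg (σ + 1)]
      have e : 1 + (2 * σ + 1) / s = (s + (2 * σ + 1)) / s := by field_simp
      rw [e]
      positivity
  have hsum : ∑ i : Fin d, (radf A β (x + Pi.single i 1) + radf A β (x - Pi.single i 1)) ≤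
      ∑ i : Fin d, s ^ (-β) * (2 - 2 * β / s + B * (2 + 8 * (x i : ℝ) ^ 2) / s ^ 2) := by
    refine Finset.sum_le_sum fun i _ => ?_
    have h1 := hstep i (x i) le_rfl
    have h2 := hstep i (-(x i)) (abs_neg _).le
    unfold radf
    rw [nsq_add_single, nsq_sub_single]
    have e1 : A + (nsq x + 2 * x i + 1) = s + (2 * (x i : ℝ) + 1) := by rw [hs]; ring
    have e2 : A + (nsq x - 2 * x i + 1) = s + (2 * (-(x i : ℝ)) + 1) := by rw [hs]; ring
    rw [e1, e2]
    refine (add_le_add h1 h2).trans_eq ?_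
    field_simp
    ring
  have havg : avg (radf A β) x ≤ s ^ (-β) * (1 - β / s + B / s ^ 2 + 4 * B * nsq x / (d * s ^ 2)) := by
    unfold avg
    refine (smul_le_smul_of_nonneg_left hsum (by positivity)).trans_eq ?_
    rw [← Finset.mul_sum, Finset.sum_add_distrib, ← Finset.sum_div, ← Finset.mul_sum,
      Finset.sum_add_distrib, ← Finset.mul_sum]
    simp only [Finset.sum_const, Finset.card_univ, Fintype.card_fin, nsmul_eq_mul, smul_eq_mul]
    change (2 * (d : ℝ))⁻¹ * (s ^ (-β) * (d * (2 - 2 * β / s) + B * (d * 2 + 8 * nsq x) / s ^ 2)) = _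
    field_simp
    ring
  refine havg.trans ?_
  have e : radf A (β + 1) x = s ^ (-β) / s := by
    unfold radf
    rw [← hs, neg_add, ← sub_eq_add_neg, Real.rpow_sub_one hspos.ne']
  rw [e]
  change _ ≤ s ^ (-β) - g / 2 * (s ^ (-β) / s)
  have h4 : B / s ^ 2 + 4 * B * nsq x / (d * s ^ 2) ≤ (β - g / 2) / s := by
    have h5 : B / s ^ 2 ≤ (g / 2) / s := by
      rw [div_le_div_iff₀ (by positivity) hspos]
      rw [div_le_iff₀ hgpos] at hA2
      have : B ≤ g / 2 * s := by nlinarith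
      nlinarith
    have h6 : 4 * B * nsq x / (d * s ^ 2) ≤ 4 * B / d / s := by
      rw [div_div, div_le_div_iff₀ (by positivity) (by positivity)]
      have : nsq x ≤ s := by linarith
      have h7 : 0 ≤ 4 * B * (d * s) := by positivity
      nlinarith [mul_le_mul_of_nonneg_left this h7]
    have : (β - g / 2) / s = g / 2 / s + 4 * B / d / s := by rw [hg]; ring
    linarith
  have h8 : 0 ≤ s ^ (-β) := by positivity
  have := mul_le_mul_of_nonneg_left h4 h8
  have e2 : s ^ (-β) * ((β - g / 2) / s) = s ^ (-β) * (β / s) - g / 2 * (s ^ (-β) / s) := by ring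
  rw [e2] at this
  nlinarith

end Radial

section Iterates

variable {d : ℕ}

/-- The averaging operator as a linear map. -/
noncomputable def avgL (d : ℕ) : (Zd d → ℝ) →ₗ[ℝ] (Zd d → ℝ) where
  toFun := avg
  map_add' f g := funext fun x => avg_add f g x
  map_smul' c f := funext fun x => avg_smul c f x

lemma avgL_apply (f : Zd d → ℝ) (x : Zd d) : avgL d f x = avg f x := rfl

lemma avgL_mono {f g : Zd d → ℝ} (h : f ≤ g) : avgL d f ≤ avgL d g := fun x => avg_mono h x

lemma avgL_pow_mono {f g : Zd d → ℝ} (h : f ≤ g) (n : ℕ) : (avgL d ^ n) f ≤ (avgL d ^ n) g := by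
  induction n with
  | zero => exact h
  | succ n ih => rw [pow_succ']; exact avgL_mono ih

lemma avgL_pow_nonneg {f : Zd d → ℝ} (h : 0 ≤ f) (n : ℕ) : 0 ≤ (avgL d ^ n) f := by
  simpa using avgL_pow_mono h n

lemma avgL_pow_const (hd : 0 < d) (c : ℝ) (n : ℕ) :
    (avgL d ^ n) (fun _ => c) = fun _ => c := by
  induction n with
  | zero => rfl
  | succ n ih => rw [pow_succ', Module.End.mul_apply, ih]; exact funext fun x => avg_const hd c x

lemma sum_avgL_pow (f : Zd d → ℝ) (N : ℕ) :
    ∑ n ∈ Finset.range N, (avgL d ^ n) (f - avgL d f) = f - (avgL d ^ N) f := by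
  induction N with
  | zero => simp
  | succ N ih =>
    rw [Finset.sum_range_succ, ih, map_sub, pow_succ, Module.End.mul_apply]
    abel

lemma hit_eq_sum (hd : 0 < d) (V : Set (Zd d)) (N : ℕ) :
    hit V = ∑ n ∈ Finset.range N, (avgL d ^ n) (eqv V) + (avgL d ^ N) (hit V) := by
  have : eqv V = hit V - avgL d (hit V) := funext fun x => (hit_sub_avg hd V x).symm
  rw [this, sum_avgL_pow]
  abel

lemma hit_le_of_superharmonic (hd : 0 < d) {V : Set (Zd d)} {f : Zd d → ℝ} (h0 : ∀ x, 0 ≤ f x)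
    (h1 : ∀ x ∈ V, 1 ≤ f x) (h2 : ∀ x ∉ V, avg f x ≤ f x) (x : Zd d) : hit V x ≤ f x := by
  have key : ∀ N x, 1 - Vᶜ.indicator (esc V N) x ≤ f x := by
    intro N
    induction N with
    | zero =>
      intro x
      by_cases hx : x ∈ V
      · simpa [hx] using h1 x hx
      · simpa [hx, esc] using h0 x
    | succ N ih =>
      intro x
      by_cases hx : x ∈ V
      · simpa [hx] using h1 x hx
      · rw [Set.indicator_of_mem (show x ∈ Vᶜ from hx), esc_succ]
        have := avg_mono ih x
        rw [avg_sub, avg_const hd] at this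
        exact this.trans (h2 x hx)
  have ht : Tendsto (fun N => 1 - Vᶜ.indicator (esc V N) x) atTop (nhds (hit V x)) := by
    refine Tendsto.sub tendsto_const_nhds ?_
    by_cases hx : x ∈ V
    · simp [hx]
    · simpa [hx] using esc_tendsto hd V x
  exact le_of_tendsto' ht fun N => key N x

lemma hit_decay (hd : 3 ≤ d) (K : Finset (Zd d)) (x : Zd d) :
    Tendsto (fun n => (avgL d ^ n) (hit (K : Set (Zd d))) x) atTop (nhds 0) := by
  have hd0 : 0 < d := by omega
  have hd3 : (3 : ℝ) ≤ d := by exact_mod_cast hd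
  obtain ⟨A, hA1, c, hc, hsup⟩ := radf_superharmonic (d := d) (β := 1 / 4) (by norm_num) hd0
    (by linarith)
  specialize hsup A le_rfl
  have hA0 : 0 < A := by linarith
  set f : Zd d → ℝ := radf A (1 / 4) with hf
  have hfpos : ∀ x, 0 < f x := radf_pos hA0 _
  have hf5 : ∀ x, radf A (1 / 4 + 1) x = f x ^ 5 := by
    intro x
    rw [hf]
    unfold radf
    rw [← Real.rpow_natCast, ← Real.rpow_mul (add_nonneg hA0.le (nsq_nonneg x))]
    norm_num
  have hfle : avgL d f ≤ f := fun x => (hsup x).trans (sub_le_self _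
    (mul_nonneg hc.le (radf_nonneg hA0.le _ _)))
  -- decay of the fifth power
  have hsum : ∀ N, ∑ n ∈ Finset.range N, (avgL d ^ n) (fun y => c * f y ^ 5) x ≤ f x := by
    intro N
    have h1 : ∑ n ∈ Finset.range N, (avgL d ^ n) (fun y => c * f y ^ 5) x ≤
        (∑ n ∈ Finset.range N, (avgL d ^ n) (f - avgL d f)) x := by
      rw [Finset.sum_apply]
      refine Finset.sum_le_sum fun n _ => avgL_pow_mono (fun y => ?_) n x
      have := hsup y
      rw [hf5] at this
      simp only [Pi.sub_apply, avgL_apply]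
      linarith
    rw [sum_avgL_pow] at h1
    have h2 := avgL_pow_nonneg (f := f) (fun y => (hfpos y).le) N x
    simp only [Pi.sub_apply, Pi.zero_apply] at h1 h2
    linarith
  have hnn : ∀ n, 0 ≤ (avgL d ^ n) (fun y => c * f y ^ 5) x := fun n =>
    avgL_pow_nonneg (fun y => mul_nonneg hc.le (pow_nonneg (hfpos y).le 5)) n x
  have h5 : Tendsto (fun n => (avgL d ^ n) (fun y => c * f y ^ 5) x) atTop (nhds 0) :=
    (summable_of_sum_range_le hnn hsum).tendsto_atTop_zero
  have hsmul : ∀ (a : ℝ) (g : Zd d → ℝ) n, (avgL d ^ n) (fun y => a * g y) x =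
      a * (avgL d ^ n) g x := by
    intro a g n
    have : (fun y => a * g y) = a • g := rfl
    rw [this, map_smul]; rfl
  have hfdecay : Tendsto (fun n => (avgL d ^ n) f x) atTop (nhds 0) := by
    rw [Metric.tendsto_atTop]
    intro ε hε
    obtain ⟨N, hN⟩ := (Metric.tendsto_atTop.1 h5) (c * (ε / 2) ^ 4 * (ε / 2)) (by positivity)
    refine ⟨N, fun n hn => ?_⟩
    have h6 := hN n hn
    have h7 : 0 ≤ (avgL d ^ n) f x := avgL_pow_nonneg (fun y => (hfpos y).le) n x
    rw [Real.dist_eq, sub_zero, abs_of_nonneg h7]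
    rw [Real.dist_eq, sub_zero, abs_of_nonneg (hnn n), hsmul] at h6
    have h8 : (avgL d ^ n) f ≤ (avgL d ^ n) ((fun _ => ε / 2) + fun y => ((ε / 2) ^ 4)⁻¹ * f y ^ 5) := by
      refine avgL_pow_mono (fun y => ?_) n
      have := hfpos y
      simp only [Pi.add_apply]
      rcases le_total (f y) (ε / 2) with h | h
      · have : 0 ≤ ((ε / 2) ^ 4)⁻¹ * f y ^ 5 := by positivity
        linarith
      · have h9 : (ε / 2) ^ 4 ≤ f y ^ 4 := by gcongr
        have : f y ≤ ((ε / 2) ^ 4)⁻¹ * f y ^ 5 := by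
          rw [inv_mul_eq_div, le_div_iff₀ (by positivity), pow_succ (f y), mul_comm]
          gcongr
        linarith
    have h9 := h8 x
    rw [map_add, avgL_pow_const hd0, Pi.add_apply, hsmul] at h9
    have h10 : (avgL d ^ n) (fun y => f y ^ 5) x < (ε / 2) ^ 4 * (ε / 2) := by
      rw [mul_assoc] at h6
      exact lt_of_mul_lt_mul_left h6 hc.le
    have h11 : ((ε / 2) ^ 4)⁻¹ * (avgL d ^ n) (fun y => f y ^ 5) x < ε / 2 := by
      rw [inv_mul_lt_iff₀ (by positivity)]
      exact h10
    linarith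
  obtain ⟨m, hm, hmK⟩ : ∃ m > 0, ∀ y ∈ K, m ≤ f y := by
    rcases K.eq_empty_or_nonempty with rfl | hK
    · exact ⟨1, one_pos, by simp⟩
    · obtain ⟨y, -, hy⟩ := K.exists_min_image f hK
      exact ⟨f y, hfpos y, hy⟩
  have hhit : hit (K : Set (Zd d)) ≤ fun y => m⁻¹ * f y := by
    intro y
    refine hit_le_of_superharmonic hd0 (f := fun y => m⁻¹ * f y)
      (fun y => mul_nonneg (by positivity) (hfpos y).le) (fun y hy => ?_) (fun y _ => ?_) y
    · rw [inv_mul_eq_div, le_div_iff₀ hm, one_mul]; exact hmK y hy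
    · rw [avg_mul]
      exact mul_le_mul_of_nonneg_left (hfle y) (by positivity)
  refine squeeze_zero (fun n => avgL_pow_nonneg (fun y => hit_nonneg hd0 _ y) n x)
    (fun n => avgL_pow_mono hhit n x) ?_
  simp only [hsmul]
  simpa using hfdecay.const_mul m⁻¹

end Iterates

section Duality

variable {d : ℕ}

lemma support_avgL {f : Zd d → ℝ} (hf : f.support.Finite) : (avgL d f).support.Finite := by
  have h : (avgL d f).support ⊆
      ⋃ p : Fin d × Bool, (fun x => nb x p) ⁻¹' f.support := by
    intro x hx
    by_contra hc
    simp only [Set.mem_iUnion, Set.mem_preimage, Function.mem_support, not_exists, not_not] at hc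
    refine hx ?_
    rw [avgL_apply, avg_eq_nb]
    simp [hc]
  refine (Set.finite_iUnion fun p => hf.preimage fun x _ y _ hxy => ?_).subset h
  cases hp : p.2 <;> simpa [nb, hp] using hxy

lemma tsum_mul_avgL {f : Zd d → ℝ} (hf : f.support.Finite) (g : Zd d → ℝ) :
    ∑' x, f x * avgL d g x = ∑' x, avgL d f x * g x := by
  have hs : ∀ (h k : Zd d → ℝ), h.support.Finite → Summable fun x => h x * k x := by
    intro h k hh
    refine summable_of_hasFiniteSupport (hh.subset ?_)
    exact Function.support_mul_subset_left h k
  have hs' : ∀ (z : Zd d) (k : Zd d → ℝ), Summable fun x => f (x + z) * k x := by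
    intro z k
    exact hs (fun x => f (x + z)) k (hf.preimage fun x _ y _ hxy => add_right_cancel hxy)
  have hshift : ∀ z : Zd d, ∑' x, f x * g (x + z) = ∑' x, f (x + -z) * g x := by
    intro z
    rw [← (Equiv.addRight z).tsum_eq (fun x => f (x + -z) * g x)]
    simp
  have e1 : ∀ x, f x * avgL d g x = (2 * d : ℝ)⁻¹ * ∑ i : Fin d, (f x * g (x + Pi.single i 1) +
      f x * g (x + -Pi.single i 1)) := by
    intro x
    simp only [avgL_apply, avg, smul_eq_mul, Finset.mul_sum, ← sub_eq_add_neg]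
    exact Finset.sum_congr rfl fun i _ => by ring
  have e2 : ∀ x, avgL d f x * g x = (2 * d : ℝ)⁻¹ * ∑ i : Fin d, (f (x + Pi.single i 1) * g x +
      f (x + -Pi.single i 1) * g x) := by
    intro x
    simp only [avgL_apply, avg, smul_eq_mul, Finset.mul_sum, Finset.sum_mul, ← sub_eq_add_neg]
    exact Finset.sum_congr rfl fun i _ => by ring
  simp only [e1, e2]
  rw [tsum_mul_left, tsum_mul_left, Summable.tsum_finsetSum, Summable.tsum_finsetSum]
  · congr 1
    refine Finset.sum_congr rfl fun i _ => ?_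
    rw [(hs f _ hf).tsum_add (hs f _ hf), (hs' _ g).tsum_add (hs' _ g), hshift, hshift, neg_neg,
      add_comm]
  · exact fun i _ => (hs' _ g).add (hs' _ g)
  · exact fun i _ => (hs f _ hf).add (hs f _ hf)

lemma tsum_mul_avgL_pow (n : ℕ) {f : Zd d → ℝ} (hf : f.support.Finite) (g : Zd d → ℝ) :
    ∑' x, f x * (avgL d ^ n) g x = ∑' x, (avgL d ^ n) f x * g x := by
  induction n generalizing f with
  | zero => rfl
  | succ n ih =>
    rw [pow_succ', Module.End.mul_apply, tsum_mul_avgL hf, ih (support_avgL hf), ← pow_succ',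
      pow_succ]
    rfl

lemma tsum_eqv_mul (K : Finset (Zd d)) (g : Zd d → ℝ) :
    ∑' x, eqv (K : Set (Zd d)) x * g x = ∑ x ∈ K, eqv (K : Set (Zd d)) x * g x :=
  tsum_eq_sum fun x hx => by simp [eqv, hx]

lemma eqv_support (K : Finset (Zd d)) : (eqv (K : Set (Zd d))).support.Finite :=
  K.finite_toSet.subset Set.support_indicator_subset

lemma eqv_hit_symm (hd : 3 ≤ d) (A K : Finset (Zd d)) :
    ∑ x ∈ K, eqv (K : Set (Zd d)) x * hit (A : Set (Zd d)) x =
      ∑ x ∈ A, eqv (A : Set (Zd d)) x * hit (K : Set (Zd d)) x := by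
  have hd0 : 0 < d := by omega
  have key : ∀ N, ∑ x ∈ K, eqv (K : Set (Zd d)) x * hit (A : Set (Zd d)) x -
      ∑ x ∈ A, eqv (A : Set (Zd d)) x * hit (K : Set (Zd d)) x =
      ∑ x ∈ K, eqv (K : Set (Zd d)) x * (avgL d ^ N) (hit (A : Set (Zd d))) x -
      ∑ x ∈ A, eqv (A : Set (Zd d)) x * (avgL d ^ N) (hit (K : Set (Zd d))) x := by
    intro N
    have h1 : ∀ B C : Finset (Zd d), ∑ x ∈ B, eqv (B : Set (Zd d)) x * hit (C : Set (Zd d)) x =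
        ∑ n ∈ Finset.range N, ∑' x, eqv (B : Set (Zd d)) x * (avgL d ^ n) (eqv (C : Set (Zd d))) x +
        ∑ x ∈ B, eqv (B : Set (Zd d)) x * (avgL d ^ N) (hit (C : Set (Zd d))) x := by
      intro B C
      simp only [tsum_eqv_mul]
      rw [Finset.sum_comm, ← Finset.sum_add_distrib]
      refine Finset.sum_congr rfl fun x _ => ?_
      conv_lhs => rw [hit_eq_sum hd0 _ N]
      rw [Pi.add_apply, Finset.sum_apply, mul_add, Finset.mul_sum]
    rw [h1 K A, h1 A K]
    have h2 : ∀ n, ∑' x, eqv (K : Set (Zd d)) x * (avgL d ^ n) (eqv (A : Set (Zd d))) x =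
        ∑' x, eqv (A : Set (Zd d)) x * (avgL d ^ n) (eqv (K : Set (Zd d))) x := by
      intro n
      rw [tsum_mul_avgL_pow n (eqv_support K)]
      exact tsum_congr fun x => mul_comm _ _
    simp only [h2]
    ring
  have ht : Tendsto (fun N => ∑ x ∈ K, eqv (K : Set (Zd d)) x *
      (avgL d ^ N) (hit (A : Set (Zd d))) x -
      ∑ x ∈ A, eqv (A : Set (Zd d)) x * (avgL d ^ N) (hit (K : Set (Zd d))) x) atTop
      (nhds (∑ x ∈ K, eqv (K : Set (Zd d)) x * 0 - ∑ x ∈ A, eqv (A : Set (Zd d)) x * 0)) :=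
    (tendsto_finsetSum _ fun x _ => (hit_decay hd A x).const_mul _).sub
      (tendsto_finsetSum _ fun x _ => (hit_decay hd K x).const_mul _)
  simp only [mul_zero, Finset.sum_const_zero, sub_zero, ← key] at ht
  exact sub_eq_zero.1 (tendsto_nhds_unique tendsto_const_nhds ht)

/-- Sweeping of the equilibrium measure. -/
lemma sum_eqv_hit (hd : 3 ≤ d) {A K : Finset (Zd d)} (h : A ⊆ K) :
    ∑ x ∈ K, eqv (K : Set (Zd d)) x * hit (A : Set (Zd d)) x = capv A := by
  rw [eqv_hit_symm hd]
  refine Finset.sum_congr rfl fun x hx => ?_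
  rw [hit_of_mem (by exact_mod_cast h hx), mul_one]

lemma card_le_capv (hd : 3 ≤ d) (D : Finset (Zd d)) {f : Zd d → ℝ} {C : ℝ} (h0 : ∀ x, 0 ≤ f x)
    (h1 : ∀ x, avg f x ≤ f x) (h2 : ∀ x ∈ D, avg f x + 1 ≤ f x) (hC : ∀ x, f x ≤ C) :
    (D.card : ℝ) ≤ C * capv D := by
  classical
  have hd0 : 0 < d := by omega
  set χ : Zd d → ℝ := (D : Set (Zd d)).indicator 1 with hχ
  have hχs : χ.support.Finite := D.finite_toSet.subset Set.support_indicator_subset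
  have hχm : ∀ g : Zd d → ℝ, ∑' x, χ x * g x = ∑ x ∈ D, g x := by
    intro g
    rw [tsum_eq_sum (s := D) fun x hx => by simp [hχ, hx]]
    exact Finset.sum_congr rfl fun x hx => by simp [hχ, hx]
  have hχf : χ ≤ f - avgL d f := by
    intro x
    by_cases hx : x ∈ D
    · have := h2 x hx
      simp only [hχ, Set.indicator_of_mem (Finset.mem_coe.2 hx), Pi.one_apply, Pi.sub_apply, avgL_apply]
      linarith
    · have := h1 x
      simp only [hχ, Set.indicator_of_notMem (fun h => hx (Finset.mem_coe.1 h)), Pi.sub_apply, avgL_apply]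
      linarith
  have key : ∀ N, (D.card : ℝ) ≤ C * capv D + ∑ x ∈ D, (avgL d ^ N) (hit (D : Set (Zd d))) x := by
    intro N
    have e1 : (D.card : ℝ) = ∑ x ∈ D, hit (D : Set (Zd d)) x := by
      rw [Finset.sum_congr rfl fun x hx => hit_of_mem (V := (D : Set (Zd d))) (by exact_mod_cast hx)]
      simp
    have e2 : ∑ x ∈ D, hit (D : Set (Zd d)) x =
        ∑ n ∈ Finset.range N, ∑ x ∈ D, eqv (D : Set (Zd d)) x * (avgL d ^ n) χ x +
        ∑ x ∈ D, (avgL d ^ N) (hit (D : Set (Zd d))) x := by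
      have : ∀ n, ∑ x ∈ D, eqv (D : Set (Zd d)) x * (avgL d ^ n) χ x =
          ∑ x ∈ D, (avgL d ^ n) (eqv (D : Set (Zd d))) x := by
        intro n
        rw [← tsum_eqv_mul, tsum_mul_avgL_pow n (eqv_support D), ← hχm]
        exact tsum_congr fun x => mul_comm _ _
      simp only [this]
      rw [Finset.sum_comm, ← Finset.sum_add_distrib]
      refine Finset.sum_congr rfl fun x _ => ?_
      conv_lhs => rw [hit_eq_sum hd0 _ N]
      rw [Pi.add_apply, Finset.sum_apply]
    rw [e1, e2]
    refine add_le_add_left ?_ _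
    rw [Finset.sum_comm, capv, Finset.mul_sum]
    refine Finset.sum_le_sum fun x _ => ?_
    rw [← Finset.mul_sum, mul_comm C]
    refine mul_le_mul_of_nonneg_left ?_ (eqv_nonneg _ x)
    have h3 : ∑ n ∈ Finset.range N, (avgL d ^ n) χ x ≤
        (∑ n ∈ Finset.range N, (avgL d ^ n) (f - avgL d f)) x := by
      rw [Finset.sum_apply]
      exact Finset.sum_le_sum fun n _ => avgL_pow_mono hχf n x
    rw [sum_avgL_pow] at h3
    have h4 := avgL_pow_nonneg (f := f) h0 N x
    have := hC x
    simp only [Pi.sub_apply, Pi.zero_apply] at h3 h4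
    linarith
  have ht : Tendsto (fun N => C * capv D + ∑ x ∈ D, (avgL d ^ N) (hit (D : Set (Zd d))) x) atTop
      (nhds (C * capv D + ∑ x ∈ D, 0)) :=
    (tendsto_finsetSum _ fun x _ => hit_decay hd D x).const_add _
  rw [Finset.sum_const_zero, add_zero] at ht
  exact ge_of_tendsto' ht key

lemma capv_le_card (hd : 3 ≤ d) (D S : Finset (Zd d)) {f : Zd d → ℝ} {M : ℝ} (hM : 0 ≤ M)
    (hf : f.support.Finite) (h1 : ∀ x ∈ D, 1 ≤ f x)
    (h2 : ∀ x ∈ S, f x - avg f x ≤ M) (h3 : ∀ x ∉ S, f x ≤ avg f x) :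
    capv D ≤ M * S.card := by
  classical
  have hd0 : 0 < d := by omega
  have hs : ∀ (h k : Zd d → ℝ), h.support.Finite → Summable fun x => h x * k x := by
    intro h k hh
    refine summable_of_hasFiniteSupport (hh.subset ?_)
    exact Function.support_mul_subset_left h k
  have e1 : capv D ≤ ∑' x, f x * eqv (D : Set (Zd d)) x := by
    have : ∑' x, f x * eqv (D : Set (Zd d)) x = ∑ x ∈ D, eqv (D : Set (Zd d)) x * f x := by
      rw [← tsum_eqv_mul]
      exact tsum_congr fun x => mul_comm _ _
    rw [this, capv]
    exact Finset.sum_le_sum fun x hx => le_mul_of_one_le_right (eqv_nonneg _ x) (h1 x hx)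
  have e2 : ∑' x, f x * eqv (D : Set (Zd d)) x =
      ∑' x, (f x - avgL d f x) * hit (D : Set (Zd d)) x := by
    have a1 : ∀ x, f x * eqv (D : Set (Zd d)) x = f x * hit (D : Set (Zd d)) x -
        f x * avgL d (hit (D : Set (Zd d))) x := by
      intro x
      rw [← hit_sub_avg hd0, mul_sub]; rfl
    simp only [a1, sub_mul]
    rw [(hs f _ hf).tsum_sub (hs f _ hf), (hs f _ hf).tsum_sub (hs _ _ (support_avgL hf)),
      tsum_mul_avgL hf]
  have e3 : ∑' x, (f x - avgL d f x) * hit (D : Set (Zd d)) x ≤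
      ∑' x, (S : Set (Zd d)).indicator (fun _ => M) x := by
    refine Summable.tsum_le_tsum (fun x => ?_) ?_ ?_
    · have ha := hit_nonneg hd0 (D : Set (Zd d)) x
      have hb := hit_le_one (D : Set (Zd d)) x
      rw [avgL_apply]
      by_cases hx : x ∈ S
      · have := h2 x hx
        rw [Set.indicator_of_mem (Finset.mem_coe.2 hx)]
        nlinarith
      · have := h3 x hx
        rw [Set.indicator_of_notMem (fun h => hx (Finset.mem_coe.1 h))]
        nlinarith
    · simp only [sub_mul]
      exact (hs f _ hf).sub (hs _ _ (support_avgL hf))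
    · exact summable_of_hasFiniteSupport (S.finite_toSet.subset Set.support_indicator_subset)
  have e4 : ∑' x, (S : Set (Zd d)).indicator (fun _ => M) x = M * S.card := by
    rw [tsum_eq_sum (s := S) fun x hx => by simp [hx],
      Finset.sum_congr rfl fun x hx => Set.indicator_of_mem (Finset.mem_coe.2 hx) _]
    simp [mul_comm]
  linarith

end Duality

section Boxes

variable {d : ℕ}

/-- The box of radius `M` around `z`. -/
noncomputable def bx (z : Zd d) (M : ℕ) : Finset (Zd d) := Finset.Icc (fun i => z i - M) (fun i => z i + M)

lemma mem_bx {z x : Zd d} {M : ℕ} : x ∈ bx z M ↔ ∀ i, |x i - z i| ≤ M := by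
  simp only [bx, Finset.mem_Icc, Pi.le_def, abs_le]
  constructor
  · rintro ⟨h1, h2⟩ i
    have := h1 i; have := h2 i
    constructor <;> linarith
  · intro h
    exact ⟨fun i => by have := (h i).1; linarith, fun i => by have := (h i).2; linarith⟩

lemma card_bx (z : Zd d) (M : ℕ) : (bx z M).card = (2 * M + 1) ^ d := by
  have : ∀ i : Fin d, (z i + M + 1 - (z i - M)).toNat = 2 * M + 1 := fun i => by omega
  rw [bx, Pi.card_Icc]
  simp only [Int.card_Icc, this]
  simp

lemma bx_mono (z : Zd d) {M M' : ℕ} (h : M ≤ M') : bx z M ⊆ bx z M' := by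
  intro x hx
  rw [mem_bx] at hx ⊢
  exact fun i => (hx i).trans (by exact_mod_cast h)

lemma nb_mem_bx {z x : Zd d} {M : ℕ} (h : x ∈ bx z M) (p : Fin d × Bool) : nb x p ∈ bx z (M + 1) := by
  rw [mem_bx] at h ⊢
  intro i
  have h1 := h i
  have h2 : |nb x p i - x i| ≤ 1 := by
    by_cases e : i = p.1
    · subst e; cases hp : p.2 <;> simp [nb, hp]
    · cases hp : p.2 <;> simp [nb, hp, e]
  have := abs_add_le (nb x p i - x i) (x i - z i)
  rw [sub_add_sub_cancel] at this
  push_cast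
  linarith

lemma nsq_le_of_mem_bx {x : Zd d} {M : ℕ} (h : x ∈ bx 0 M) : nsq x ≤ d * (M : ℝ) ^ 2 := by
  refine nsq_le fun i => ?_
  have := mem_bx.1 h i
  simp only [Pi.zero_apply, sub_zero] at this
  exact_mod_cast this

lemma le_nsq_of_notMem_bx {x : Zd d} {M : ℕ} (h : x ∉ bx 0 M) : (M : ℝ) ^ 2 ≤ nsq x := by
  simp only [mem_bx, not_forall, not_le, Pi.zero_apply, sub_zero] at h
  obtain ⟨i, hi⟩ := h
  refine le_trans ?_ (sq_le_nsq x i)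
  rw [← sq_abs (x i : ℝ)]
  have : (M : ℝ) < |(x i : ℝ)| := by exact_mod_cast hi
  gcongr

lemma eqv_translate (hd : 0 < d) (V : Set (Zd d)) (z x : Zd d) :
    eqv ((· + z) ⁻¹' V) x = eqv V (x + z) := by
  by_cases hx : x + z ∈ V <;> simp [eqv, Set.indicator, hx, Esc_translate hd]

lemma hit_translate (hd : 0 < d) (V : Set (Zd d)) (z x : Zd d) :
    hit ((· + z) ⁻¹' V) x = hit V (x + z) := by
  by_cases hx : x + z ∈ V <;> simp [hit, Set.indicator, hx, Esc_translate hd]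

lemma capv_translate (hd : 0 < d) (K : Finset (Zd d)) (z : Zd d) :
    capv (K.map (addRightEmbedding z)) = capv K := by
  unfold capv
  rw [Finset.sum_map]
  refine Finset.sum_congr rfl fun x _ => ?_
  have : (K : Set (Zd d)) = (· + z) ⁻¹' ((K.map (addRightEmbedding z) : Finset (Zd d)) : Set (Zd d)) := by
    ext y; simp
  conv_rhs => rw [this]
  rw [eqv_translate hd]
  rfl

lemma bx_translate (z : Zd d) (M : ℕ) : (bx 0 M).map (addRightEmbedding z) = bx z M := by
  ext x
  simp only [Finset.mem_map, addRightEmbedding_apply]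
  constructor
  · rintro ⟨y, hy, rfl⟩
    rw [mem_bx] at hy ⊢
    simpa using hy
  · intro hx
    refine ⟨x - z, ?_, sub_add_cancel x z⟩
    rw [mem_bx] at hx ⊢
    simpa using hx

lemma capv_bx (hd : 0 < d) (z : Zd d) (M : ℕ) : capv (bx z M) = capv (bx (0 : Zd d) M) := by
  rw [← bx_translate, capv_translate hd]

lemma hit_bx (hd : 0 < d) (z : Zd d) (M : ℕ) (x : Zd d) :
    hit (bx z M : Set (Zd d)) x = hit (bx (0 : Zd d) M : Set (Zd d)) (x - z) := by
  have : (bx (0 : Zd d) M : Set (Zd d)) = (· + z) ⁻¹' (bx z M : Set (Zd d)) := by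
    ext y; simp [mem_bx]
  rw [this, hit_translate hd, sub_add_cancel]

/-- Upper bound on the capacity of a box. -/
lemma capv_bx_le (hd : 3 ≤ d) {L : ℕ} (hL : 1 ≤ L) (z : Zd d) :
    capv (bx z (3 * L)) ≤ (13 * d : ℝ) ^ d * (L : ℝ) ^ (d - 2) := by
  have hd0 : 0 < d := by omega
  rw [capv_bx hd0]
  have hdr : (1 : ℝ) ≤ d := by exact_mod_cast hd0
  have hLr : (1 : ℝ) ≤ L := by exact_mod_cast hL
  set R : ℝ := 9 * d * L ^ 2 with hR
  have hRpos : 0 < R := by positivity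
  set p : ℝ → ℝ := fun t => (max 0 t) ^ 2 with hp
  have hpconv : ∀ t δ, p t + 2 * max 0 t * δ ≤ p (t + δ) := by
    intro t δ
    simp only [hp]
    rcases le_total 0 t with h | h <;> rcases le_total 0 (t + δ) with h' | h' <;>
      simp only [max_eq_right h, max_eq_right h', max_eq_left h, max_eq_left h'] <;>
      nlinarith [sq_nonneg δ]
  set f : Zd d → ℝ := fun x => p (2 - nsq x / R) with hf
  have hfz : ∀ x ∉ bx (0 : Zd d) (6 * d * L), f x = 0 := by
    intro x hx
    have h1 := le_nsq_of_notMem_bx hx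
    have h2 : 2 ≤ nsq x / R := by
      rw [le_div_iff₀ hRpos]
      refine le_trans ?_ h1
      rw [hR]; push_cast
      have : (0 : ℝ) ≤ (d : ℝ) * L ^ 2 * (d - 1) := by
        have : (0 : ℝ) ≤ (d : ℝ) - 1 := by linarith
        positivity
      nlinarith
    simp [hf, hp, max_eq_left (by linarith : 2 - nsq x / R ≤ 0)]
  have hfpos : ∀ x, 0 ≤ f x := fun x => sq_nonneg _
  have havg : ∀ x, f x - avg f x ≤ 4 / R := by
    intro x
    set t := 2 - nsq x / R with ht
    have h1 : ∑ i : Fin d, (2 * p t - 4 * max 0 t / R) ≤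
        ∑ i : Fin d, (f (x + Pi.single i 1) + f (x - Pi.single i 1)) := by
      refine Finset.sum_le_sum fun i _ => ?_
      have a1 := hpconv t (-(2 * x i + 1) / R)
      have a2 := hpconv t (-(-2 * x i + 1) / R)
      have b1 : f (x + Pi.single i 1) = p (t + -(2 * x i + 1) / R) := by
        simp only [hf, nsq_add_single, ht]; congr 1; ring
      have b2 : f (x - Pi.single i 1) = p (t + -(-2 * x i + 1) / R) := by
        simp only [hf, nsq_sub_single, ht]; congr 1; ring
      rw [b1, b2]
      have : 2 * max 0 t * (-(2 * x i + 1) / R) + 2 * max 0 t * (-(-2 * x i + 1) / R) =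
        -(4 * max 0 t / R) := by ring
      linarith
    have h2 := smul_le_smul_of_nonneg_left h1 (show (0 : ℝ) ≤ (2 * d : ℝ)⁻¹ by positivity)
    rw [← avg] at h2
    have h3 : (2 * d : ℝ)⁻¹ • ∑ i : Fin d, (2 * p t - 4 * max 0 t / R) = p t - 2 * max 0 t / R := by
      simp
      field_simp
      ring
    rw [h3] at h2
    have h4 : max 0 t ≤ 2 := by
      refine max_le (by norm_num) ?_
      have : 0 ≤ nsq x / R := div_nonneg (nsq_nonneg x) hRpos.le
      linarith
    have h5 : 2 * max 0 t / R ≤ 4 / R := by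
      gcongr; linarith
    change p t - avg f x ≤ _
    linarith
  have h := capv_le_card hd (bx 0 (3 * L)) (bx 0 (6 * d * L)) (f := f) (M := 4 / R) (by positivity)
    ((bx (0 : Zd d) (6 * d * L)).finite_toSet.subset fun x hx => by
      by_contra hc; exact hx (hfz x hc))
    (fun x hx => ?_) (fun x _ => havg x) (fun x hx => ?_)
  · refine h.trans ?_
    rw [card_bx]
    have e : ((((2 * (6 * d * L) + 1) ^ d : ℕ)) : ℝ) ≤ (13 * d * L : ℝ) ^ d := by
      push_cast
      gcongr
      nlinarith
    have e2 : 4 / R ≤ 1 / (L : ℝ) ^ 2 := by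
      rw [div_le_div_iff₀ hRpos (by positivity), hR]
      nlinarith [show (0 : ℝ) < (L : ℝ) ^ 2 by positivity]
    have e3 : (L : ℝ) ^ d = (L : ℝ) ^ (d - 2) * (L : ℝ) ^ 2 := by rw [← pow_add]; congr 1; omega
    calc 4 / R * ((((2 * (6 * d * L) + 1) ^ d : ℕ)) : ℝ) ≤ 1 / (L : ℝ) ^ 2 * (13 * d * L : ℝ) ^ d := by
          gcongr
      _ = (13 * d : ℝ) ^ d * (L : ℝ) ^ (d - 2) := by
          rw [mul_pow _ (L : ℝ), e3]; field_simp
  · have h1 := nsq_le_of_mem_bx hx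
    have h2 : nsq x / R ≤ 1 := by
      rw [div_le_one hRpos, hR]
      push_cast at h1
      linarith
    have h3 : 1 ≤ max 0 (2 - nsq x / R) := le_max_of_le_right (by linarith)
    simp only [hf, hp]
    nlinarith
  · rw [hfz x hx]
    exact avg_nonneg hfpos x

lemma bx_superharmonic (hd : 3 ≤ d) : ∃ (c : ℝ) (L₁ : ℕ), 0 < c ∧ 1 ≤ L₁ ∧ ∀ L : ℕ, L₁ ≤ L → ∀ x : Zd d,
    avg (radf ((L : ℝ) ^ 2) (1 / 4)) x ≤
      radf ((L : ℝ) ^ 2) (1 / 4) x - c * radf ((L : ℝ) ^ 2) (1 / 4 + 1) x := by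
  have hd3 : (3 : ℝ) ≤ d := by exact_mod_cast hd
  obtain ⟨A, hA1, c, hc, hsup⟩ := radf_superharmonic (d := d) (β := 1 / 4) (by norm_num) (by omega)
    (by linarith)
  obtain ⟨n, hn⟩ := exists_nat_ge A
  refine ⟨c, max n 1, hc, le_max_right _ _, fun L hL x => hsup _ ?_ x⟩
  have h1 : (n : ℝ) ≤ L := by exact_mod_cast (le_max_left _ _).trans hL
  have h2 : (1 : ℝ) ≤ L := by exact_mod_cast (le_max_right _ _).trans hL
  nlinarith

/-- Lower bound on the capacity of a box. -/
lemma le_capv_bx (hd : 3 ≤ d) : ∃ (c : ℝ) (L₁ : ℕ), 0 < c ∧ 1 ≤ L₁ ∧ ∀ L : ℕ, L₁ ≤ L → ∀ z : Zd d,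
    c * (L : ℝ) ^ (d - 2) ≤ capv (bx z (3 * L)) := by
  have hd0 : 0 < d := by omega
  obtain ⟨c, L₁, hc, hL₁, hsup⟩ := bx_superharmonic hd
  set κ : ℝ := (1 + 9 * d) ^ (5 / 4 : ℝ) / c with hκ
  have hκpos : 0 < κ := by positivity
  refine ⟨κ⁻¹, L₁, by positivity, hL₁, fun L hL z => ?_⟩
  rw [capv_bx hd0]
  have hL0 : (0 : ℝ) < L := by exact_mod_cast (by omega : 0 < L)
  have hL2 : (0 : ℝ) < (L : ℝ) ^ 2 := by positivity
  set a : ℝ := ((1 + 9 * d) * (L : ℝ) ^ 2) ^ (5 / 4 : ℝ) / c with ha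
  have hapos : 0 < a := by positivity
  have h := card_le_capv hd (bx 0 (3 * L)) (f := fun x => a * radf ((L : ℝ) ^ 2) (1 / 4) x)
    (C := κ * (L : ℝ) ^ 2) (fun x => mul_nonneg hapos.le (radf_nonneg hL2.le _ _)) (fun x => ?_)
    (fun x hx => ?_) (fun x => ?_)
  · rw [card_bx] at h
    have e3 : (L : ℝ) ^ d = (L : ℝ) ^ (d - 2) * (L : ℝ) ^ 2 := by rw [← pow_add]; congr 1; omega
    have e4 : (L : ℝ) ^ d ≤ (((2 * (3 * L) + 1) ^ d : ℕ) : ℝ) := by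
      push_cast; gcongr; linarith
    rw [e3] at e4
    rw [inv_mul_le_iff₀ hκpos]
    have := e4.trans h
    nlinarith
  · rw [avg_mul]
    refine mul_le_mul_of_nonneg_left ((hsup L hL x).trans (sub_le_self _ ?_)) hapos.le
    exact mul_nonneg hc.le (radf_nonneg hL2.le _ _)
  · rw [avg_mul]
    have h1 := hsup L hL x
    have h2 : 1 ≤ a * (c * radf ((L : ℝ) ^ 2) (1 / 4 + 1) x) := by
      have h3 := nsq_le_of_mem_bx hx
      have h4 : (L : ℝ) ^ 2 + nsq x ≤ (1 + 9 * d) * (L : ℝ) ^ 2 := by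
        push_cast at h3; nlinarith
      have h5 : ((1 + 9 * d) * (L : ℝ) ^ 2) ^ (-(5 / 4) : ℝ) ≤ radf ((L : ℝ) ^ 2) (1 / 4 + 1) x := by
        unfold radf
        norm_num
        exact Real.rpow_le_rpow_of_nonpos (add_pos_of_pos_of_nonneg hL2 (nsq_nonneg x)) h4
          (by norm_num)
      have h6 : a * (c * ((1 + 9 * d) * (L : ℝ) ^ 2) ^ (-(5 / 4) : ℝ)) = 1 := by
        rw [ha, Real.rpow_neg (by positivity)]
        field_simp
      refine h6.symm.le.trans ?_
      gcongr
    nlinarith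
  · have h1 : radf ((L : ℝ) ^ 2) (1 / 4) x ≤ ((L : ℝ) ^ 2) ^ (-(1 / 4) : ℝ) := by
      unfold radf
      exact Real.rpow_le_rpow_of_nonpos hL2 (by linarith [nsq_nonneg x]) (by norm_num)
    have h2 : a * ((L : ℝ) ^ 2) ^ (-(1 / 4) : ℝ) = κ * (L : ℝ) ^ 2 := by
      rw [ha, hκ, Real.mul_rpow (by positivity) hL2.le]
      have : ((L : ℝ) ^ 2) ^ (5 / 4 : ℝ) * ((L : ℝ) ^ 2) ^ (-(1 / 4) : ℝ) = (L : ℝ) ^ 2 := by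
        rw [← Real.rpow_add hL2]; norm_num
      rw [div_mul_eq_mul_div, mul_assoc, this, div_mul_eq_mul_div]
    rw [← h2]
    exact mul_le_mul_of_nonneg_left h1 hapos.le

/-- Far away from a box, it is hit with probability at most one half. -/
lemma hit_bx_le_half (hd : 3 ≤ d) : ∃ L₁ : ℕ, 1 ≤ L₁ ∧ ∀ L : ℕ, L₁ ≤ L → ∀ z x : Zd d,
    16 * (1 + 9 * d) * (L : ℝ) ^ 2 ≤ nsq (x - z) → hit (bx z (3 * L) : Set (Zd d)) x ≤ 1 / 2 := by
  have hd0 : 0 < d := by omega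
  obtain ⟨c, L₁, hc, hL₁, hsup⟩ := bx_superharmonic hd
  refine ⟨L₁, hL₁, fun L hL z x hx => ?_⟩
  rw [hit_bx hd0]
  set y := x - z
  have hL0 : (0 : ℝ) < L := by exact_mod_cast (by omega : 0 < L)
  have hL2 : (0 : ℝ) < (L : ℝ) ^ 2 := by positivity
  set a : ℝ := ((1 + 9 * d) * (L : ℝ) ^ 2) ^ (1 / 4 : ℝ) with ha
  have hapos : 0 < a := by positivity
  refine (hit_le_of_superharmonic hd0 (f := fun x => a * radf ((L : ℝ) ^ 2) (1 / 4) x)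
    (fun x => mul_nonneg hapos.le (radf_nonneg hL2.le _ _)) (fun x hx => ?_) (fun x _ => ?_) y).trans ?_
  · have h3 := nsq_le_of_mem_bx (Finset.mem_coe.1 hx)
    have h4 : (L : ℝ) ^ 2 + nsq x ≤ (1 + 9 * d) * (L : ℝ) ^ 2 := by
      push_cast at h3; nlinarith
    have h5 : ((1 + 9 * d) * (L : ℝ) ^ 2) ^ (-(1 / 4) : ℝ) ≤ radf ((L : ℝ) ^ 2) (1 / 4) x :=
      Real.rpow_le_rpow_of_nonpos (add_pos_of_pos_of_nonneg hL2 (nsq_nonneg x)) h4 (by norm_num)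
    have h6 : a * ((1 + 9 * d) * (L : ℝ) ^ 2) ^ (-(1 / 4) : ℝ) = 1 := by
      rw [ha, ← Real.rpow_add (by positivity)]; norm_num
    refine h6.symm.le.trans ?_
    gcongr
  · rw [avg_mul]
    refine mul_le_mul_of_nonneg_left ((hsup L hL x).trans (sub_le_self _ ?_)) hapos.le
    exact mul_nonneg hc.le (radf_nonneg hL2.le _ _)
  · have h1 : radf ((L : ℝ) ^ 2) (1 / 4) y ≤ (16 * ((1 + 9 * d) * (L : ℝ) ^ 2)) ^ (-(1 / 4) : ℝ) :=
      Real.rpow_le_rpow_of_nonpos (by positivity) (by nlinarith) (by norm_num)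
    have h2 : a * (16 * ((1 + 9 * d) * (L : ℝ) ^ 2)) ^ (-(1 / 4) : ℝ) = 1 / 2 := by
      rw [Real.mul_rpow (by norm_num) (by positivity), mul_comm, mul_assoc, ha,
        ← Real.rpow_add (by positivity)]
      have : (16 : ℝ) ^ (-(1 / 4) : ℝ) = 1 / 2 := by
        rw [show (16 : ℝ) = 2 ^ (4 : ℝ) by norm_num, ← Real.rpow_mul (by norm_num)]
        norm_num
      rw [this]; norm_num
    rw [← h2]
    gcongr

end Boxes

section HittingKernel

variable {d : ℕ}

open Classical in
/-- Probability that the walk from `y` hits `V` within `N` steps, and does so first at `z ∈ V`. -/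
noncomputable def kap (V : Set (Zd d)) (z : Zd d) : ℕ → Zd d → ℝ
  | 0 => fun y => if y = z then 1 else 0
  | N + 1 => fun y => if y ∈ V then (if y = z then 1 else 0) else avg (kap V z N) y

lemma kap_nonneg (V : Set (Zd d)) (z : Zd d) (N : ℕ) (y : Zd d) : 0 ≤ kap V z N y := by
  induction N generalizing y with
  | zero => simp only [kap]; split_ifs <;> norm_num
  | succ N ih =>
    simp only [kap]
    split_ifs
    · norm_num
    · norm_num
    · exact avg_nonneg ih y

lemma kap_self {V : Set (Zd d)} {z : Zd d} (hz : z ∈ V) (N : ℕ) : kap V z N z = 1 := by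
  cases N <;> simp [kap, hz]

/-- The one-step operator of the walk killed on `V`. -/
noncomputable def killL (V : Set (Zd d)) : (Zd d → ℝ) →ₗ[ℝ] (Zd d → ℝ) where
  toFun f := Vᶜ.indicator (avgL d (Vᶜ.indicator f))
  map_add' f g := by rw [Set.indicator_add', map_add, Set.indicator_add']
  map_smul' c f := by
    have h : ∀ g : Zd d → ℝ, Vᶜ.indicator (c • g) = c • Vᶜ.indicator g := fun g =>
      Set.indicator_const_smul Vᶜ c g
    rw [h, map_smul, h]
    rfl

lemma killL_apply (V : Set (Zd d)) (f : Zd d → ℝ) :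
    killL V f = Vᶜ.indicator (avgL d (Vᶜ.indicator f)) := rfl

lemma support_killL (V : Set (Zd d)) {f : Zd d → ℝ} (hf : f.support.Finite) :
    (killL V f).support.Finite := by
  rw [killL_apply]
  refine (support_avgL (f := Vᶜ.indicator f) (hf.subset ?_)).subset ?_
  · rw [Set.support_indicator]; exact Set.inter_subset_right
  · rw [Set.support_indicator]; exact Set.inter_subset_right

lemma tsum_mul_killL (V : Set (Zd d)) {f : Zd d → ℝ} (hf : f.support.Finite) (g : Zd d → ℝ) :
    ∑' x, f x * killL V g x = ∑' x, killL V f x * g x := by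
  have h : (Vᶜ.indicator f).support.Finite :=
    hf.subset (by rw [Set.support_indicator]; exact Set.inter_subset_right)
  have := tsum_mul_avgL h (Vᶜ.indicator g)
  refine Eq.trans (tsum_congr fun x => ?_) (this.trans (tsum_congr fun x => ?_))
  · by_cases hx : x ∈ V <;> simp [killL_apply, hx]
  · by_cases hx : x ∈ V <;> simp [killL_apply, hx]

lemma tsum_mul_killL_pow (V : Set (Zd d)) (n : ℕ) {f : Zd d → ℝ} (hf : f.support.Finite)
    (g : Zd d → ℝ) :
    ∑' x, f x * (killL V ^ n) g x = ∑' x, (killL V ^ n) f x * g x := by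
  induction n generalizing f with
  | zero => rfl
  | succ n ih =>
    rw [pow_succ', Module.End.mul_apply, tsum_mul_killL V hf, ih (support_killL V hf), ← pow_succ',
      pow_succ]
    rfl

/-- The Green function of the walk from `y` killed on `V` and after `N` steps. -/
noncomputable def killG (V : Set (Zd d)) (y : Zd d) (N : ℕ) : Zd d → ℝ :=
  ∑ n ∈ Finset.range N, (killL V ^ n) (Pi.single y 1)

lemma killG_succ (V : Set (Zd d)) (y : Zd d) (N : ℕ) :
    killG V y (N + 1) = Pi.single y 1 + killL V (killG V y N) := by
  rw [killG, Finset.sum_range_succ', killG, map_sum, add_comm]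
  congr 1
  exact Finset.sum_congr rfl fun n _ => by rw [pow_succ', Module.End.mul_apply]

lemma killG_of_mem {V : Set (Zd d)} {x y : Zd d} (hy : y ∉ V) (hx : x ∈ V) (N : ℕ) :
    killG V y N x = 0 := by
  cases N with
  | zero => simp [killG]
  | succ N =>
    rw [killG_succ, Pi.add_apply, killL_apply, Set.indicator_of_notMem (by simpa using hx),
      Pi.single_eq_of_ne (by rintro rfl; exact hy hx)]
    simp

lemma kap_eq_sum {V : Set (Zd d)} {z : Zd d} (hz : z ∈ V) (N : ℕ) :
    Vᶜ.indicator (kap V z N) =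
      ∑ n ∈ Finset.range N, (killL V ^ n) (Vᶜ.indicator (avgL d (Pi.single z 1))) := by
  have hsplit : ∀ N, kap V z N = Pi.single z 1 + Vᶜ.indicator (kap V z N) := by
    intro N
    funext x
    by_cases hx : x ∈ V
    · cases N <;> simp [kap, hx, Pi.single_apply]
    · have : x ≠ z := by rintro rfl; exact hx hz
      simp [hx, this]
  induction N with
  | zero =>
    funext x
    by_cases hx : x ∈ V
    · simp [hx]
    · have : x ≠ z := by rintro rfl; exact hx hz
      simp [kap, hx, this]
  | succ N ih =>
    rw [Finset.sum_range_succ']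
    simp only [pow_succ', Module.End.mul_apply, ← map_sum, ← ih]
    funext x
    by_cases hx : x ∈ V
    · simp [hx, killL_apply]
    · have h1 : kap V z (N + 1) x = avgL d (kap V z N) x := by simp [kap, hx, avgL_apply]
      have h2 : avgL d (kap V z N) = avgL d (Pi.single z 1) + avgL d (Vᶜ.indicator (kap V z N)) := by
        conv_lhs => rw [hsplit N, map_add]
      rw [Set.indicator_of_mem (by simpa using hx), h1, h2]
      simp [hx, killL_apply, add_comm, Set.indicator_indicator]

/-- Reversibility: the hitting kernel in terms of the killed Green function. -/
lemma kap_eq_avg_killG {V : Set (Zd d)} {y z : Zd d} (hy : y ∉ V) (hz : z ∈ V) (N : ℕ) :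
    kap V z N y = avg (killG V y N) z := by
  classical
  have hfin : ∀ w : Zd d, (Pi.single w (1 : ℝ) : Zd d → ℝ).support.Finite := fun w =>
    (Set.finite_singleton w).subset (Pi.support_single_subset)
  have hpow : ∀ n, ((killL V ^ n) (Pi.single y 1)).support.Finite := by
    intro n
    induction n with
    | zero => exact hfin y
    | succ n ih => rw [pow_succ']; exact support_killL V ih
  have hGfin : (killG V y N).support.Finite := by
    unfold killG
    refine Finset.sum_induction _ (fun f : Zd d → ℝ => f.support.Finite) (fun f g hf hg =>
      (hf.union hg).subset (Function.support_add f g)) (by simp) fun n _ => hpow n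
  have hmul : ∀ (f g : Zd d → ℝ), f.support.Finite → Summable fun x => f x * g x := fun f g hf =>
    summable_of_hasFiniteSupport (hf.subset (Function.support_mul_subset_left f g))
  have h1 : kap V z N y = ∑' x, (Pi.single y (1 : ℝ) : Zd d → ℝ) x * Vᶜ.indicator (kap V z N) x := by
    rw [tsum_eq_single y (fun x hx => by simp [Pi.single_eq_of_ne hx])]
    simp [hy]
  have h2 : ∑' x, (Pi.single y (1 : ℝ) : Zd d → ℝ) x * Vᶜ.indicator (kap V z N) x =
      ∑' x, killG V y N x * Vᶜ.indicator (avgL d (Pi.single z 1)) x := by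
    rw [kap_eq_sum hz]
    simp only [killG, Finset.sum_apply, Finset.mul_sum, Finset.sum_mul]
    rw [Summable.tsum_finsetSum fun n _ => hmul _ _ (hfin y),
      Summable.tsum_finsetSum fun n _ => hmul _ _ (hpow n)]
    exact Finset.sum_congr rfl fun n _ => tsum_mul_killL_pow V n (hfin y) _
  have h3 : ∑' x, killG V y N x * Vᶜ.indicator (avgL d (Pi.single z 1)) x =
      ∑' x, killG V y N x * avgL d (Pi.single z 1) x := by
    refine tsum_congr fun x => ?_
    by_cases hx : x ∈ V
    · simp [killG_of_mem hy hx]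
    · simp [hx]
  rw [h1, h2, h3, tsum_mul_avgL hGfin, tsum_eq_single z (fun x hx => by simp [Pi.single_eq_of_ne hx])]
  simp [avgL_apply]

lemma killG_le (hd : 3 ≤ d) : ∃ C A : ℝ, 0 < C ∧ 1 ≤ A ∧ ∀ (V : Set (Zd d)) (y : Zd d) (N : ℕ) (x : Zd d),
    killG V y N x ≤ C * radf A (((d : ℝ) - 2) / 2 - 1 / 800) (x - y) := by
  have hd3 : (3 : ℝ) ≤ d := by exact_mod_cast hd
  set β : ℝ := ((d : ℝ) - 2) / 2 - 1 / 800 with hβ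
  obtain ⟨A, hA, c, hc, hsup⟩ := radf_superharmonic (d := d) (β := β) (by linarith) (by omega)
    (by linarith)
  have hA0 : (0 : ℝ) < A := by linarith
  set C : ℝ := A ^ (β + 1) / c with hC
  have hCpos : 0 < C := by positivity
  refine ⟨C, A, hCpos, hA, fun V y N => ?_⟩
  have hpos : ∀ x : Zd d, 0 ≤ C * radf A β (x - y) := fun x => mul_nonneg hCpos.le (radf_nonneg hA0.le _ _)
  induction N with
  | zero => intro x; simpa [killG] using hpos x
  | succ N ih =>
    intro x
    rw [killG_succ, Pi.add_apply, killL_apply]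
    have h1 : Vᶜ.indicator (avgL d (Vᶜ.indicator (killG V y N))) x ≤
        avg (fun x => C * radf A β (x - y)) x := by
      have h2 : avg (Vᶜ.indicator (killG V y N)) x ≤ avg (fun x => C * radf A β (x - y)) x :=
        avg_mono (fun w => by
          by_cases hw : w ∈ V
          · simpa [hw] using hpos w
          · simpa [hw] using ih w) x
      by_cases hx : x ∈ V
      · simpa [hx] using avg_nonneg hpos x
      · simpa [hx, avgL_apply] using h2
    have h3 : avg (fun x => C * radf A β (x - y)) x = C * avg (radf A β) (x - y) := by
      rw [avg_mul]
      congr 1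
      simpa [sub_eq_add_neg] using avg_translate (radf A β) (-y) x
    have h4 := mul_le_mul_of_nonneg_left (hsup A le_rfl (x - y)) hCpos.le
    have h5 : (Pi.single y (1 : ℝ) : Zd d → ℝ) x ≤ C * (c * radf A (β + 1) (x - y)) := by
      by_cases hxy : x = y
      · subst hxy
        simp only [Pi.single_eq_same, sub_self]
        have : C * (c * radf A (β + 1) (0 : Zd d)) = 1 := by
          simp only [radf, nsq, Pi.zero_apply]
          norm_num
          rw [hC, show (-1 + -β) = -(β + 1) by ring, Real.rpow_neg hA0.le]
          field_simp
        exact this.ge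
      · rw [Pi.single_eq_of_ne hxy]
        exact mul_nonneg hCpos.le (mul_nonneg hc.le (radf_nonneg hA0.le _ _))
    linarith

/-- Far from a box, its hitting distribution is dominated by a small multiple of its escape
probabilities. -/
lemma kap_le (hd : 3 ≤ d) : ∃ (C : ℝ) (L₁ : ℕ), 0 < C ∧ 1 ≤ L₁ ∧ ∀ L : ℕ, L₁ ≤ L → ∀ m : ℕ, d ≤ m →
    ∀ z y : Zd d, y ∉ bx z (40 * m * L) → ∀ N, ∀ x ∈ bx z (3 * L),
      kap (bx z (3 * L)) x N y ≤
        C * ((m * L : ℕ) : ℝ) ^ (-((d : ℝ) - 2 - 1 / 400)) * Esc (bx z (3 * L)) x := by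
  have hd0 : 0 < d := by omega
  have hd3 : (3 : ℝ) ≤ d := by exact_mod_cast hd
  obtain ⟨C, A, hC, hA, hG⟩ := killG_le hd
  obtain ⟨L₁, hL₁, hhalf⟩ := hit_bx_le_half hd
  refine ⟨2 * C, L₁, by positivity, hL₁, fun L hL m hm z y hy N x hx => ?_⟩
  set V : Set (Zd d) := (bx z (3 * L) : Set (Zd d)) with hV
  set R := 20 * m * L with hR
  have hLpos : 0 < L := by omega
  have hmpos : 0 < m := by omega
  have hmL : 0 < m * L := Nat.mul_pos hmpos hLpos
  have hRL : 3 * L ≤ R := by rw [hR]; nlinarith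
  have hyR : y ∉ bx z (R + 1) := fun h => hy (bx_mono z (by rw [hR]; nlinarith) h)
  have hyV : y ∉ V := fun h => hyR (bx_mono z (by omega) (Finset.mem_coe.1 h))
  set β : ℝ := ((d : ℝ) - 2) / 2 - 1 / 800 with hβ
  set M : ℝ := C * ((m * L : ℕ) : ℝ) ^ (-((d : ℝ) - 2 - 1 / 400)) with hM
  have hmLr : (0 : ℝ) < ((m * L : ℕ) : ℝ) := by exact_mod_cast hmL
  have hMpos : 0 < M := by positivity
  set ψ : Zd d → ℝ := Vᶜ.indicator (Esc V) with hψ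
  have hψ0 : ∀ x, 0 ≤ ψ x := fun x => Set.indicator_nonneg (fun _ _ => Esc_nonneg V _) x
  have hfar : ∀ w ∈ bx z (R + 1), C * radf A β (w - y) ≤ M := by
    intro w hw
    rw [mem_bx] at hw hy
    push Not at hy
    obtain ⟨i, hi⟩ := hy
    have h1 : ((m * L : ℕ) : ℝ) ≤ |((w - y) i : ℝ)| := by
      have a := hw i
      have b := abs_sub_le (y i) (w i) (z i)
      have e : |(w - y) i| = |y i - w i| := by rw [Pi.sub_apply, abs_sub_comm]
      have : ((m * L : ℕ) : ℤ) ≤ |(w - y) i| := by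
        rw [e, hR] at *
        push_cast at *
        nlinarith
      exact_mod_cast this
    have h2 : ((m * L : ℕ) : ℝ) ^ 2 ≤ A + nsq (w - y) := by
      have a := sq_le_nsq (w - y) i
      have b : ((m * L : ℕ) : ℝ) ^ 2 ≤ |((w - y) i : ℝ)| ^ 2 := by gcongr
      rw [sq_abs] at b
      linarith
    rw [hM]
    refine mul_le_mul_of_nonneg_left ?_ hC.le
    have h3 : radf A β (w - y) ≤ (((m * L : ℕ) : ℝ) ^ 2) ^ (-β) :=
      Real.rpow_le_rpow_of_nonpos (by positivity) h2 (by rw [hβ]; linarith)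
    refine h3.trans_eq ?_
    rw [← Real.rpow_natCast, ← Real.rpow_mul hmLr.le]
    congr 1
    rw [hβ]; push_cast; ring
  have key : ∀ N, ∀ w ∈ bx z (R + 1), killG V y N w ≤ 2 * M * ψ w := by
    intro N
    induction N with
    | zero => intro w _; simpa [killG] using mul_nonneg (by positivity) (hψ0 w)
    | succ N ih =>
      intro w hw
      by_cases hwR : w ∈ bx z R
      · rw [killG_succ, Pi.add_apply, killL_apply,
          Pi.single_eq_of_ne (by rintro rfl; exact hyR hw), zero_add]
        by_cases hwV : w ∈ V
        · simpa [hwV] using mul_nonneg (by positivity) (hψ0 w)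
        · rw [Set.indicator_of_mem (by simpa using hwV), avgL_apply]
          have e : ψ w = avg ψ w := by
            rw [hψ, ← Esc_eq hd0, Set.indicator_of_mem (by simpa using hwV)]
          rw [e, ← avg_mul]
          have nbm : ∀ v ∈ bx z (R + 1), Vᶜ.indicator (killG V y N) v ≤ 2 * M * ψ v := by
            intro v hv
            by_cases hvV : v ∈ V
            · simpa [hvV] using mul_nonneg (by positivity) (hψ0 v)
            · rw [Set.indicator_of_mem (by simpa using hvV)]; exact ih v hv
          refine avg_mono_nb (fun i => nbm _ ?_) fun i => nbm _ ?_
          · simpa [nb] using nb_mem_bx hwR (i, true)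
          · simpa [nb] using nb_mem_bx hwR (i, false)
      · have h1 := (hG V y (N + 1) w).trans (hfar w hw)
        have h2 : 1 / 2 ≤ ψ w := by
          have h3 := hhalf L hL z w (by
            have h4 : w - z ∉ bx 0 R := by
              intro h; apply hwR
              rw [mem_bx] at h ⊢
              simpa using h
            have h5 := le_nsq_of_notMem_bx h4
            refine le_trans ?_ h5
            have hmd : (d : ℝ) ≤ m := by exact_mod_cast hm
            rw [hR]
            push_cast
            rw [mul_pow]
            gcongr
            nlinarith)
          have h4 : hit V w = 1 - ψ w := rfl
          linarith
        nlinarith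
  rw [kap_eq_avg_killG hyV (by exact hx)]
  have h1 : avg (killG V y N) x ≤ avg (fun w => 2 * M * ψ w) x := by
    have hx' : x ∈ bx z R := bx_mono z hRL hx
    refine avg_mono_nb (fun i => key N _ ?_) fun i => key N _ ?_
    · simpa [nb] using nb_mem_bx hx' (i, true)
    · simpa [nb] using nb_mem_bx hx' (i, false)
  refine h1.trans_eq ?_
  rw [avg_mul, hψ, ← Esc_eq hd0, hM]
  ring

end HittingKernel

section WalkOperators

variable {d : ℕ} {α : Type*} [Fintype α] [SemilatticeSup α] [OrderBot α]

open Classical in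
/-- The convolution operator of the join of the marks `ι` collected by the walk from `x` during
`N` steps, stopped on leaving `B`. -/
noncomputable def wop (ι : Zd d → α) (B : Set (Zd d)) : ℕ → Zd d → Op α
  | 0 => fun x => shift (ι x)
  | N + 1 => fun x => shift (ι x) * (if x ∈ B then avg (wop ι B N) x else 1)

lemma avg_op_apply (f : Zd d → Op α) (x : Zd d) (F : α → ℝ) (a : α) :
    avg f x F a = avg (fun y => f y F a) x := by
  let φ : Op α →ₗ[ℝ] ℝ :=
    { toFun := fun U => U F a
      map_add' := fun U V => by simp
      map_smul' := fun c U => by simp }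
  exact map_avg φ f x

variable {ι : Zd d → α} {B : Set (Zd d)}

lemma wop_zero_apply (x : Zd d) (F : α → ℝ) (a : α) : wop ι B 0 x F a = F (a ⊔ ι x) := rfl

lemma wop_succ_of_mem {x : Zd d} (hx : x ∈ B) (N : ℕ) (F : α → ℝ) (a : α) :
    wop ι B (N + 1) x F a = avg (fun y => wop ι B N y F (a ⊔ ι x)) x := by
  rw [← avg_op_apply]
  simp [wop, hx]

lemma wop_succ_of_notMem {x : Zd d} (hx : x ∉ B) (N : ℕ) (F : α → ℝ) (a : α) :
    wop ι B (N + 1) x F a = F (a ⊔ ι x) := by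
  simp [wop, hx]

lemma wop_conv (ι : Zd d → α) (B : Set (Zd d)) (N : ℕ) (x : Zd d) : IsConv (wop ι B N x) := by
  induction N generalizing x with
  | zero => exact IsConv.shift _
  | succ N ih =>
    refine (IsConv.shift _).mul ?_
    split_ifs
    · rw [avg_eq_nb]
      exact (IsConv.sum _ fun p _ => ih _).smul (by positivity)
    · exact IsConv.one

lemma wop_one (hd : 0 < d) (ι : Zd d → α) (B : Set (Zd d)) (N : ℕ) (x : Zd d) :
    wop ι B N x 1 = 1 := by
  induction N generalizing x with
  | zero => rfl
  | succ N ih =>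
    funext a
    by_cases hx : x ∈ B
    · rw [wop_succ_of_mem hx]
      simp only [ih, Pi.one_apply]
      exact avg_const hd 1 x
    · rw [wop_succ_of_notMem hx]; rfl

lemma wop_le_succ (hd : 0 < d) {F : α → ℝ} (hF : Monotone F) (N : ℕ) (x : Zd d) (a : α) :
    wop ι B N x F a ≤ wop ι B (N + 1) x F a := by
  induction N generalizing x a with
  | zero =>
    rw [wop_zero_apply]
    by_cases hx : x ∈ B
    · rw [wop_succ_of_mem hx, ← avg_const hd (F (a ⊔ ι x)) x]
      exact avg_mono (fun y => hF le_sup_left) x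
    · rw [wop_succ_of_notMem hx]
  | succ N ih =>
    by_cases hx : x ∈ B
    · rw [wop_succ_of_mem hx, wop_succ_of_mem hx]
      exact avg_mono (fun y => ih y _) x
    · rw [wop_succ_of_notMem hx, wop_succ_of_notMem hx]

lemma wop_mono_time (hd : 0 < d) {F : α → ℝ} (hF : Monotone F) {M N : ℕ} (h : M ≤ N) (x : Zd d)
    (a : α) : wop ι B M x F a ≤ wop ι B N x F a :=
  monotone_nat_of_le_succ (f := fun N => wop ι B N x F a) (fun N => wop_le_succ hd hF N x a) h

/-- Stopping the walk earlier decreases the marks collected. -/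
lemma wop_le_univ (hd : 0 < d) {F : α → ℝ} (hF : Monotone F) (N : ℕ) (x : Zd d) (a : α) :
    wop ι B N x F a ≤ wop ι Set.univ N x F a := by
  induction N generalizing x a with
  | zero => exact le_rfl
  | succ N ih =>
    rw [wop_succ_of_mem (Set.mem_univ x)]
    by_cases hx : x ∈ B
    · rw [wop_succ_of_mem hx]
      exact avg_mono (fun y => ih y _) x
    · rw [wop_succ_of_notMem hx, ← avg_const hd (F (a ⊔ ι x)) x]
      refine avg_mono (fun y => ?_) x
      exact (wop_conv ι _ N y).le_apply (wop_one hd ι _ N y) hF _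

lemma wop_congr {ι' : Zd d → α} {B' : Set (Zd d)} (hB : ∀ x ∈ B, ∀ p, nb x p ∈ B')
    (h : ∀ x ∈ B', ι x = ι' x) (N : ℕ) {x : Zd d} (hx : x ∈ B') :
    wop ι B N x = wop ι' B N x := by
  induction N generalizing x with
  | zero => simp only [wop, h x hx]
  | succ N ih =>
    simp only [wop, h x hx]
    by_cases hxB : x ∈ B
    · simp only [hxB, if_true, avg_eq_nb]
      congr 2
      exact Finset.sum_congr rfl fun p _ => ih (hB x hxB p)
    · simp [hxB]

lemma wop_actsOn {B' : Set (Zd d)} (hB : ∀ x ∈ B, ∀ p, nb x p ∈ B') (N : ℕ) {x : Zd d}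
    (hx : x ∈ B') : ActsOn (ι '' B') (wop ι B N x) := by
  induction N generalizing x with
  | zero => exact ActsOn.shift (Set.mem_image_of_mem ι hx)
  | succ N ih =>
    refine (ActsOn.shift (Set.mem_image_of_mem ι hx)).mul ?_
    split_ifs with hxB
    · rw [avg_eq_nb]
      exact (ActsOn.sum _ fun p _ => ih (hB x hxB p)).smul _
    · exact ActsOn.one

end WalkOperators

section Excursions

variable {d : ℕ} {α : Type*} [Fintype α] [SemilatticeSup α] [OrderBot α]

/-- Decomposition at the first visit to `D 0 ∪ D 1`. -/
lemma wop_le_add_kap (hd : 0 < d) (ι : Zd d → α) (D : Fin 2 → Finset (Zd d))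
    (hι : ∀ y, (∀ i, y ∉ D i) → ι y = ⊥) {F : α → ℝ} (hF : Monotone F) (h0 : 0 ≤ F) (N : ℕ)
    (y : Zd d) (a : α) :
    wop ι Set.univ N y F a ≤
      F a + ∑ i, ∑ z ∈ D i, kap (D i : Set (Zd d)) z N y * wop ι Set.univ N z F a := by
  have hw0 : ∀ N z a, 0 ≤ wop ι Set.univ N z F a := fun N z a => (wop_conv ι _ N z).nonneg F h0 a
  have hterm : ∀ N y a i, ∀ z ∈ D i, 0 ≤ kap (D i : Set (Zd d)) z N y * wop ι Set.univ N z F a :=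
    fun N y a i z _ => mul_nonneg (kap_nonneg _ _ _ _) (hw0 _ _ _)
  by_cases hy : ∃ i, y ∈ D i
  · obtain ⟨i, hi⟩ := hy
    have h1 : kap (D i : Set (Zd d)) y N y * wop ι Set.univ N y F a ≤
        ∑ i, ∑ z ∈ D i, kap (D i : Set (Zd d)) z N y * wop ι Set.univ N z F a :=
      (Finset.single_le_sum (f := fun z => kap (D i : Set (Zd d)) z N y * wop ι Set.univ N z F a)
        (hterm N y a i) hi).trans (Finset.single_le_sum
          (f := fun i => ∑ z ∈ D i, kap (D i : Set (Zd d)) z N y * wop ι Set.univ N z F a)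
          (fun j _ => Finset.sum_nonneg (hterm N y a j)) (Finset.mem_univ i))
    rw [kap_self (by exact_mod_cast hi), one_mul] at h1
    have := h0 a
    simp only [Pi.zero_apply] at this
    linarith
  · push Not at hy
    induction N generalizing y a with
    | zero =>
      rw [wop_zero_apply, hι y hy, sup_bot_eq]
      exact le_add_of_nonneg_right (Finset.sum_nonneg fun j _ => Finset.sum_nonneg (hterm 0 y a j))
    | succ N ih =>
      rw [wop_succ_of_mem (Set.mem_univ y), hι y hy, sup_bot_eq]
      have h2 : avg (fun y => wop ι Set.univ N y F a) y ≤ avg (fun y => F a +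
          ∑ i, ∑ z ∈ D i, kap (D i : Set (Zd d)) z N y * wop ι Set.univ N z F a) y := by
        refine avg_mono (fun w => ?_) y
        by_cases hw : ∃ i, w ∈ D i
        · obtain ⟨i, hi⟩ := hw
          have h1 : kap (D i : Set (Zd d)) w N w * wop ι Set.univ N w F a ≤
              ∑ i, ∑ z ∈ D i, kap (D i : Set (Zd d)) z N w * wop ι Set.univ N z F a :=
            (Finset.single_le_sum
              (f := fun z => kap (D i : Set (Zd d)) z N w * wop ι Set.univ N z F a)
              (hterm N w a i) hi).trans (Finset.single_le_sum
                (f := fun i => ∑ z ∈ D i, kap (D i : Set (Zd d)) z N w * wop ι Set.univ N z F a)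
                (fun j _ => Finset.sum_nonneg (hterm N w a j)) (Finset.mem_univ i))
          rw [kap_self (by exact_mod_cast hi), one_mul] at h1
          have := h0 a
          simp only [Pi.zero_apply] at this
          linarith
        · push Not at hw
          exact ih w a hw
      refine h2.trans ?_
      rw [avg_add, avg_const hd, avg_sum]
      refine add_le_add le_rfl (Finset.sum_le_sum fun i _ => ?_)
      rw [avg_sum]
      refine Finset.sum_le_sum fun z hz => ?_
      have h3 : avg (fun y => kap (D i : Set (Zd d)) z N y * wop ι Set.univ N z F a) y =
          kap (D i : Set (Zd d)) z (N + 1) y * wop ι Set.univ N z F a := by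
        simp only [mul_comm _ (wop ι Set.univ N z F a), avg_mul]
        have : y ∉ (D i : Set (Zd d)) := by exact_mod_cast hy i
        simp [kap, hy i]
      rw [h3]
      exact mul_le_mul_of_nonneg_left (wop_le_succ hd hF N z a) (kap_nonneg _ _ _ _)

/-- If the walk started far away is dominated by `V`, the walk started in `B` is dominated by
the walk stopped on leaving `B`, followed by `V`. -/
lemma wop_le_stopped (hd : 0 < d) (ι : Zd d → α) {B Far : Set (Zd d)}
    (hB : ∀ x ∈ B, ∀ p, nb x p ∈ B ∪ Far) {F V : α → ℝ} (hF : Monotone F) (hV : Monotone V)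
    (hFV : F ≤ V) (N : ℕ) (h : ∀ y ∈ Far, wop ι Set.univ N y F ≤ V) (M : ℕ) (hM : M ≤ N)
    (x : Zd d) (hx : x ∈ B ∪ Far) (a : α) : wop ι Set.univ M x F a ≤ wop ι B M x V a := by
  induction M generalizing x a with
  | zero => exact hFV _
  | succ M ih =>
    by_cases hxB : x ∈ B
    · rw [wop_succ_of_mem (Set.mem_univ x), wop_succ_of_mem hxB, avg_eq_nb, avg_eq_nb]
      refine smul_le_smul_of_nonneg_left (Finset.sum_le_sum fun p _ => ?_) (by positivity)
      exact ih (by omega) _ (hB x hxB p) _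
    · rw [wop_succ_of_notMem hxB]
      have hxF : x ∈ Far := hx.resolve_left hxB
      exact (wop_mono_time hd hF hM x a).trans ((h x hxF a).trans (hV le_sup_left))

end Excursions

section Domination

variable {d : ℕ} {α : Type*} [Fintype α] [SemilatticeSup α] [OrderBot α]

/-- Mixture over starting points of the operators of the walk stopped on leaving `B`. -/
noncomputable def mixOp (ι : Zd d → α) (B : Set (Zd d)) (N : ℕ) (D : Finset (Zd d))
    (w : Zd d → ℝ) : Op α := ∑ x ∈ D, w x • wop ι B N x

lemma mixOp_apply (ι : Zd d → α) (B : Set (Zd d)) (N : ℕ) (D : Finset (Zd d)) (w : Zd d → ℝ)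
    (F : α → ℝ) (a : α) : mixOp ι B N D w F a = ∑ x ∈ D, w x * wop ι B N x F a := by
  simp [mixOp, sum_apply, Finset.sum_apply]

lemma mixOp_conv (ι : Zd d → α) (B : Set (Zd d)) (N : ℕ) {D : Finset (Zd d)} {w : Zd d → ℝ}
    (hw : ∀ x, 0 ≤ w x) : IsConv (mixOp ι B N D w) :=
  IsConv.sum _ fun x _ => (wop_conv ι B N x).smul (hw x)

lemma mixOp_one (hd : 0 < d) (ι : Zd d → α) (B : Set (Zd d)) (N : ℕ) (D : Finset (Zd d))
    (w : Zd d → ℝ) : mixOp ι B N D w 1 = (∑ x ∈ D, w x) • (1 : α → ℝ) := by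
  funext a
  simp [mixOp_apply, wop_one hd]

lemma mixOp_le_univ (hd : 0 < d) {ι : Zd d → α} {B : Set (Zd d)} {N : ℕ} {D : Finset (Zd d)}
    {w : Zd d → ℝ} (hw : ∀ x, 0 ≤ w x) {F : α → ℝ} (hF : Monotone F) :
    mixOp ι B N D w F ≤ mixOp ι Set.univ N D w F := by
  intro a
  rw [mixOp_apply, mixOp_apply]
  exact Finset.sum_le_sum fun x _ => mul_le_mul_of_nonneg_left (wop_le_univ hd hF N x a) (hw x)

lemma add_pow_le {T₀ T₁ : Op α} (h₀ : IsConv T₀) (h₁ : IsConv T₁) (m₀ : T₀ 1 = 1) (m₁ : T₁ 1 = 1)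
    {F : α → ℝ} (hF : Monotone F) (n : ℕ) :
    ((T₀ + T₁) ^ n) F ≤ (2 : ℝ) ^ n • ((T₀ * T₁) ^ n) F := by
  have hS := h₀.add h₁
  have hP := h₀.mul h₁
  have key : ∀ G : α → ℝ, Monotone G → (T₀ + T₁) G ≤ (2 : ℝ) • (T₀ * T₁) G := by
    intro G hG a
    have a1 : T₀ G a ≤ T₀ (T₁ G) a := h₀.mono (h₁.le_apply m₁ hG) a
    have a2 : T₁ G a ≤ T₀ (T₁ G) a := h₀.le_apply m₀ (h₁.monotone hG) a
    change T₀ G a + T₁ G a ≤ 2 * T₀ (T₁ G) a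
    linarith
  induction n with
  | zero => simp
  | succ n ih =>
    rw [pow_succ', pow_succ', pow_succ']
    refine (hS.mono ih).trans ?_
    rw [map_smul]
    intro a
    have := key _ ((hP.pow n).monotone hF) a
    simp only [Pi.smul_apply, smul_eq_mul, ContinuousLinearMap.mul_def,
      ContinuousLinearMap.comp_apply] at this ⊢
    calc _ ≤ (2 : ℝ) ^ n * (2 * T₀ (T₁ (((T₀.comp T₁) ^ n) F)) a) :=
          mul_le_mul_of_nonneg_left this (by positivity)
      _ = _ := by ring

variable [OrderTop α]

/-- The standing assumptions on a pair of well-separated sets. -/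
structure Separated (ι : Zd d → α) (D : Fin 2 → Finset (Zd d)) (B : Fin 2 → Set (Zd d))
    (w : Fin 2 → Zd d → ℝ) (δ : ℝ) : Prop where
  mark : ∀ y, (∀ i, y ∉ D i) → ι y = ⊥
  sub : ∀ i, ∀ x ∈ D i, x ∈ B i
  step : ∀ i, ∀ x ∈ B i, ∀ p, nb x p ∈ B i ∪ {y | ∀ j, y ∉ B j}
  nonneg : ∀ i x, 0 ≤ w i x
  sum : ∀ i, ∑ x ∈ D i, w i x = 1
  kernel : ∀ i y, (∀ j, y ∉ B j) → ∀ N, ∀ z ∈ D i, kap (D i : Set (Zd d)) z N y ≤ δ * w i z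

variable {ι : Zd d → α} {D : Fin 2 → Finset (Zd d)} {B : Fin 2 → Set (Zd d)}
  {w : Fin 2 → Zd d → ℝ} {δ : ℝ}

lemma Separated.markov (hd : 0 < d) (h : Separated ι D B w δ) (i : Fin 2) (A : Set (Zd d)) (N : ℕ) :
    mixOp ι A N (D i) (w i) 1 = 1 := by
  rw [mixOp_one hd, h.sum, one_smul]

lemma Separated.mix_le (hd : 0 < d) (h : Separated ι D B w δ) (N : ℕ) {F V : α → ℝ}
    (hF : Monotone F) (hV : Monotone V) (hFV : F ≤ V)
    (hfar : ∀ y, (∀ j, y ∉ B j) → wop ι Set.univ N y F ≤ V) (i : Fin 2) :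
    mixOp ι Set.univ N (D i) (w i) F ≤ mixOp ι (B i) N (D i) (w i) V := by
  intro a
  rw [mixOp_apply, mixOp_apply]
  refine Finset.sum_le_sum fun x hx => mul_le_mul_of_nonneg_left ?_ (h.nonneg i x)
  exact wop_le_stopped hd ι (h.step i) hF hV hFV N hfar N le_rfl x (Or.inl (h.sub i x hx)) a

lemma Separated.far_le (hd : 0 < d) (h : Separated ι D B w δ) (hδ : 0 ≤ δ) (N : ℕ) {F : α → ℝ}
    (hF : Monotone F) (h0 : 0 ≤ F) (j : ℕ) :
    F ≤ (∑ k ∈ Finset.range j, ((δ • (mixOp ι (B 0) N (D 0) (w 0) +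
        mixOp ι (B 1) N (D 1) (w 1))) ^ k) F + fun _ => (2 * δ) ^ j * F ⊤) ∧
    ∀ y, (∀ i, y ∉ B i) → wop ι Set.univ N y F ≤
      ∑ k ∈ Finset.range j, ((δ • (mixOp ι (B 0) N (D 0) (w 0) +
        mixOp ι (B 1) N (D 1) (w 1))) ^ k) F + fun _ => (2 * δ) ^ j * F ⊤ := by
  set T : Fin 2 → Op α := fun i => mixOp ι (B i) N (D i) (w i) with hT
  have cT : ∀ i, IsConv (T i) := fun i => mixOp_conv ι _ N (h.nonneg i)
  set R : Op α := δ • (T 0 + T 1) with hR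
  have cR : IsConv R := ((cT 0).add (cT 1)).smul hδ
  have R1 : R 1 = (2 * δ) • (1 : α → ℝ) := by
    have e0 : T 0 1 = 1 := h.markov hd 0 _ N
    have e1 : T 1 1 = 1 := h.markov hd 1 _ N
    rw [hR, smul_apply, add_apply, e0, e1]
    module
  have hFtop : 0 ≤ F ⊤ := h0 ⊤
  induction j with
  | zero =>
    have hle : F ≤ fun _ => F ⊤ := fun a => hF le_top
    refine ⟨by simpa using hle, fun y _ => ?_⟩
    have := (wop_conv ι Set.univ N y).mono hle
    rw [IsConv.map_const (wop_one hd ι _ N y)] at this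
    simpa using this
  | succ j ih =>
    obtain ⟨ih1, ih2⟩ := ih
    set V : α → ℝ := ∑ k ∈ Finset.range j, (R ^ k) F + fun _ => (2 * δ) ^ j * F ⊤ with hV
    have mV : Monotone V := by
      intro a b hab
      simp only [hV, Pi.add_apply, Finset.sum_apply]
      exact add_le_add (Finset.sum_le_sum fun k _ => (cR.pow k).monotone hF hab) le_rfl
    have key : F + R V = ∑ k ∈ Finset.range (j + 1), (R ^ k) F + fun _ => (2 * δ) ^ (j + 1) * F ⊤ := by
      have e : (fun _ : α => (2 * δ) ^ j * F ⊤) = ((2 * δ) ^ j * F ⊤) • (1 : α → ℝ) := by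
        funext; simp
      rw [hV, map_add, map_sum, e, map_smul, R1, Finset.sum_range_succ']
      funext a
      simp [pow_succ']
      ring
    rw [← key]
    have hRV : 0 ≤ R V := cR.nonneg V (h0.trans ih1)
    refine ⟨le_add_of_nonneg_right hRV, fun y hy a => ?_⟩
    refine (wop_le_add_kap hd ι D h.mark hF h0 N y a).trans ?_
    rw [Pi.add_apply]
    refine add_le_add le_rfl ?_
    have hRVa : R V a = ∑ i, δ * T i V a := by
      simp [hR, Fin.sum_univ_two]
    rw [hRVa]
    refine Finset.sum_le_sum fun i _ => ?_
    refine le_trans ?_ (mul_le_mul_of_nonneg_left (h.mix_le hd N hF mV ih1 ih2 i a) hδ)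
    rw [mixOp_apply, Finset.mul_sum]
    refine Finset.sum_le_sum fun z hz => ?_
    rw [← mul_assoc]
    exact mul_le_mul_of_nonneg_right (h.kernel i y hy N z hz) ((wop_conv ι _ N z).nonneg F h0 a)

/-- The walks started from the union are dominated by independent stopped walks and rare
clusters of excursions. -/
lemma Separated.mixOp_le (hd : 0 < d) (h : Separated ι D B w δ) (hδ : 0 ≤ δ) (hδ1 : 2 * δ ≤ 1)
    (N : ℕ) {K : Finset (Zd d)} (hK : ∀ x ∈ K, ∃ i, x ∈ D i) {e : Zd d → ℝ} (he : ∀ x, 0 ≤ e x)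
    {c : ℝ} (hc : 0 ≤ c) (hec : ∀ i, ∀ x ∈ D i, e x ≤ c * w i x) (r : ℕ) {F : α → ℝ}
    (hF : Monotone F) (h0 : 0 ≤ F) (a : α) :
    mixOp ι Set.univ N K e F a ≤
      c * mixOp ι (B 0) N (D 0) (w 0) F a + c * mixOp ι (B 1) N (D 1) (w 1) F a +
        (4 * r * c * δ) * ((mixOp ι (B 0) N (D 0) (w 0) *
          mixOp ι (B 1) N (D 1) (w 1)) ^ (r + 1)) F a + 2 * c * (2 * δ) ^ (r + 1) * F ⊤ := by
  classical
  set T : Fin 2 → Op α := fun i => mixOp ι (B i) N (D i) (w i) with hT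
  have cT : ∀ i, IsConv (T i) := fun i => mixOp_conv ι _ N (h.nonneg i)
  have m0 : T 0 1 = 1 := h.markov hd 0 _ N
  have m1 : T 1 1 = 1 := h.markov hd 1 _ N
  set S : Op α := T 0 + T 1 with hS
  have cS : IsConv S := (cT 0).add (cT 1)
  have cP : IsConv (T 0 * T 1) := (cT 0).mul (cT 1)
  have P1 : (T 0 * T 1) 1 = 1 := by simp [m0, m1]
  have cR : IsConv (δ • S) := cS.smul hδ
  obtain ⟨hFV, hfar⟩ := h.far_le hd hδ N hF h0 (r + 1)
  set V : α → ℝ := ∑ k ∈ Finset.range (r + 1), ((δ • S) ^ k) F + fun _ => (2 * δ) ^ (r + 1) * F ⊤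
    with hV
  have mV : Monotone V := by
    intro a b hab
    simp only [hV, Pi.add_apply, Finset.sum_apply]
    exact add_le_add (Finset.sum_le_sum fun k _ => (cR.pow k).monotone hF hab) le_rfl
  have hw0 : ∀ z, 0 ≤ wop ι Set.univ N z F a := fun z => (wop_conv ι _ N z).nonneg F h0 a
  have s1 : mixOp ι Set.univ N K e F a ≤ ∑ i, ∑ x ∈ D i, e x * wop ι Set.univ N x F a := by
    rw [mixOp_apply, Fin.sum_univ_two, ← Finset.sum_union_inter]
    have hsub : K ⊆ D 0 ∪ D 1 := fun x hx => by
      have := hK x hx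
      rw [Fin.exists_fin_two] at this
      exact Finset.mem_union.2 this
    have hnn : ∀ x, 0 ≤ e x * wop ι Set.univ N x F a := fun x => mul_nonneg (he x) (hw0 x)
    exact (Finset.sum_le_sum_of_subset_of_nonneg hsub fun x _ _ => hnn x).trans
      (le_add_of_nonneg_right (Finset.sum_nonneg fun x _ => hnn x))
  have s2 : ∀ i, ∑ x ∈ D i, e x * wop ι Set.univ N x F a ≤ c * T i V a := by
    intro i
    refine le_trans ?_ (mul_le_mul_of_nonneg_left (h.mix_le hd N hF mV hFV hfar i a) hc)
    rw [mixOp_apply, Finset.mul_sum]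
    refine Finset.sum_le_sum fun x hx => ?_
    rw [← mul_assoc]
    exact mul_le_mul_of_nonneg_right (hec i x hx) (hw0 x)
  have s3 : S V a = T 0 V a + T 1 V a := rfl
  have S1 : S 1 = (2 : ℝ) • (1 : α → ℝ) := by
    change T 0 1 + T 1 1 = _
    rw [m0, m1]; module
  have s4 : S V a = (∑ k ∈ Finset.range r, S (((δ • S) ^ (k + 1)) F) a) + (T 0 F a + T 1 F a) +
      2 * (2 * δ) ^ (r + 1) * F ⊤ := by
    have e1 : (fun _ : α => (2 * δ) ^ (r + 1) * F ⊤) = ((2 * δ) ^ (r + 1) * F ⊤) • (1 : α → ℝ) := by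
      funext; simp
    rw [hV, map_add, map_sum, e1, map_smul, S1, Finset.sum_range_succ']
    simp only [Pi.add_apply, Finset.sum_apply, pow_zero, Pi.smul_apply, smul_eq_mul, Pi.one_apply]
    have : S ((1 : Op α) F) a = T 0 F a + T 1 F a := rfl
    rw [this]
    ring
  have s5 : ∀ k ∈ Finset.range r, S (((δ • S) ^ (k + 1)) F) a ≤
      4 * δ * ((T 0 * T 1) ^ (r + 1)) F a := by
    intro k hk
    have hk := Finset.mem_range.1 hk
    have e1 : S (((δ • S) ^ (k + 1)) F) a = δ ^ (k + 1) * (S ^ (k + 2)) F a := by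
      rw [smul_pow, pow_succ' S (k + 1), smul_apply, map_smul]
      rfl
    have e2 : (S ^ (k + 2)) F a ≤ 2 ^ (k + 2) * ((T 0 * T 1) ^ (k + 2)) F a :=
      add_pow_le (cT 0) (cT 1) m0 m1 hF (k + 2) a
    have e3 : ((T 0 * T 1) ^ (k + 2)) F a ≤ ((T 0 * T 1) ^ (r + 1)) F a :=
      cP.pow_mono P1 hF (by omega) a
    have e4 : 0 ≤ ((T 0 * T 1) ^ (r + 1)) F a := (cP.pow _).nonneg F h0 a
    rw [e1]
    calc δ ^ (k + 1) * (S ^ (k + 2)) F a ≤ δ ^ (k + 1) * (2 ^ (k + 2) * ((T 0 * T 1) ^ (r + 1)) F a) := by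
          refine mul_le_mul_of_nonneg_left (e2.trans ?_) (by positivity)
          exact mul_le_mul_of_nonneg_left e3 (by positivity)
      _ = 4 * δ * ((2 * δ) ^ k * ((T 0 * T 1) ^ (r + 1)) F a) := by
          rw [mul_pow]; ring
      _ ≤ 4 * δ * ((T 0 * T 1) ^ (r + 1)) F a := by
          refine mul_le_mul_of_nonneg_left (mul_le_of_le_one_left e4 ?_) (by positivity)
          exact pow_le_one₀ (by positivity) hδ1
  have s6 := Finset.sum_le_sum s5
  rw [Finset.sum_const, Finset.card_range, nsmul_eq_mul] at s6
  have s7 : ∑ i, ∑ x ∈ D i, e x * wop ι Set.univ N x F a ≤ c * S V a := by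
    rw [Fin.sum_univ_two, s3, mul_add]
    exact add_le_add (s2 0) (s2 1)
  refine s1.trans (s7.trans ?_)
  rw [s4]
  have := mul_le_mul_of_nonneg_left s6 hc
  change _ ≤ c * T 0 F a + c * T 1 F a + (4 * r * c * δ) * ((T 0 * T 1) ^ (r + 1)) F a +
    2 * c * (2 * δ) ^ (r + 1) * F ⊤
  nlinarith

/-- The generator inequality behind the decoupling. -/
lemma Separated.generator_le (hd : 0 < d) (h : Separated ι D B w δ) (hδ : 0 ≤ δ) (hδ1 : 2 * δ ≤ 1)
    (N : ℕ) {K : Finset (Zd d)} (hK : ∀ x ∈ K, ∃ i, x ∈ D i) {e : Zd d → ℝ} (he : ∀ x, 0 ≤ e x)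
    {c : ℝ} (hc : 0 ≤ c) (hec : ∀ i, ∀ x ∈ D i, e x ≤ c * w i x) (r : ℕ) {F : α → ℝ}
    (hF : Monotone F) :
    (mixOp ι Set.univ N K e - (∑ x ∈ K, e x) • (1 : Op α)) F ≤
      (c • (mixOp ι (B 0) N (D 0) (w 0) - 1) + c • (mixOp ι (B 1) N (D 1) (w 1) - 1) +
        (4 * r * c * δ) • ((mixOp ι (B 0) N (D 0) (w 0) *
          mixOp ι (B 1) N (D 1) (w 1)) ^ (r + 1) - 1) +
        (2 * c * (2 * δ) ^ (r + 1)) • (shift ⊤ - 1) : Op α) F := by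
  intro a
  set G : α → ℝ := fun b => F (a ⊔ b) - F a with hG
  have mG : Monotone G := fun x y hxy => sub_le_sub_right (hF (sup_le_sup_left hxy a)) _
  have G0 : 0 ≤ G := fun b => sub_nonneg.2 (hF le_sup_left)
  have key := h.mixOp_le hd hδ hδ1 N hK he hc hec r mG G0 ⊥
  have conv : ∀ (U : Op α) (m : ℝ), (∀ s, Commute U (shift s)) → U 1 = m • 1 →
      U G ⊥ = U F a - m * F a := by
    intro U m hU h1
    have e1 : G = (fun b => F (a ⊔ b)) - F a • (1 : α → ℝ) := by funext b; simp [hG]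
    rw [e1, map_sub, map_smul, h1, apply_eq_bot hU F a]
    simp [mul_comm]
  have cT : ∀ i, IsConv (mixOp ι (B i) N (D i) (w i)) := fun i => mixOp_conv ι _ N (h.nonneg i)
  have cP := ((cT 0).mul (cT 1)).pow (r + 1)
  have P1 : ((mixOp ι (B 0) N (D 0) (w 0) * mixOp ι (B 1) N (D 1) (w 1)) ^ (r + 1)) (1 : α → ℝ) =
      (1 : ℝ) • 1 := by
    rw [one_smul]
    exact IsConv.one_pow (by simp [h.markov hd]) (r + 1)
  rw [conv _ _ (mixOp_conv ι Set.univ N he).comm (mixOp_one hd ι Set.univ N K e),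
    conv _ 1 (cT 0).comm (by rw [h.markov hd, one_smul]),
    conv _ 1 (cT 1).comm (by rw [h.markov hd, one_smul]), conv _ 1 cP.comm P1] at key
  simp only [hG, sup_top_eq] at key
  simp only [add_apply, sub_apply, smul_apply, Pi.add_apply, Pi.sub_apply, Pi.smul_apply, smul_eq_mul,
    shift_apply, sup_top_eq, one_apply_eq_self]
  linarith

end Domination

section Law

variable {d : ℕ} {α : Type*} [Fintype α] [SemilatticeSup α] [OrderBot α]

open Classical in
/-- The join of the marks of the points of `K` which are not vacant. -/
noncomputable def joinMarks (ι : Zd d → α) (K : Finset (Zd d)) (Y : Zd d → Bool) : α :=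
  (K.filter fun x => Y x = false).sup ι

lemma joinMarks_le {ι : Zd d → α} {K : Finset (Zd d)} {Y : Zd d → Bool} {A : α} :
    joinMarks ι K Y ≤ A ↔ ∀ x ∈ K, ¬ ι x ≤ A → Y x = true := by
  simp only [joinMarks, Finset.sup_le_iff, Finset.mem_filter, and_imp]
  refine forall₂_congr fun x _ => ?_
  cases Y x <;> simp

lemma measurableSet_joinMarks (ι : Zd d → α) (K : Finset (Zd d)) (E : Set α) :
    MeasurableSet {Y : Zd d → Bool | joinMarks ι K Y ∈ E} := by
  classical
  let g : (K → Bool) → Zd d → Bool := fun f x => if h : x ∈ K then f ⟨x, h⟩ else true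
  have h1 : Measurable fun (Y : Zd d → Bool) (x : K) => Y x :=
    measurable_pi_lambda _ fun x => measurable_pi_apply _
  have h2 : MeasurableSet {f : K → Bool | joinMarks ι K (g f) ∈ E} := MeasurableSet.of_discrete
  have h3 := h1 h2
  convert h3 using 1
  ext Y
  have : joinMarks ι K Y = joinMarks ι K (g fun x => Y x) := by
    simp only [joinMarks]
    congr 1
    refine Finset.filter_congr fun x hx => ?_
    simp [g, hx]
  simp only [Set.mem_ofPred_eq, Set.mem_preimage, this]

lemma exp_eigen {X : Op α} {F : α → ℝ} {μ : ℝ} (h : X F = μ • F) :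
    NormedSpace.exp X F = Real.exp μ • F := by
  have hn : ∀ n : ℕ, (X ^ n) F = μ ^ n • F := by
    intro n
    induction n with
    | zero => simp
    | succ n ih =>
      have : (X ^ (n + 1)) F = X ((X ^ n) F) := by rw [pow_succ']; rfl
      rw [this, ih, map_smul, h, smul_smul, pow_succ]
  funext a
  refine (IsConv.exp_hasSum X F a).unique ?_
  have := (NormedSpace.expSeries_div_hasSum_exp μ).mul_right (F a)
  rw [← Real.exp_eq_exp_ℝ] at this
  refine hasSum_of_eq this fun n => ?_
  rw [hn]
  simp only [Pi.smul_apply, smul_eq_mul]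
  ring

lemma indicator_esc_tendsto (hd : 0 < d) (V : Set (Zd d)) (x : Zd d) :
    Tendsto (fun N => Vᶜ.indicator (esc V N) x) atTop (nhds (Vᶜ.indicator (Esc V) x)) := by
  by_cases hx : x ∈ V
  · simp [hx]
  · simpa [hx] using esc_tendsto hd V x

open Classical in
lemma wop_indicator_le (ι : Zd d → α) (A : α) (N : ℕ) (x : Zd d) :
    wop ι Set.univ N x (fun s => if s ≤ A then 1 else 0) ⊥ =
      {x | ¬ ι x ≤ A}ᶜ.indicator (esc {x | ¬ ι x ≤ A} N) x := by
  set F : α → ℝ := fun s => if s ≤ A then 1 else 0 with hF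
  have mul : ∀ a b, F (a ⊔ b) = F a * F b := by
    intro a b
    simp only [hF, sup_le_iff, ite_and]
    split_ifs <;> simp
  have hw : ∀ N y a, wop ι Set.univ N y F a = F a * wop ι Set.univ N y F ⊥ := by
    intro N y a
    rw [apply_eq_bot (wop_conv ι _ N y).comm F a]
    have : (fun b => F (a ⊔ b)) = F a • F := funext fun b => mul a b
    rw [this, map_smul]; rfl
  induction N generalizing x with
  | zero =>
    rw [wop_zero_apply, bot_sup_eq]
    by_cases hx : ι x ≤ A <;> simp [hF, hx, esc]
  | succ N ih =>
    rw [wop_succ_of_mem (Set.mem_univ x), bot_sup_eq]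
    simp only [hw N _ (ι x), avg_mul]
    have : (fun y => wop ι Set.univ N y F ⊥) =
      {x | ¬ ι x ≤ A}ᶜ.indicator (esc {x | ¬ ι x ≤ A} N) := funext ih
    rw [this]
    by_cases hx : ι x ≤ A <;> simp [hF, hx, esc_succ]

variable {P : Zd d → Measure (ℕ → Zd d)}

open Classical in
/-- The law of the joined marks under a vacant-set law is the limit of the Poissonian laws. -/
lemma law_tendsto (hd : 3 ≤ d) (hP : IsSRW d P) {u : ℝ} {Q : Measure (Zd d → Bool)}
    (hQ : IsVacantLaw P u Q) (ι : Zd d → α) (K : Finset (Zd d)) (hι : ∀ x ∉ K, ι x = ⊥)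
    (E : Set α) :
    Tendsto (fun N => NormedSpace.exp (u • (mixOp ι Set.univ N K (eqv (K : Set (Zd d))) -
      capv K • (1 : Op α))) (E.indicator 1) ⊥) atTop
      (nhds (Q {Y | joinMarks ι K Y ∈ E}).toReal) := by
  have hd0 : 0 < d := by omega
  have hQ1 := hQ.1
  set X : ℕ → Op α := fun N => mixOp ι Set.univ N K (eqv (K : Set (Zd d))) - capv K • (1 : Op α)
    with hX
  set S := joinMarks ι K with hS
  have hmeas : ∀ E : Set α, MeasurableSet (S ⁻¹' E) := measurableSet_joinMarks ι K
  have hset : ∀ E : Set α, ∑ s, E.indicator (1 : α → ℝ) s * Q.real (S ⁻¹' {s}) = Q.real (S ⁻¹' E) := by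
    intro E
    have := sum_measureReal_preimage_singleton (μ := Q) (f := S) (Finset.univ.filter (· ∈ E))
      (fun y _ => hmeas {y})
    rw [Finset.sum_filter] at this
    convert this using 2
    · simp [Set.indicator_apply]
    · ext; simp
  have hdown : ∀ A : α, Tendsto (fun N => NormedSpace.exp (u • X N) (fun s => if s ≤ A then 1 else 0) ⊥)
      atTop (nhds (∑ s, (if s ≤ A then 1 else 0) * Q.real (S ⁻¹' {s}))) := by
    intro A
    set F : α → ℝ := fun s => if s ≤ A then 1 else 0 with hF
    set V : Finset (Zd d) := K.filter fun x => ¬ ι x ≤ A with hV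
    have hVset : {x | ¬ ι x ≤ A} = (V : Set (Zd d)) := by
      ext x
      by_cases hx : x ∈ K
      · simp [hV, hx]
      · simp [hV, hx, hι x hx]
    have mul : ∀ a b, F (a ⊔ b) = F a * F b := by
      intro a b
      simp only [hF, sup_le_iff, ite_and]
      split_ifs <;> simp
    have heig : ∀ U : Op α, (∀ s, Commute U (shift s)) → U F = U F ⊥ • F := by
      intro U hU
      funext a
      rw [apply_eq_bot hU F a]
      have : (fun b => F (a ⊔ b)) = F a • F := funext fun b => mul a b
      rw [this, map_smul]
      simp [mul_comm]
    have hXcomm : ∀ N s, Commute (u • X N) (shift s) := fun N s =>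
      (((mixOp_conv ι Set.univ N (eqv_nonneg _)).comm s).sub_left
        ((Commute.one_left _).smul_left _)).smul_left _
    have hval : ∀ N, NormedSpace.exp (u • X N) F ⊥ = Real.exp ((u • X N) F ⊥) := by
      intro N
      rw [exp_eigen (heig _ (hXcomm N))]
      simp [hF]
    simp only [hval]
    have hXF : ∀ N, (u • X N) F ⊥ = -(u * ∑ x ∈ K, eqv (K : Set (Zd d)) x *
        (1 - (V : Set (Zd d))ᶜ.indicator (esc V N) x)) := by
      intro N
      have e1 : (u • X N) F ⊥ = u * (mixOp ι Set.univ N K (eqv (K : Set (Zd d))) F ⊥ - capv K * F ⊥) := rfl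
      rw [e1, mixOp_apply]
      simp only [hF, wop_indicator_le, hVset]
      simp only [bot_le, if_true, mul_one, mul_sub, Finset.sum_sub_distrib, capv]
      ring
    have hlim : Tendsto (fun N => (u • X N) F ⊥) atTop (nhds (-(u * capv V))) := by
      simp only [hXF]
      rw [← sum_eqv_hit hd (Finset.filter_subset _ K : V ⊆ K)]
      refine (Tendsto.const_mul u (tendsto_finsetSum _ fun x _ => Tendsto.const_mul _ ?_)).neg
      refine Tendsto.const_sub 1 ?_
      exact indicator_esc_tendsto hd0 _ x
    have hsum : ∑ s, F s * Q.real (S ⁻¹' {s}) = Real.exp (-(u * capv V)) := by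
      have e1 := hset {s | s ≤ A}
      have e2 : ({s | s ≤ A} : Set α).indicator (1 : α → ℝ) = F := by
        funext s; simp [hF, Set.indicator_apply]
      rw [e2] at e1
      rw [e1]
      have e3 : S ⁻¹' {s | s ≤ A} = {Y | ∀ x ∈ V, Y x = true} := by
        ext Y
        simp only [Set.mem_preimage, Set.mem_ofPred_eq, hS, joinMarks_le, hV, Finset.mem_filter, and_imp]
      rw [measureReal_def, e3, hQ.2 V, capa_eq hd0 hP, ENNReal.toReal_ofReal (Real.exp_pos _).le]
    rw [hsum]
    exact (Real.continuous_exp.tendsto _).comp hlim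
  have hlin : ∀ F : α → ℝ, Tendsto (fun N => NormedSpace.exp (u • X N) F ⊥) atTop
      (nhds (∑ s, F s * Q.real (S ⁻¹' {s}))) := by
    have hsingle : ∀ A : α, Tendsto (fun N => NormedSpace.exp (u • X N) (Pi.single A 1) ⊥) atTop
        (nhds (∑ s, (Pi.single A (1 : ℝ) : α → ℝ) s * Q.real (S ⁻¹' {s}))) := by
      intro A
      induction A using WellFoundedLT.induction with
      | ind A ih =>
        have e : (Pi.single A (1 : ℝ) : α → ℝ) = (fun s => if s ≤ A then (1 : ℝ) else 0) -
            ∑ B ∈ Finset.univ.filter (· < A), Pi.single B 1 := by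
          funext s
          simp only [Pi.sub_apply, Finset.sum_apply, Pi.single_apply, Finset.sum_ite_eq,
            Finset.mem_filter, Finset.mem_univ, true_and]
          by_cases h1 : s = A
          · simp [h1]
          · by_cases h2 : s ≤ A
            · simp [h1, h2, lt_of_le_of_ne h2 h1]
            · have : ¬ s < A := fun h => h2 h.le
              simp [h1, h2, this]
        rw [e]
        simp only [map_sub, map_sum, Pi.sub_apply, Finset.sum_apply, sub_mul, Finset.sum_mul,
          Finset.sum_sub_distrib]
        refine (hdown A).sub ?_
        rw [Finset.sum_comm]
        exact tendsto_finsetSum _ fun B hB => ih B (Finset.mem_filter.1 hB).2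
    intro F
    have e : F = ∑ A, F A • (Pi.single A (1 : ℝ) : α → ℝ) := by
      funext s; simp [Finset.sum_apply, Pi.single_apply]
    have e2 : ∑ s, F s * Q.real (S ⁻¹' {s}) =
        ∑ A, F A * ∑ s, (Pi.single A (1 : ℝ) : α → ℝ) s * Q.real (S ⁻¹' {s}) := by
      simp [Pi.single_apply]
    rw [e2]
    have e3 : ∀ N, NormedSpace.exp (u • X N) F ⊥ =
        ∑ A, F A * NormedSpace.exp (u • X N) (Pi.single A 1) ⊥ := by
      intro N
      conv_lhs => rw [e]
      simp [map_sum, Finset.sum_apply]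
    simp only [e3]
    exact tendsto_finsetSum _ fun A _ => (hsingle A).const_mul _
  have := hlin (E.indicator 1)
  rw [hset] at this
  exact this

end Law

section Decoupling

variable {d : ℕ}

/-- The occupied set of a configuration. -/
def occ (Y : Zd d → Bool) : Set (Zd d) := {x | Y x = false}

/-- The mark of `y` in the power set of `K`. -/
def markIn (K : Finset (Zd d)) (y : Zd d) : Set K := {z | (z : Zd d) = y}

lemma markIn_eq_bot {K : Finset (Zd d)} {y : Zd d} (hy : y ∉ K) : markIn K y = ⊥ := by
  ext ⟨z, hz⟩
  simp only [markIn, Set.mem_ofPred_eq, Set.bot_eq_empty, Set.mem_empty_iff_false, iff_false]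
  rintro rfl
  exact hy hz

open Classical in
lemma image_joinMarks {K D : Finset (Zd d)} (hD : D ⊆ K) (ι : Zd d → Set K)
    (hι : ∀ x ∈ D, ι x = markIn K x) {M : Finset (Zd d)} (hM : D ⊆ M)
    (hsub : ∀ x, ι x ⊆ markIn K x) (Y : Zd d → Bool) :
    (Subtype.val '' joinMarks ι M Y) ∩ (D : Set (Zd d)) = occ Y ∩ D := by
  have hj : joinMarks ι M Y = {z | ∃ x ∈ M, Y x = false ∧ z ∈ ι x} := by
    ext z
    simp only [joinMarks, Finset.sup_set_eq_biUnion, Set.mem_iUnion, Finset.mem_filter, exists_prop,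
      Set.mem_ofPred_eq, and_assoc]
  rw [hj]
  ext x
  simp only [Set.mem_inter_iff, Set.mem_image, Set.mem_ofPred_eq, Finset.mem_coe, occ,
    and_congr_left_iff]
  intro hx
  constructor
  · rintro ⟨z, ⟨y, -, hY, hz⟩, rfl⟩
    rwa [show (z : Zd d) = y from hsub y hz]
  · intro hY
    refine ⟨⟨x, hD hx⟩, ⟨x, hM hx, hY, ?_⟩, rfl⟩
    rw [hι x hx]
    rfl

variable {P : Zd d → Measure (ℕ → Zd d)}

open Classical in
/-- Sprinkled decoupling of increasing functionals of the occupied set in two distant regions. -/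
lemma decouple_law (hd : 3 ≤ d) (hP : IsSRW d P) {u u' : ℝ} {Q Q' : Measure (Zd d → Bool)}
    (hQ : IsVacantLaw P u Q) (hQ' : IsVacantLaw P u' Q') (hu' : 0 ≤ u') (huu : u' ≤ u)
    {D : Fin 2 → Finset (Zd d)} {B B' : Fin 2 → Set (Zd d)} {c δ : ℝ} (hc : 0 < c) (hδ : 0 ≤ δ)
    (hδc : 2 * (δ * c) ≤ 1) (hcap : ∀ i, capv (D i) = c) (hDB : ∀ i, ∀ x ∈ D i, x ∈ B i)
    (hBB' : ∀ i, B i ⊆ B' i) (hstep : ∀ i, ∀ x ∈ B i, ∀ p, nb x p ∈ B' i)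
    (hdisj : Disjoint (B' 0) (B' 1))
    (hkap : ∀ i, ∀ y ∉ B i, ∀ N, ∀ z ∈ D i,
      kap (D i : Set (Zd d)) z N y ≤ δ * Esc (D i : Set (Zd d)) z)
    (p : Fin 2 → Set (Zd d) → Prop) (hp : ∀ i s t, s ⊆ t → p i s → p i t) (r k : ℕ) :
    (Q' {Y | p 0 (occ Y ∩ D 0) ∧ p 1 (occ Y ∩ D 1)}).toReal ≤
      (Q {Y | p 0 (occ Y ∩ D 0)}).toReal * (Q {Y | p 1 (occ Y ∩ D 1)}).toReal +
      (Real.exp (2 * (u' * (4 * r * c * (δ * c))) - k) +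
        2 * Real.exp (((r + 1) * k : ℕ) - (u - u') * c / 2) +
        u' * (2 * c * (2 * (δ * c)) ^ (r + 1))) := by
  have hd0 : 0 < d := by omega
  have hu : 0 ≤ u := hu'.trans huu
  have hne : ∀ i j : Fin 2, i ≠ j → ∀ x, x ∈ B' i → x ∉ B' j := by
    intro i j hij x hi hj
    rw [Set.disjoint_left] at hdisj
    fin_cases i <;> fin_cases j
    · exact hij rfl
    · exact hdisj hi hj
    · exact hdisj hj hi
    · exact hij rfl
  set K : Finset (Zd d) := D 0 ∪ D 1 with hK
  have hDK : ∀ i, D i ⊆ K := by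
    intro i
    fin_cases i
    · exact Finset.subset_union_left
    · exact Finset.subset_union_right
  have hKD : ∀ x ∈ K, ∃ i, x ∈ D i := by
    intro x hx
    rcases Finset.mem_union.1 hx with h | h
    exacts [⟨0, h⟩, ⟨1, h⟩]
  set ι : Zd d → Set K := markIn K with hι
  set κ : Fin 2 → Zd d → Set K := fun i x => if x ∈ D i then ι x else ⊥ with hκ
  have hικ : ∀ i, ∀ x ∈ B' i, ι x = κ i x := by
    intro i x hx
    by_cases h : x ∈ D i
    · simp [hκ, h]
    · simp only [hκ, h, if_false]
      refine markIn_eq_bot fun hxK => ?_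
      obtain ⟨j, hj⟩ := hKD x hxK
      have hij : i ≠ j := fun e => h (e ▸ hj)
      exact hne i j hij x hx (hBB' j (hDB j x hj))
  set w : Fin 2 → Zd d → ℝ := fun i x => c⁻¹ * eqv (D i : Set (Zd d)) x with hw
  have hcw : ∀ i x, c * w i x = eqv (D i : Set (Zd d)) x := by
    intro i x; simp only [hw]; field_simp
  have hEsc : ∀ i, ∀ x ∈ D i, eqv (D i : Set (Zd d)) x = Esc (D i : Set (Zd d)) x :=
    fun i x hx => Set.indicator_of_mem (Finset.mem_coe.2 hx) _
  have sep : Separated ι D B w (δ * c) :=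
    { mark := fun y hy => markIn_eq_bot fun hyK => (hKD y hyK).elim hy
      sub := hDB
      step := by
        intro i x hx q
        by_cases h : nb x q ∈ B i
        · exact Or.inl h
        · refine Or.inr fun j hj => ?_
          by_cases hij : i = j
          · exact h (hij ▸ hj)
          · exact hne i j hij _ (hstep i x hx q) (hBB' j hj)
      nonneg := fun i x => mul_nonneg (inv_nonneg.2 hc.le) (eqv_nonneg _ x)
      sum := by
        intro i
        simp only [hw]
        rw [← Finset.mul_sum]
        have := hcap i
        unfold capv at this
        rw [this]
        field_simp
      kernel := by
        intro i y hy N z hz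
        rw [mul_assoc, hcw, hEsc i z hz]
        exact hkap i y (hy i) N z hz }
  have he : ∀ i, ∀ x ∈ D i, eqv (K : Set (Zd d)) x ≤ c * w i x := by
    intro i x hx
    rw [hcw, hEsc i x hx, eqv, Set.indicator_of_mem (Finset.mem_coe.2 (hDK i hx))]
    exact Esc_anti hd0 (Finset.coe_subset.2 (hDK i)) x
  set E : Fin 2 → Set (Set K) := fun i => {s | p i (Subtype.val '' s ∩ (D i : Set (Zd d)))} with hE
  set F : Fin 2 → Set K → ℝ := fun i => (E i).indicator 1 with hF
  have hmono : ∀ i, Monotone (F i) := by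
    intro i s t hst
    have : s ∈ E i → t ∈ E i := hp i _ _ (Set.inter_subset_inter_left _ (Set.image_mono hst))
    simp only [hF, Set.indicator_apply, Pi.one_apply]
    split_ifs with h1 h2 <;> first | exact absurd (this h1) h2 | norm_num
  have hF0 : ∀ i, 0 ≤ F i := fun i s => Set.indicator_nonneg (fun _ _ => zero_le_one) s
  have hF1 : ∀ i, F i ≤ 1 := fun i s => Set.indicator_le_self' (fun _ _ => zero_le_one) s
  have hshift : ∀ i j, i ≠ j → ∀ s ∈ ι '' B' j, shift s (F i) = F i := by
    rintro i j hij _ ⟨y, hy, rfl⟩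
    funext a
    have hyD : y ∉ D i := fun h => hne j i hij.symm y hy (hBB' i (hDB i y h))
    have : Subtype.val '' (a ⊔ ι y) ∩ (D i : Set (Zd d)) = Subtype.val '' a ∩ (D i : Set (Zd d)) := by
      ext x
      simp only [Set.sup_eq_union, Set.image_union, Set.mem_inter_iff, Set.mem_union,
        and_congr_left_iff, Finset.mem_coe]
      intro hx
      refine ⟨fun h => h.resolve_right ?_, Or.inl⟩
      rintro ⟨z, hz, rfl⟩
      have e : (z : Zd d) = y := hz
      exact hyD (e ▸ hx)
    rw [shift_apply]
    simp only [hF, Set.indicator_apply, hE, Set.mem_ofPred_eq, this, Pi.one_apply]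
  set T : Fin 2 → ℕ → Set K → ℝ := fun i N => NormedSpace.exp
    (u • (mixOp (κ i) Set.univ N (D i) (eqv (D i : Set (Zd d))) - capv (D i) • (1 : Op (Set K))))
      (F i) with hT
  have hbox : ∀ i N, NormedSpace.exp ((u * c) • (mixOp ι (B i) N (D i) (w i) - 1 : Op (Set K)))
      (F i) ⊥ ≤ T i N ⊥ := by
    intro i N
    have e1 : mixOp ι (B i) N (D i) (w i) = mixOp (κ i) (B i) N (D i) (w i) := by
      unfold mixOp
      refine Finset.sum_congr rfl fun x hx => ?_
      rw [wop_congr (hstep i) (hικ i) N (hBB' i (hDB i x hx))]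
    have e2 : ∀ A, c • mixOp (κ i) A N (D i) (w i) =
        mixOp (κ i) A N (D i) (eqv (D i : Set (Zd d))) := by
      intro A
      unfold mixOp
      rw [Finset.smul_sum]
      refine Finset.sum_congr rfl fun x hx => ?_
      rw [smul_smul, hcw]
    have e3 : (u * c) • (mixOp ι (B i) N (D i) (w i) - 1 : Op (Set K)) =
        u • (mixOp (κ i) (B i) N (D i) (eqv (D i : Set (Zd d))) - capv (D i) • (1 : Op (Set K))) := by
      rw [e1, hcap, ← e2, mul_smul, smul_sub c]
    rw [e3]
    have gen : ∀ A, IsGen (u • (mixOp (κ i) A N (D i) (eqv (D i : Set (Zd d))) -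
        capv (D i) • (1 : Op (Set K)))) := fun A =>
      (IsGen.of_conv (mixOp_conv _ _ _ (eqv_nonneg _)) (mixOp_one hd0 _ _ _ _ _)).smul hu
    refine IsGen.exp_le (gen _) (gen _) (fun G hG => ?_) (hmono i) ⊥
    intro a
    have := mixOp_le_univ hd0 (ι := κ i) (B := B i) (N := N) (D := D i) (eqv_nonneg (D i : Set (Zd d)))
      hG a
    exact mul_le_mul_of_nonneg_left (sub_le_sub_right this _) hu
  have hfin : ∀ N, NormedSpace.exp (u' • (mixOp ι Set.univ N K (eqv (K : Set (Zd d))) -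
      capv K • (1 : Op (Set K)))) ((E 0 ∩ E 1).indicator 1) ⊥ ≤ T 0 N ⊥ * T 1 N ⊥ +
      (Real.exp (2 * (u' * (4 * r * c * (δ * c))) - k) +
        2 * Real.exp (((r + 1) * k : ℕ) - (u - u') * c / 2) +
        u' * (2 * c * (2 * (δ * c)) ^ (r + 1))) := by
    intro N
    have hFF : (E 0 ∩ E 1).indicator (1 : Set K → ℝ) = F 0 * F 1 := by
      funext s
      simp only [hF, Pi.mul_apply, ← Set.inter_indicator_mul, Pi.one_apply, mul_one]
      rfl
    rw [hFF]
    have hconv : ∀ i, IsConv (mixOp ι (B i) N (D i) (w i)) := fun i =>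
      mixOp_conv _ _ _ (sep.nonneg i)
    have hacts : ∀ i, ActsOn (ι '' B' i) (mixOp ι (B i) N (D i) (w i)) := fun i =>
      ActsOn.sum _ fun x hx => (wop_actsOn (hstep i) N (hBB' i (hDB i x hx))).smul _
    have main := decouple_operator (hconv 0) (sep.markov hd0 0 _ N) (hconv 1) (sep.markov hd0 1 _ N)
      (hacts 0) (hacts 1) (hshift 0 1 (by decide)) (hshift 1 0 (by decide)) (hmono 0) (hmono 1)
      (hF0 0) (hF0 1) (hF1 0) (hF1 1)
      (X := mixOp ι Set.univ N K (eqv (K : Set (Zd d))) - capv K • (1 : Op (Set K)))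
      (IsGen.of_conv (mixOp_conv _ _ _ (eqv_nonneg _)) (mixOp_one hd0 _ _ _ _ _))
      hc.le (b := 4 * r * c * (δ * c)) (by positivity) (ρ := 2 * c * (2 * (δ * c)) ^ (r + 1))
      (by positivity) (r + 1)
      (fun G hG => sep.generator_le hd0 (by positivity) hδc N hKD (eqv_nonneg _) hc.le he r hG)
      hu' huu k ⊥
    refine main.trans (add_le_add_left ?_ _)
    have hpos : ∀ i, 0 ≤ NormedSpace.exp ((u * c) • (mixOp ι (B i) N (D i) (w i) - 1 : Op (Set K)))
        (F i) ⊥ := by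
      intro i
      have g := (IsGen.of_markov (hconv i) (sep.markov hd0 i _ N)).smul (mul_nonneg hu hc.le)
      exact g.exp_conv.nonneg _ (hF0 i) ⊥
    exact mul_le_mul (hbox 0 N) (hbox 1 N) (hpos 1) ((hpos 0).trans (hbox 0 N))
  have lim := law_tendsto hd hP hQ' ι K (fun x hx => markIn_eq_bot hx) (E 0 ∩ E 1)
  have limi := fun i => law_tendsto hd hP hQ (κ i) (D i) (fun x hx => by simp [hκ, hx]) (E i)
  have hsetK : {Y | joinMarks ι K Y ∈ E 0 ∩ E 1} =
      {Y | p 0 (occ Y ∩ D 0) ∧ p 1 (occ Y ∩ D 1)} := by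
    have := fun i => image_joinMarks (hDK i) ι (fun _ _ => rfl) (hDK i) (fun _ => subset_rfl)
    ext Y
    simp only [hE, Set.mem_ofPred_eq, Set.mem_inter_iff, this]
  have hseti : ∀ i, {Y | joinMarks (κ i) (D i) Y ∈ E i} = {Y | p i (occ Y ∩ D i)} := by
    intro i
    have := image_joinMarks (hDK i) (κ i) (fun x hx => by simp [hκ, hx, hι]) subset_rfl
      (fun x => by
        by_cases h : x ∈ D i
        · simp [hκ, h, hι]
        · simp [hκ, h])
    ext Y
    simp only [hE, Set.mem_ofPred_eq, this]
  rw [hsetK] at lim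
  simp only [hseti] at limi
  exact le_of_tendsto_of_tendsto' lim (((limi 0).mul (limi 1)).add_const _) hfin

end Decoupling

section Translation

variable {d : ℕ} {P : Zd d → Measure (ℕ → Zd d)}

open Classical in
lemma setOf_local_eq (D : Finset (Zd d)) (p : Set (Zd d) → Prop) :
    {Y : Zd d → Bool | p (occ Y ∩ D)} =
      {Y | joinMarks (markIn D) D Y ∈ {s : Set D | p (Subtype.val '' s ∩ (D : Set (Zd d)))}} := by
  ext Y
  simp only [Set.mem_ofPred_eq,
    image_joinMarks (subset_refl D) (markIn D) (fun _ _ => rfl) subset_rfl (fun _ => subset_rfl)]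

lemma measurableSet_local (D : Finset (Zd d)) (p : Set (Zd d) → Prop) :
    MeasurableSet {Y : Zd d → Bool | p (occ Y ∩ D)} := by
  classical
  rw [setOf_local_eq]
  exact measurableSet_joinMarks _ _ _

/-- The probabilities of local events are determined by the level. -/
lemma law_unique (hd : 3 ≤ d) (hP : IsSRW d P) {u : ℝ} {Q₁ Q₂ : Measure (Zd d → Bool)}
    (h₁ : IsVacantLaw P u Q₁) (h₂ : IsVacantLaw P u Q₂) (D : Finset (Zd d))
    (p : Set (Zd d) → Prop) :
    (Q₁ {Y | p (occ Y ∩ D)}).toReal = (Q₂ {Y | p (occ Y ∩ D)}).toReal := by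
  classical
  rw [setOf_local_eq]
  exact tendsto_nhds_unique (law_tendsto hd hP h₁ _ D (fun x hx => markIn_eq_bot hx) _)
    (law_tendsto hd hP h₂ _ D (fun x hx => markIn_eq_bot hx) _)

lemma measurable_translate (z : Zd d) : Measurable fun (Y : Zd d → Bool) (x : Zd d) => Y (x + z) :=
  measurable_pi_lambda _ fun _ => measurable_pi_apply _

lemma IsVacantLaw.translate (hd : 0 < d) (hP : IsSRW d P) {u : ℝ} {Q : Measure (Zd d → Bool)}
    (h : IsVacantLaw P u Q) (z : Zd d) : IsVacantLaw P u (Q.map fun Y x => Y (x + z)) := by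
  have := h.1
  refine ⟨Measure.isProbabilityMeasure_map (measurable_translate z).aemeasurable, fun K => ?_⟩
  have hm : MeasurableSet {Y : Zd d → Bool | ∀ x ∈ K, Y x = true} := by
    have : {Y : Zd d → Bool | ∀ x ∈ K, Y x = true} = ⋂ x ∈ K, {Y | Y x = true} := by
      ext; simp
    rw [this]
    refine Finset.measurableSet_biInter _ fun x _ => ?_
    exact measurableSet_eq_fun (measurable_pi_apply x) measurable_const
  rw [Measure.map_apply (measurable_translate z) hm, capa_eq hd hP, ← capv_translate hd K z,
    ← capa_eq hd hP, ← h.2]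
  congr 1
  ext Y
  simp [Finset.mem_map]

end Translation

section Crossing

variable {d : ℕ}

/-- There is a planar `*`-path in `s` from the box of radius `L` to the interior boundary of the
box of radius `3 * L`, both centered at `z`. -/
def crosses (z : Zd d) (L : ℕ) (s : Set (Zd d)) : Prop :=
  HasStarPath {x | inPlane x ∧ ∀ i, |x i - z i| ≤ (L : ℤ)}
    (intBdry {x | ∀ i, |x i - z i| ≤ (3 * L : ℤ)}) {x | inPlane x ∧ x ∈ s}

lemma crosses_mono (z : Zd d) (L : ℕ) {s t : Set (Zd d)} (h : s ⊆ t) (hs : crosses z L s) :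
    crosses z L t := by
  obtain ⟨N, w, h0, hN, hA, hst⟩ := hs
  exact ⟨N, w, h0, hN, fun k hk => ⟨(hA k hk).1, h (hA k hk).2⟩, hst⟩

lemma mem_qEvent {L : ℕ} {Y : Zd d → Bool} : Y ∈ qEvent d L ↔ crosses 0 L (occ Y) := by
  simp [qEvent, crosses, occ]

lemma inPlane_sub {x z : Zd d} (hx : inPlane x) (hz : inPlane z) : inPlane (x - z) := by
  intro i hi
  simp [hx i hi, hz i hi]

lemma crosses_translate {z : Zd d} (hz : inPlane z) {L : ℕ} {s : Set (Zd d)}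
    (h : crosses z L s) : crosses 0 L ((· + z) ⁻¹' s) := by
  obtain ⟨N, w, h0, hN, hA, hst⟩ := h
  refine ⟨N, fun k => w k - z, ⟨inPlane_sub h0.1 hz, by simpa using h0.2⟩, ?_,
    fun k hk => ⟨inPlane_sub (hA k hk).1 hz, by simpa using (hA k hk).2⟩, fun k hk => ?_⟩
  · obtain ⟨h1, y, h2, h3⟩ := hN
    refine ⟨by simpa using h1, y - z, by simpa using h2, ?_⟩
    simpa [adj] using h3
  · obtain ⟨h1, h2⟩ := hst k hk
    exact ⟨fun e => h1 (sub_left_injective e), by simpa using h2⟩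

/-- The sup-distance. -/
def dist_sup (x z : Zd d) : ℕ := Finset.univ.sup fun i => (x i - z i).natAbs

lemma dist_sup_le {x z : Zd d} {M : ℕ} : dist_sup x z ≤ M ↔ ∀ i, |x i - z i| ≤ M := by
  simp only [dist_sup, Finset.sup_le_iff, Finset.mem_univ, true_imp_iff]
  refine forall_congr' fun i => ?_
  rw [Int.abs_eq_natAbs, Nat.cast_le]

lemma le_dist_sup (x z : Zd d) (i : Fin d) : |x i - z i| ≤ dist_sup x z := dist_sup_le.1 le_rfl i

lemma exists_eq_dist_sup (hd : 0 < d) (x z : Zd d) : ∃ i, |x i - z i| = dist_sup x z := by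
  have : Nonempty (Fin d) := ⟨⟨0, hd⟩⟩
  obtain ⟨i, -, hi⟩ := Finset.exists_mem_eq_sup (Finset.univ : Finset (Fin d))
    Finset.univ_nonempty fun i => (x i - z i).natAbs
  refine ⟨i, ?_⟩
  rw [dist_sup, hi, Int.abs_eq_natAbs]

lemma dist_sup_step {x y : Zd d} (h : starAdj x y) (z : Zd d) : dist_sup y z ≤ dist_sup x z + 1 := by
  refine dist_sup_le.2 fun i => ?_
  have h1 := h.2 i
  have h2 := le_dist_sup x z i
  rw [abs_le] at *
  push_cast
  constructor <;> linarith

lemma exists_first_eq {f : ℕ → ℕ} {N a : ℕ} (h0 : f 0 ≤ a) (hN : a ≤ f N)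
    (hf : ∀ k < N, f (k + 1) ≤ f k + 1) : ∃ k ≤ N, f k = a ∧ ∀ j ≤ k, f j ≤ a := by
  classical
  have hex : ∃ k, a ≤ f k := ⟨N, hN⟩
  have hk := Nat.find_spec hex
  have hkN : Nat.find hex ≤ N := Nat.find_min' hex hN
  have hlt : ∀ j < Nat.find hex, f j < a := fun j hj => not_le.1 (Nat.find_min hex hj)
  have heq : f (Nat.find hex) = a := by
    rcases Nat.eq_zero_or_pos (Nat.find hex) with h | h
    · rw [h] at hk ⊢; omega
    · obtain ⟨j, hj⟩ := Nat.exists_eq_succ_of_ne_zero h.ne'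
      have h1 := hlt j (by omega)
      have h2 := hf j (by omega)
      rw [hj] at hk ⊢
      simp only [Nat.succ_eq_add_one] at *
      omega
  refine ⟨_, hkN, heq, fun j hj => ?_⟩
  rcases hj.eq_or_lt with h | h
  · rw [h, heq]
  · exact (hlt j h).le

lemma mem_intBdry_of_dist_sup (hd : 0 < d) {x z : Zd d} {L : ℕ} (h : dist_sup x z = 3 * L) :
    x ∈ intBdry {x : Zd d | ∀ i, |x i - z i| ≤ (3 * L : ℤ)} := by
  have h1 := dist_sup_le.1 h.le
  push_cast at h1
  refine ⟨h1, ?_⟩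
  obtain ⟨i, hi⟩ := exists_eq_dist_sup hd x z
  rw [h] at hi
  push_cast at hi
  have key : ∃ b : Bool, 3 * (L : ℤ) < |nb x (i, b) i - z i| := by
    rcases le_total 0 (x i - z i) with h0 | h0
    · rw [abs_of_nonneg h0] at hi
      refine ⟨true, lt_of_lt_of_le ?_ (le_abs_self _)⟩
      simp [nb]; omega
    · rw [abs_of_nonpos h0] at hi
      refine ⟨false, lt_of_lt_of_le ?_ (neg_le_abs _)⟩
      simp [nb]; omega
  obtain ⟨b, hb⟩ := key
  exact ⟨nb x (i, b), fun hh => absurd (hh i) (not_le.2 hb), (adj_iff _ _).2 ⟨_, rfl⟩⟩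

lemma crosses_of_path (hd : 0 < d) {w : ℕ → Zd d} {N k₀ : ℕ} {z : Zd d} {L : ℕ} {s : Set (Zd d)}
    (hk : k₀ ≤ N) (hw : ∀ k ≤ N, inPlane (w k) ∧ w k ∈ s)
    (hst : ∀ k < N, starAdj (w k) (w (k + 1))) (h0 : dist_sup (w k₀) z ≤ L)
    (hN : 3 * L ≤ dist_sup (w N) z) : crosses z L (s ∩ bx z (3 * L)) := by
  obtain ⟨k, hkN, hke, hkl⟩ := exists_first_eq (f := fun j => dist_sup (w (k₀ + j)) z) (N := N - k₀)
    (a := 3 * L) (by simp only [add_zero]; omega) (by simpa [Nat.add_sub_cancel' hk] using hN)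
    (fun j hj => dist_sup_step (hst (k₀ + j) (by omega)) z)
  refine ⟨k, fun j => w (k₀ + j), ⟨(hw k₀ hk).1, dist_sup_le.1 h0⟩,
    mem_intBdry_of_dist_sup hd hke, fun j hj => ?_, fun j hj => hst (k₀ + j) (by omega)⟩
  obtain ⟨h1, h2⟩ := hw (k₀ + j) (by omega)
  exact ⟨h1, h2, Finset.mem_coe.2 (mem_bx.2 (dist_sup_le.1 (hkl j hj)))⟩

lemma measure_crosses_le (hd : 3 ≤ d) {P : Zd d → Measure (ℕ → Zd d)} (hP : IsSRW d P) {u : ℝ}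
    {Q : Measure (Zd d → Bool)} (hQ : IsVacantLaw P u Q) {z : Zd d} (hz : inPlane z) (L : ℕ) :
    (Q {Y | crosses z L (occ Y ∩ bx z (3 * L))}).toReal ≤ (Q (qEvent d L)).toReal := by
  have hd0 : 0 < d := by omega
  have := hQ.1
  set R : Set (Zd d → Bool) := {Y | crosses 0 L (occ Y ∩ bx (0 : Zd d) (3 * L))} with hR
  have h1 : {Y | crosses z L (occ Y ∩ bx z (3 * L))} ⊆ (fun Y x => Y (x + z)) ⁻¹' R := by
    intro Y hY
    have := crosses_translate hz hY
    refine crosses_mono 0 L (fun x hx => ?_) this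
    obtain ⟨hx1, hx2⟩ := hx
    refine ⟨hx1, ?_⟩
    rw [Finset.mem_coe, mem_bx] at hx2 ⊢
    simpa using hx2
  have h2 : R ⊆ qEvent d L := fun Y hY => mem_qEvent.2 (crosses_mono 0 L Set.inter_subset_left hY)
  have hRm : MeasurableSet R := measurableSet_local _ _
  calc (Q {Y | crosses z L (occ Y ∩ bx z (3 * L))}).toReal
      ≤ (Q ((fun Y x => Y (x + z)) ⁻¹' R)).toReal := ENNReal.toReal_mono (measure_ne_top _ _)
        (measure_mono h1)
    _ = ((Q.map fun Y x => Y (x + z)) R).toReal := by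
        rw [Measure.map_apply (measurable_translate z) hRm]
    _ = (Q R).toReal := law_unique hd hP (hQ.translate hd0 hP z) hQ _ _
    _ ≤ _ := ENNReal.toReal_mono (measure_ne_top _ _) (measure_mono h2)

/-- The planar point with coordinate `t` on the axis `a` and `v` on the other axis. -/
def planePt (a : Bool) (t v : ℤ) : Zd d := fun i =>
  if (i : ℕ) = 0 then (if a then t else v) else if (i : ℕ) = 1 then (if a then v else t) else 0

lemma inPlane_planePt (a : Bool) (t v : ℤ) : inPlane (planePt a t v : Zd d) := by
  intro i hi
  simp only [planePt]
  rw [if_neg (by omega), if_neg (by omega)]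

/-- Parameters of the centers at sup-distance `s * ℓ * L` from the origin. -/
noncomputable def centerIdx (M : ℕ) : Finset (Bool × Bool × ℤ) :=
  Finset.univ ×ˢ Finset.univ ×ˢ Finset.Icc (-(M : ℤ)) M

/-- Centers at sup-distance `M * L` from the origin. -/
def center (M L : ℕ) (q : Bool × Bool × ℤ) : Zd d :=
  planePt q.1 (if q.2.1 then M * L else -(M * L)) (q.2.2 * L)

lemma card_centerIdx (M : ℕ) : (centerIdx M).card = 4 * (2 * M + 1) := by
  simp only [centerIdx, Finset.card_product, Finset.card_univ, Fintype.card_bool, Int.card_Icc]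
  omega

lemma exists_center (hd : 2 ≤ d) {x : Zd d} (hx : inPlane x) {M L : ℕ} (hL : 1 ≤ L)
    (h : dist_sup x 0 = M * L) : ∃ q ∈ centerIdx M, dist_sup x (center M L q) ≤ L := by
  have hLz : (0 : ℤ) < L := by exact_mod_cast hL
  have hle := dist_sup_le.1 h.le
  obtain ⟨i, hi⟩ := exists_eq_dist_sup (by omega) x 0
  rw [h] at hi
  simp only [Pi.zero_apply, sub_zero] at hi hle
  push_cast at hi hle
  set i0 : Fin d := ⟨0, by omega⟩
  set i1 : Fin d := ⟨1, by omega⟩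
  have key : ∃ a : Bool, |x (if a then i0 else i1)| = M * L := by
    rcases Nat.lt_or_ge i 2 with h2 | h2
    · obtain h3 | h3 : (i : ℕ) = 0 ∨ (i : ℕ) = 1 := by omega
      · exact ⟨true, by rw [if_pos rfl, ← hi]; congr 2; ext; simp [i0, h3]⟩
      · refine ⟨false, ?_⟩
        rw [if_neg (by simp), ← hi]; congr 2; ext; simp [i1, h3]
    · rw [hx i h2] at hi
      refine ⟨true, ?_⟩
      rw [if_pos rfl]
      have := hle i0
      rw [← hi] at this ⊢
      simpa using this
  obtain ⟨a, ha⟩ := key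
  set v := x (if a then i1 else i0) with hv
  have hvle : |v| ≤ M * L := hle _
  rw [abs_le] at hvle
  have hj1 : v / L ≤ M := by
    refine Int.ediv_le_of_le_mul hLz hvle.2
  have hj2 : -(M : ℤ) ≤ v / L := by
    rw [Int.le_ediv_iff_mul_le hLz]; linarith [hvle.1]
  have hr1 : 0 ≤ v - v / L * L := by have := Int.ediv_mul_le v hLz.ne'; linarith
  have hr2 : v - v / L * L ≤ L := by have := Int.lt_ediv_add_one_mul_self v hLz; linarith
  have habs : |v - v / L * L| ≤ L := by rw [abs_of_nonneg hr1]; exact hr2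
  obtain ⟨b, hb⟩ : ∃ b : Bool, x (if a then i0 else i1) = if b then (M * L : ℤ) else -(M * L) := by
    rcases abs_eq (by positivity : (0 : ℤ) ≤ M * L) |>.1 ha with h | h
    · exact ⟨true, by simpa using h⟩
    · exact ⟨false, by simpa using h⟩
  refine ⟨(a, b, v / L), by simp [centerIdx, hj1, hj2], dist_sup_le.2 fun j => ?_⟩
  simp only [center, planePt]
  rcases Nat.lt_or_ge j 2 with h2 | h2
  · obtain h3 | h3 : (j : ℕ) = 0 ∨ (j : ℕ) = 1 := by omega
    · have ej : j = i0 := by ext; simp [i0, h3]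
      cases a
      · simp only [Bool.false_eq_true, if_false] at hv hb ⊢
        rw [if_pos h3, ej, ← hv]
        exact habs
      · simp only [if_true] at hv hb ⊢
        rw [if_pos h3, ej, hb, sub_self, abs_zero]
        exact hLz.le
    · have ej : j = i1 := by ext; simp [i1, h3]
      cases a
      · simp only [Bool.false_eq_true, if_false] at hv hb ⊢
        rw [if_neg (by omega), if_pos h3, ej, hb, sub_self, abs_zero]
        exact hLz.le
      · simp only [if_true] at hv hb ⊢
        rw [if_neg (by omega), if_pos h3, ej, ← hv]
        exact habs
  · rw [if_neg (by omega), if_neg (by omega), hx j h2]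
    simp

lemma abs_center_le {M L : ℕ} {q : Bool × Bool × ℤ} (hq : q ∈ centerIdx M) (i : Fin d) :
    |(center M L q : Zd d) i| ≤ M * L := by
  simp only [centerIdx, Finset.mem_product, Finset.mem_univ, true_and, Finset.mem_Icc] at hq
  have h0 : (0 : ℤ) ≤ M * L := by positivity
  have h1 : |if q.2.1 then (M * L : ℤ) else -(M * L)| ≤ M * L := by
    split_ifs
    · rw [abs_of_nonneg h0]
    · rw [abs_neg, abs_of_nonneg h0]
  have h2 : |q.2.2 * (L : ℤ)| ≤ M * L := by
    rw [abs_mul, Nat.abs_cast]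
    exact mul_le_mul_of_nonneg_right (abs_le.2 hq) (by positivity)
  simp only [center]
  generalize (if q.2.1 then (M * L : ℤ) else -(M * L)) = t at h1 ⊢
  simp only [planePt]
  split_ifs <;> first | exact h1 | exact h2 | exact abs_zero.trans_le h0

lemma exists_abs_center_eq (hd : 2 ≤ d) (M L : ℕ) (q : Bool × Bool × ℤ) :
    ∃ i : Fin d, |(center M L q : Zd d) i| = M * L := by
  have h0 : (0 : ℤ) ≤ M * L := by positivity
  have h1 : |if q.2.1 then (M * L : ℤ) else -(M * L)| = M * L := by
    split_ifs
    · rw [abs_of_nonneg h0]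
    · rw [abs_neg, abs_of_nonneg h0]
  obtain ⟨a, b, j⟩ := q
  cases a
  · exact ⟨⟨1, by omega⟩, by simpa [center, planePt] using h1⟩
  · exact ⟨⟨0, by omega⟩, by simpa [center, planePt] using h1⟩

/-- A crossing at scale `ℓ L` produces two crossings at scale `L` around distant centers. -/
lemma qEvent_subset (hd : 2 ≤ d) {ℓ L : ℕ} (hL : 1 ≤ L) (hℓ : 3 ≤ ℓ) :
    qEvent d (ℓ * L) ⊆ ⋃ q ∈ centerIdx ℓ ×ˢ centerIdx (2 * ℓ),
      {Y : Zd d → Bool |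
        crosses (center ℓ L q.1) L (occ Y ∩ bx (center ℓ L q.1 : Zd d) (3 * L)) ∧
        crosses (center (2 * ℓ) L q.2) L (occ Y ∩ bx (center (2 * ℓ) L q.2 : Zd d) (3 * L))} := by
  intro Y hY
  rw [mem_qEvent] at hY
  obtain ⟨N, w, h0, hN, hA, hst⟩ := hY
  have hLl : 3 * (L : ℤ) ≤ ℓ * L := by
    have : (3 : ℤ) ≤ ℓ := by exact_mod_cast hℓ
    nlinarith
  have hd0 : 0 < d := by omega
  have hend : ∃ i, 3 * (ℓ * L : ℤ) ≤ |w N i| := by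
    obtain ⟨h1, y, h2, h3⟩ := hN
    simp only [Set.mem_ofPred_eq, not_forall, not_le, Pi.zero_apply, sub_zero] at h2 h1
    obtain ⟨i, hi⟩ := h2
    obtain ⟨p, rfl⟩ := (adj_iff _ _).1 h3
    have hb : w N ∈ bx (w N) 0 := mem_bx.2 fun i => by simp
    have h4 := mem_bx.1 (nb_mem_bx hb p) i
    refine ⟨i, ?_⟩
    push_cast at hi h4
    have h5 : |nb (w N) p i| ≤ |nb (w N) p i - w N i| + |w N i| := by
      simpa using abs_add_le (nb (w N) p i - w N i) (w N i)
    omega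
  obtain ⟨i, hi⟩ := hend
  have hstart : dist_sup (w 0) 0 ≤ ℓ * L := dist_sup_le.2 h0.2
  have hNd : 3 * (ℓ * L) ≤ dist_sup (w N) 0 := by
    have := le_dist_sup (w N) 0 i
    simp only [Pi.zero_apply, sub_zero] at this
    have h6 := hi.trans this
    exact_mod_cast h6
  have cross : ∀ M, (M = ℓ ∨ M = 2 * ℓ) → ∃ q ∈ centerIdx M,
      crosses (center M L q) L (occ Y ∩ bx (center M L q : Zd d) (3 * L)) := by
    intro M hM
    have hM1 : ℓ * L ≤ M * L := Nat.mul_le_mul_right _ (by omega)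
    have hM2 : M * L ≤ 2 * (ℓ * L) := by rw [← mul_assoc]; exact Nat.mul_le_mul_right _ (by omega)
    obtain ⟨k, hkN, hk, -⟩ := exists_first_eq (f := fun j => dist_sup (w j) 0) (a := M * L)
      (hstart.trans hM1) (by omega) (fun j hj => dist_sup_step (hst j hj) 0)
    obtain ⟨q, hq, hqL⟩ := exists_center hd (hA k hkN).1 hL hk
    refine ⟨q, hq, crosses_of_path hd0 hkN hA hst hqL ?_⟩
    have h7 := abs_center_le (d := d) (L := L) hq i
    have h8 := le_dist_sup (w N) (center M L q) i
    have h9 : |w N i| ≤ |w N i - (center M L q : Zd d) i| + |(center M L q : Zd d) i| := by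
      simpa using abs_add_le (w N i - (center M L q : Zd d) i) ((center M L q : Zd d) i)
    zify at hM2 ⊢
    linarith
  obtain ⟨q₁, hq₁, hc₁⟩ := cross ℓ (Or.inl rfl)
  obtain ⟨q₂, hq₂, hc₂⟩ := cross (2 * ℓ) (Or.inr rfl)
  simp only [Set.mem_iUnion]
  exact ⟨(q₁, q₂), Finset.mem_product.2 ⟨hq₁, hq₂⟩, hc₁, hc₂⟩

/-- One step of the renormalization. -/
lemma qEvent_step (hd : 3 ≤ d) {P : Zd d → Measure (ℕ → Zd d)} (hP : IsSRW d P) {u u' : ℝ}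
    {Q Q' : Measure (Zd d → Bool)} (hQ : IsVacantLaw P u Q) (hQ' : IsVacantLaw P u' Q')
    (hu' : 0 ≤ u') (huu : u' ≤ u) {L m : ℕ} (hL : 1 ≤ L) (hm : 1 ≤ m) {c δ : ℝ} (hc : 0 < c)
    (hcap : capv (bx (0 : Zd d) (3 * L)) = c) (hδ : 0 ≤ δ) (hδc : 2 * (δ * c) ≤ 1)
    (hkap : ∀ z y : Zd d, y ∉ bx z (40 * m * L) → ∀ N, ∀ x ∈ bx z (3 * L),
      kap (bx z (3 * L)) x N y ≤ δ * Esc (bx z (3 * L)) x) (r k : ℕ) :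
    (Q' (qEvent d ((100 * m + 1) * L))).toReal ≤ 240 * ((100 * m + 1 : ℕ) : ℝ) ^ 2 *
      ((Q (qEvent d L)).toReal ^ 2 +
      (Real.exp (2 * (u' * (4 * r * c * (δ * c))) - k) +
        2 * Real.exp (((r + 1) * k : ℕ) - (u - u') * c / 2) +
        u' * (2 * c * (2 * (δ * c)) ^ (r + 1)))) := by
  have hd0 : 0 < d := by omega
  have := hQ.1
  have := hQ'.1
  set ℓ := 100 * m + 1 with hℓ
  set err := Real.exp (2 * (u' * (4 * r * c * (δ * c))) - k) +
        2 * Real.exp (((r + 1) * k : ℕ) - (u - u') * c / 2) +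
        u' * (2 * c * (2 * (δ * c)) ^ (r + 1)) with herr
  have herr0 : 0 ≤ err := by positivity
  have hpair : ∀ q ∈ centerIdx ℓ ×ˢ centerIdx (2 * ℓ),
      Q'.real {Y : Zd d → Bool |
        crosses (center ℓ L q.1) L (occ Y ∩ bx (center ℓ L q.1 : Zd d) (3 * L)) ∧
        crosses (center (2 * ℓ) L q.2) L (occ Y ∩ bx (center (2 * ℓ) L q.2 : Zd d) (3 * L))} ≤
      (Q (qEvent d L)).toReal ^ 2 + err := by
    rintro ⟨q₁, q₂⟩ hq
    rw [Finset.mem_product] at hq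
    set z : Fin 2 → Zd d := ![center ℓ L q₁, center (2 * ℓ) L q₂] with hz
    have hzp : ∀ i, inPlane (z i) := by
      intro i; fin_cases i <;> exact inPlane_planePt _ _ _
    have main := decouple_law hd hP hQ hQ' hu' huu (D := fun i => bx (z i) (3 * L))
      (B := fun i => bx (z i) (40 * m * L)) (B' := fun i => bx (z i) (40 * m * L + 1)) hc hδ hδc
      (fun i => by rw [capv_bx hd0, hcap])
      (fun i x hx => bx_mono _ (Nat.mul_le_mul_right _ (by omega)) hx)
      (fun i => Finset.coe_subset.2 (bx_mono _ (Nat.le_succ _)))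
      (fun i x hx p => nb_mem_bx hx p) (by
        rw [Set.disjoint_left]
        intro x h0 h1
        obtain ⟨i, hi⟩ := exists_abs_center_eq (d := d) (by omega) (2 * ℓ) L q₂
        have hi2 := abs_center_le (d := d) (L := L) hq.1 i
        have a0 := mem_bx.1 (Finset.mem_coe.1 h0) i
        have a1 := mem_bx.1 (Finset.mem_coe.1 h1) i
        simp only [hz, Matrix.cons_val_zero, Matrix.cons_val_one] at a0 a1
        have hLz : (1 : ℤ) ≤ L := by exact_mod_cast hL
        have hmz : (1 : ℤ) ≤ m := by exact_mod_cast hm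
        have e : (ℓ : ℤ) * L = 100 * (m * L) + L := by rw [hℓ]; push_cast; ring
        have hmL : (1 : ℤ) ≤ m * L := by nlinarith
        push_cast at hi a0 a1
        rw [abs_le] at a0 a1 hi2
        rcases abs_cases ((center (2 * ℓ) L q₂ : Zd d) i) with h | h <;> nlinarith)
      (fun i y hy N x hx => hkap (z i) y hy N x hx)
      (fun i => crosses (z i) L) (fun i s t h => crosses_mono _ _ h) r k
    have h0 := measure_crosses_le hd hP hQ (hzp 0) L
    have h1 := measure_crosses_le hd hP hQ (hzp 1) L
    have hmul := mul_le_mul h0 h1 ENNReal.toReal_nonneg ENNReal.toReal_nonneg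
    rw [sq]
    exact main.trans (add_le_add_left hmul _)
  calc (Q' (qEvent d (ℓ * L))).toReal
      ≤ Q'.real (⋃ q ∈ centerIdx ℓ ×ˢ centerIdx (2 * ℓ), {Y : Zd d → Bool |
        crosses (center ℓ L q.1) L (occ Y ∩ bx (center ℓ L q.1 : Zd d) (3 * L)) ∧
        crosses (center (2 * ℓ) L q.2) L (occ Y ∩ bx (center (2 * ℓ) L q.2 : Zd d) (3 * L))}) :=
        measureReal_mono (qEvent_subset (by omega) hL (by omega)) (measure_ne_top _ _)
    _ ≤ _ := measureReal_biUnion_finset_le _ _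
    _ ≤ ∑ _q ∈ centerIdx ℓ ×ˢ centerIdx (2 * ℓ), ((Q (qEvent d L)).toReal ^ 2 + err) :=
        Finset.sum_le_sum hpair
    _ = ((4 * (2 * ℓ + 1) * (4 * (2 * (2 * ℓ) + 1)) : ℕ) : ℝ) *
        ((Q (qEvent d L)).toReal ^ 2 + err) := by
        rw [Finset.sum_const, Finset.card_product, card_centerIdx, card_centerIdx, nsmul_eq_mul]
    _ ≤ _ := by
        refine mul_le_mul_of_nonneg_right ?_ (by positivity)
        have h1 : (1 : ℝ) ≤ ℓ := by exact_mod_cast (by omega : 1 ≤ ℓ)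
        push_cast
        nlinarith

end Crossing

section Numerics

/-- The number of sub-boxes per unit at scale `L`. -/
noncomputable def mOf (L : ℕ) : ℕ := ⌊(L : ℝ) ^ ((1 : ℝ) / 100)⌋₊

lemma ellOf_eq (L : ℕ) : ellOf L = 100 * mOf L + 1 := rfl

lemma one_le_mOf {L : ℕ} (hL : 1 ≤ L) : 1 ≤ mOf L := by
  refine Nat.le_floor ?_
  rw [Nat.cast_one]
  exact Real.one_le_rpow (by exact_mod_cast hL) (by norm_num)

lemma rpow_le_two_mul_mOf {L : ℕ} (hL : 1 ≤ L) : (L : ℝ) ^ ((1 : ℝ) / 100) ≤ 2 * mOf L := by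
  have h1 : (1 : ℝ) ≤ mOf L := by exact_mod_cast one_le_mOf hL
  have h2 := Nat.lt_floor_add_one ((L : ℝ) ^ ((1 : ℝ) / 100))
  change _ < (mOf L : ℝ) + 1 at h2
  linarith

lemma tendsto_mOf : Tendsto mOf atTop atTop :=
  tendsto_nat_floor_atTop.comp ((tendsto_rpow_atTop (by norm_num)).comp tendsto_natCast_atTop_atTop)

lemma tendsto_log_natCast : Tendsto (fun L : ℕ => Real.log L) atTop atTop :=
  Real.tendsto_log_atTop.comp tendsto_natCast_atTop_atTop

lemma eventually_mul_log_le (K : ℝ) {s : ℝ} (hs : 0 < s) (hK : 0 < K) :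
    ∀ᶠ L : ℕ in atTop, K * Real.log L ≤ (L : ℝ) ^ s := by
  have h := (isLittleO_log_rpow_atTop hs).def (inv_pos.2 hK)
  filter_upwards [tendsto_natCast_atTop_atTop.eventually h] with L hL
  have h1 : |Real.log L| ≤ K⁻¹ * |(L : ℝ) ^ s| := by simpa using hL
  rw [abs_of_nonneg (Real.rpow_nonneg (Nat.cast_nonneg L) s)] at h1
  have h2 := (le_abs_self _).trans h1
  calc K * Real.log L ≤ K * (K⁻¹ * (L : ℝ) ^ s) := by gcongr
    _ = _ := by field_simp

lemma eventually_ellOf_sq_le : ∀ᶠ L : ℕ in atTop, ((ellOf L : ℝ)) ^ 2 ≤ L := by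
  have h := (tendsto_rpow_atTop (show (0 : ℝ) < 1 - 1 / 50 by norm_num)).comp
    (tendsto_natCast_atTop_atTop (R := ℝ))
  filter_upwards [h.eventually_ge_atTop (101 ^ 2 : ℝ), eventually_ge_atTop 1] with L h1 hL
  have hLr : (1 : ℝ) ≤ L := by exact_mod_cast hL
  simp only [Function.comp_apply] at h1
  have h2 : (mOf L : ℝ) ≤ (L : ℝ) ^ ((1 : ℝ) / 100) := Nat.floor_le (by positivity)
  have h3 : (1 : ℝ) ≤ (L : ℝ) ^ ((1 : ℝ) / 100) := Real.one_le_rpow hLr (by norm_num)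
  have h4 : (ellOf L : ℝ) ≤ 101 * (L : ℝ) ^ ((1 : ℝ) / 100) := by
    rw [ellOf_eq]; push_cast; linarith
  calc (ellOf L : ℝ) ^ 2 ≤ (101 * (L : ℝ) ^ ((1 : ℝ) / 100)) ^ 2 := by gcongr
    _ = 101 ^ 2 * (L : ℝ) ^ ((1 : ℝ) / 50) := by
        rw [mul_pow, ← Real.rpow_natCast ((L : ℝ) ^ _) 2, ← Real.rpow_mul (by positivity)]
        norm_num
    _ ≤ (L : ℝ) ^ (1 - 1 / 50 : ℝ) * (L : ℝ) ^ ((1 : ℝ) / 50) := by gcongr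
    _ = L := by rw [← Real.rpow_add (by positivity)]; norm_num

/-- Smallness of the normalized hitting kernel far from a box. -/
lemma exists_kernel_bound {d : ℕ} (hd : 3 ≤ d) : ∃ C : ℝ, 0 < C ∧ ∀ᶠ L : ℕ in atTop, ∃ δ : ℝ, 0 ≤ δ ∧
    δ * capv (bx (0 : Zd d) (3 * L)) ≤ C * (L : ℝ) ^ (-(1 / 200 : ℝ)) ∧
    ∀ z y : Zd d, y ∉ bx z (40 * mOf L * L) → ∀ N, ∀ x ∈ bx z (3 * L),
      kap (bx z (3 * L)) x N y ≤ δ * Esc (bx z (3 * L)) x := by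
  have hd3 : (3 : ℝ) ≤ d := by exact_mod_cast hd
  obtain ⟨C, L₁, hC, hL₁, hk⟩ := kap_le hd
  refine ⟨C * 2 * (13 * d : ℝ) ^ d, by positivity, ?_⟩
  filter_upwards [eventually_ge_atTop L₁, tendsto_mOf.eventually_ge_atTop d] with L hL hm
  set s : ℝ := (d : ℝ) - 2 - 1 / 400 with hs
  have hL1 : 1 ≤ L := hL₁.trans hL
  have hLr : (1 : ℝ) ≤ L := by exact_mod_cast hL1
  have hL0 : (0 : ℝ) < L := by linarith
  have hm1 : (1 : ℝ) ≤ mOf L := by exact_mod_cast one_le_mOf hL1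
  have hx1 : (1 : ℝ) ≤ (L : ℝ) ^ ((1 : ℝ) / 100) := Real.one_le_rpow hLr (by norm_num)
  refine ⟨C * ((mOf L * L : ℕ) : ℝ) ^ (-s), by positivity, ?_, hk L hL _ hm⟩
  have h1 : (mOf L : ℝ) ^ (-s) ≤ 2 * (L : ℝ) ^ (-(399 / 40000 : ℝ)) := by
    calc (mOf L : ℝ) ^ (-s) ≤ (mOf L : ℝ) ^ (-(399 / 400 : ℝ)) :=
          Real.rpow_le_rpow_of_exponent_le hm1 (by rw [hs]; linarith)
      _ ≤ ((L : ℝ) ^ ((1 : ℝ) / 100) / 2) ^ (-(399 / 400 : ℝ)) :=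
          Real.rpow_le_rpow_of_nonpos (by positivity) (by linarith [rpow_le_two_mul_mOf hL1])
            (by norm_num)
      _ = (L : ℝ) ^ (-(399 / 40000 : ℝ)) * (2 : ℝ) ^ (399 / 400 : ℝ) := by
          rw [Real.div_rpow (by positivity) (by norm_num), ← Real.rpow_mul hL0.le, div_eq_mul_inv,
            ← Real.rpow_neg (by norm_num)]
          norm_num
      _ ≤ (L : ℝ) ^ (-(399 / 40000 : ℝ)) * (2 : ℝ) ^ (1 : ℝ) := by
          gcongr <;> norm_num
      _ = _ := by rw [Real.rpow_one, mul_comm]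
  have h2 : capv (bx (0 : Zd d) (3 * L)) ≤ (13 * d : ℝ) ^ d * (L : ℝ) ^ ((d : ℝ) - 2) := by
    refine (capv_bx_le hd hL1 0).trans_eq ?_
    rw [← Real.rpow_natCast (L : ℝ) (d - 2)]
    push_cast [Nat.cast_sub (by omega : 2 ≤ d)]
    rfl
  have h3 : (L : ℝ) ^ (-s) * (L : ℝ) ^ ((d : ℝ) - 2) = (L : ℝ) ^ (1 / 400 : ℝ) := by
    rw [← Real.rpow_add hL0, hs]
    congr 1; ring
  have h4 : (L : ℝ) ^ (-(399 / 40000 : ℝ)) * (L : ℝ) ^ (1 / 400 : ℝ) ≤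
      (L : ℝ) ^ (-(1 / 200 : ℝ)) := by
    rw [← Real.rpow_add hL0]
    exact Real.rpow_le_rpow_of_exponent_le hLr (by norm_num)
  push_cast
  rw [Real.mul_rpow (by positivity) hL0.le]
  calc C * ((mOf L : ℝ) ^ (-s) * (L : ℝ) ^ (-s)) * capv (bx (0 : Zd d) (3 * L))
      ≤ C * (2 * (L : ℝ) ^ (-(399 / 40000 : ℝ)) * (L : ℝ) ^ (-s)) *
        ((13 * d : ℝ) ^ d * (L : ℝ) ^ ((d : ℝ) - 2)) := by
        gcongr
        exact capv_nonneg _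
    _ = C * 2 * (13 * d : ℝ) ^ d * ((L : ℝ) ^ (-(399 / 40000 : ℝ)) *
        ((L : ℝ) ^ (-s) * (L : ℝ) ^ ((d : ℝ) - 2))) := by ring
    _ ≤ _ := by rw [h3]; gcongr

/-- The error of the decoupling inequality with a good choice of `k`. -/
lemma exists_error_le {C A : ℝ} (hC : 0 < C) (hA : 0 < A) {d : ℕ} (hd : 3 ≤ d) {r : ℕ}
    (hr : r + 1 = 200 * (d + 5)) :
    ∀ᶠ L : ℕ in atTop, ∀ u u' c η : ℝ, 0 ≤ u' → u' ≤ 1 → 0 < c → c ≤ A * (L : ℝ) ^ (d - 2) → 0 ≤ η →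
      η ≤ C * (L : ℝ) ^ (-(1 / 200 : ℝ)) → u - u' = u' / Real.log L →
      64 * (r + 1) * (Real.log L) ^ 2 ≤ u' * c → ∃ k : ℕ,
        Real.exp (2 * (u' * (4 * r * c * η)) - k) +
          2 * Real.exp (((r + 1) * k : ℕ) - (u - u') * c / 2) +
          u' * (2 * c * (2 * η) ^ (r + 1)) ≤ 4 / (L : ℝ) ^ 6 := by
  have hlog := eventually_mul_log_le (64 * (r + 1) ^ 2 * C) (s := 1 / 200) (by norm_num) (by positivity)
  filter_upwards [hlog, tendsto_natCast_atTop_atTop.eventually_ge_atTop (2 * A * (2 * C) ^ (r + 1)),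
    tendsto_log_natCast.eventually_ge_atTop 1, eventually_ge_atTop 1] with L h1 h2 hl hL1
  intro u u' c η hu0 hu1 hc hcA hη hηC huu hlam
  have hLr : (1 : ℝ) ≤ L := by exact_mod_cast hL1
  have hL0 : (0 : ℝ) < L := by linarith
  set l := Real.log L with hldef
  have hl0 : 0 < l := by linarith
  set R : ℝ := (r : ℝ) + 1 with hR
  have hR1 : 1 ≤ R := by rw [hR]; have := Nat.cast_nonneg (α := ℝ) r; linarith
  set lam : ℝ := (u - u') * c with hlamdef
  have hlamu : u' * c = lam * l := by rw [hlamdef, huu]; field_simp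
  have hlam1 : 64 * R * l ≤ lam := by
    rw [hlamu] at hlam
    have : 64 * R * l * l ≤ lam * l := by nlinarith
    exact le_of_mul_le_mul_right this hl0
  have hlam0 : 0 ≤ lam := le_trans (by positivity) hlam1
  have hη1 : 64 * R ^ 2 * (η * l) ≤ 1 := by
    have e : (L : ℝ) ^ (-(1 / 200 : ℝ)) * (L : ℝ) ^ (1 / 200 : ℝ) = 1 := by
      rw [← Real.rpow_add hL0]; norm_num
    calc 64 * R ^ 2 * (η * l) ≤ 64 * R ^ 2 * (C * (L : ℝ) ^ (-(1 / 200 : ℝ)) * l) := by gcongr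
      _ = (L : ℝ) ^ (-(1 / 200 : ℝ)) * (64 * R ^ 2 * C * l) := by ring
      _ ≤ (L : ℝ) ^ (-(1 / 200 : ℝ)) * (L : ℝ) ^ (1 / 200 : ℝ) := by gcongr
      _ = 1 := e
  have hexp : ∀ n : ℕ, Real.exp (-(n * l)) = 1 / (L : ℝ) ^ n := by
    intro n
    rw [Real.exp_neg, Real.exp_nat_mul, hldef, Real.exp_log hL0, one_div]
  refine ⟨⌊lam / (4 * R)⌋₊, ?_⟩
  have hk1 : ((⌊lam / (4 * R)⌋₊ : ℕ) : ℝ) ≤ lam / (4 * R) := Nat.floor_le (by positivity)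
  have hk2 := Nat.lt_floor_add_one (lam / (4 * R))
  set k : ℕ := ⌊lam / (4 * R)⌋₊
  have hk1' : R * k ≤ lam / 4 := by
    have := mul_le_mul_of_nonneg_left hk1 (by linarith : 0 ≤ R)
    refine this.trans_eq ?_
    field_simp
  have t1 : Real.exp (2 * (u' * (4 * r * c * η)) - k) ≤ 1 / (L : ℝ) ^ 6 := by
    rw [← hexp]
    refine Real.exp_le_exp.2 ?_
    have e1 : 2 * (u' * (4 * r * c * η)) ≤ lam / (8 * R) := by
      rw [le_div_iff₀ (by positivity)]
      calc 2 * (u' * (4 * r * c * η)) * (8 * R) = (u' * c) * (64 * r * R * η) := by ring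
        _ = lam * (64 * r * R * (η * l)) := by rw [hlamu]; ring
        _ ≤ lam * (64 * R * R * (η * l)) := by
            gcongr
            rw [hR]; linarith
        _ = lam * (64 * R ^ 2 * (η * l)) := by ring
        _ ≤ lam * 1 := by gcongr
        _ = lam := mul_one _
    have e2 : 8 * l ≤ lam / (8 * R) := by
      rw [le_div_iff₀ (by positivity)]; linarith
    have e3 : lam / (4 * R) = 2 * (lam / (8 * R)) := by field_simp; ring
    rw [e3] at hk2
    push_cast
    linarith
  have t2 : 2 * Real.exp (((r + 1) * k : ℕ) - lam / 2) ≤ 2 * (1 / (L : ℝ) ^ 6) := by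
    rw [← hexp]
    refine mul_le_mul_of_nonneg_left (Real.exp_le_exp.2 ?_) (by norm_num)
    push_cast
    have : 64 * l ≤ 64 * R * l := by nlinarith
    linarith
  have t3 : u' * (2 * c * (2 * η) ^ (r + 1)) ≤ 1 / (L : ℝ) ^ 6 := by
    have e0 : 1 / (L : ℝ) ^ (d + 5) = (L : ℝ) ^ (-((d + 5 : ℕ) : ℝ)) := by
      rw [Real.rpow_neg hL0.le, Real.rpow_natCast, one_div]
    have e1 : ((L : ℝ) ^ (-(1 / 200 : ℝ))) ^ (r + 1) = 1 / (L : ℝ) ^ (d + 5) := by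
      rw [e0, ← Real.rpow_natCast, ← Real.rpow_mul hL0.le, hr]
      congr 1
      push_cast
      ring
    have e2 : (2 * η) ^ (r + 1) ≤ (2 * C) ^ (r + 1) * (1 / (L : ℝ) ^ (d + 5)) := by
      rw [← e1, ← mul_pow]
      exact pow_le_pow_left₀ (by positivity) (by linarith) _
    have e3 : (L : ℝ) ^ (d + 5) = (L : ℝ) ^ (d - 2) * (L : ℝ) ^ 7 := by
      rw [← pow_add]
      congr 1
      omega
    calc u' * (2 * c * (2 * η) ^ (r + 1))
        ≤ 1 * (2 * (A * (L : ℝ) ^ (d - 2)) * ((2 * C) ^ (r + 1) * (1 / (L : ℝ) ^ (d + 5)))) := by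
          gcongr
      _ = (2 * A * (2 * C) ^ (r + 1)) * ((L : ℝ) ^ (d - 2) / (L : ℝ) ^ (d + 5)) := by ring
      _ ≤ L * ((L : ℝ) ^ (d - 2) / (L : ℝ) ^ (d + 5)) := by gcongr
      _ = 1 / (L : ℝ) ^ 6 := by
          rw [e3]
          field_simp
  have : (4 : ℝ) / (L : ℝ) ^ 6 = 1 / (L : ℝ) ^ 6 + 2 * (1 / (L : ℝ) ^ 6) + 1 / (L : ℝ) ^ 6 := by ring
  rw [this]
  exact add_le_add (add_le_add t1 t2) t3

end Numerics

section Induction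

lemma recursion_closes {ℓ ℓ' L q e q' : ℝ} (hL : 960 ≤ L) (hℓ : 1 ≤ ℓ) (hℓL : ℓ ^ 2 ≤ L)
    (hℓ' : ℓ' ^ 2 ≤ ℓ * L) (hq0 : 0 ≤ q) (hq : 480 * ℓ ^ 2 * q ≤ L⁻¹) (he : e ≤ 4 / L ^ 6)
    (hq' : q' ≤ 240 * ℓ ^ 2 * (q ^ 2 + e)) : 480 * ℓ' ^ 2 * q' ≤ (ℓ * L)⁻¹ := by
  have hL0 : 0 < L := by linarith
  have hℓ0 : 0 < ℓ := by linarith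
  have h1 : q ≤ 1 / (480 * ℓ ^ 2 * L) := by
    rw [le_div_iff₀ (by positivity)]
    calc q * (480 * ℓ ^ 2 * L) = (480 * ℓ ^ 2 * q) * L := by ring
      _ ≤ L⁻¹ * L := by gcongr
      _ = 1 := inv_mul_cancel₀ hL0.ne'
  have h2 : ℓ ^ 4 * 1843200 ≤ L ^ 4 * 2 := by
    have h3 : ℓ ^ 4 ≤ L ^ 2 := by
      calc ℓ ^ 4 = (ℓ ^ 2) ^ 2 := by ring
        _ ≤ L ^ 2 := by gcongr
    have h4 : (960 : ℝ) ^ 2 ≤ L ^ 2 := by gcongr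
    nlinarith
  calc 480 * ℓ' ^ 2 * q' ≤ 480 * ℓ' ^ 2 * (240 * ℓ ^ 2 * (q ^ 2 + e)) := by gcongr
    _ ≤ 480 * ℓ' ^ 2 * (240 * ℓ ^ 2 * ((1 / (480 * ℓ ^ 2 * L)) ^ 2 + 4 / L ^ 6)) := by gcongr
    _ ≤ 480 * (ℓ * L) * (240 * ℓ ^ 2 * ((1 / (480 * ℓ ^ 2 * L)) ^ 2 + 4 / L ^ 6)) := by gcongr
    _ = (1 / 2 + 460800 * (ℓ ^ 4 / L ^ 4)) * (ℓ * L)⁻¹ := by field_simp; ring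
    _ ≤ (1 / 2 + 1 / 2) * (ℓ * L)⁻¹ := by
        gcongr
        rw [← mul_div_assoc, div_le_iff₀ (by positivity)]
        linarith
    _ = (ℓ * L)⁻¹ := by ring

lemma scale_step {d : ℕ} (hd : 3 ≤ d) : ∃ κ : ℝ, 0 < κ ∧ ∀ᶠ L : ℕ in atTop,
    ∀ (P : Zd d → Measure (ℕ → Zd d)) (Q Q' : Measure (Zd d → Bool)) (u u' : ℝ), IsSRW d P →
      IsVacantLaw P u Q → IsVacantLaw P u' Q' → 0 ≤ u' → u' ≤ 1 →
      u = (1 + 1 / Real.log L) * u' → (Real.log L) ^ 2 ≤ κ * u' * (L : ℝ) ^ (d - 2) →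
      480 * (ellOf L : ℝ) ^ 2 * (Q (qEvent d L)).toReal ≤ (L : ℝ)⁻¹ →
      480 * (ellOf (ellOf L * L) : ℝ) ^ 2 * (Q' (qEvent d (ellOf L * L))).toReal ≤
        ((ellOf L * L : ℕ) : ℝ)⁻¹ := by
  have hd0 : 1 ≤ d := by omega
  have hdr : (1 : ℝ) ≤ d := by exact_mod_cast hd0
  obtain ⟨C, hC, hker⟩ := exists_kernel_bound hd
  obtain ⟨c₀, L₁, hc₀, hL₁, hcap⟩ := le_capv_bx hd
  obtain ⟨r, hr⟩ : ∃ r : ℕ, r + 1 = 200 * (d + 5) := ⟨200 * (d + 5) - 1, by omega⟩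
  have herr := exists_error_le hC (show 0 < (13 * d : ℝ) ^ d by positivity) hd hr
  have hsq := eventually_ellOf_sq_le
  have hsmall := ((tendsto_rpow_atTop (show (0 : ℝ) < 1 / 200 by norm_num)).comp
    (tendsto_natCast_atTop_atTop (R := ℝ))).eventually_ge_atTop (2 * C)
  refine ⟨c₀ / (64 * (r + 1)), by positivity, ?_⟩
  have hsq' : ∀ᶠ L : ℕ in atTop, (ellOf (ellOf L * L) : ℝ) ^ 2 ≤ (ellOf L * L : ℕ) := by
    refine Tendsto.eventually (tendsto_atTop_mono (fun L => ?_) tendsto_id) hsq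
    exact Nat.le_mul_of_pos_left L (by rw [ellOf_eq]; omega)
  filter_upwards [hker, herr, hsq, hsq', hsmall, eventually_ge_atTop L₁, eventually_ge_atTop 960,
    tendsto_log_natCast.eventually_ge_atTop 1] with L hker herr hsq hsq' hsmall hLL₁ hL960 hlog
  intro P Q Q' u u' hP hQ hQ' hu0 hu1 huu hlam hq
  have hL960r : (960 : ℝ) ≤ L := by exact_mod_cast hL960
  have hL0 : (0 : ℝ) < L := by linarith
  have hL1 : 1 ≤ L := by omega
  obtain ⟨δ, hδ, hδc, hkap⟩ := hker
  have hc := hcap L hLL₁ 0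
  set c := capv (bx (0 : Zd d) (3 * L)) with hcdef
  have hcpos : 0 < c := lt_of_lt_of_le (by positivity) hc
  have huu' : u - u' = u' / Real.log L := by rw [huu]; ring
  have hle : u' ≤ u := by
    have : 0 ≤ u' / Real.log L := by positivity
    linarith
  have hlam' : 64 * (r + 1) * (Real.log L) ^ 2 ≤ u' * c := by
    calc 64 * (r + 1) * (Real.log L) ^ 2
        ≤ 64 * (r + 1) * (c₀ / (64 * (r + 1)) * u' * (L : ℝ) ^ (d - 2)) := by gcongr
      _ = u' * (c₀ * (L : ℝ) ^ (d - 2)) := by field_simp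
      _ ≤ u' * c := by gcongr
  have h2δ : 2 * (δ * c) ≤ 1 := by
    calc 2 * (δ * c) ≤ 2 * (C * (L : ℝ) ^ (-(1 / 200 : ℝ))) := by gcongr
      _ = (2 * C) * (L : ℝ) ^ (-(1 / 200 : ℝ)) := by ring
      _ ≤ (L : ℝ) ^ (1 / 200 : ℝ) * (L : ℝ) ^ (-(1 / 200 : ℝ)) := by gcongr; exact hsmall
      _ = 1 := by rw [← Real.rpow_add hL0]; norm_num
  obtain ⟨k, hk⟩ := herr u u' c (δ * c) hu0 hu1 hcpos (capv_bx_le hd hL1 0) (by positivity) hδc huu'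
    hlam'
  have hstep := qEvent_step hd hP hQ hQ' hu0 hle hL1 (one_le_mOf hL1) hcpos hcdef.symm hδ h2δ hkap r k
  rw [← ellOf_eq] at hstep
  have hℓ : (1 : ℝ) ≤ ellOf L := by
    rw [ellOf_eq]
    push_cast
    linarith [Nat.cast_nonneg (α := ℝ) (mOf L)]
  push_cast at hsq' ⊢
  exact recursion_closes hL960r hℓ hsq hsq' ENNReal.toReal_nonneg hq hk hstep

end Induction

section Sequences

lemma le_Lseq (L0 n : ℕ) : L0 ≤ Lseq L0 n := by
  induction n with
  | zero => exact le_rfl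
  | succ n ih => exact ih.trans (Nat.le_mul_of_pos_left _ (by rw [ellOf_eq]; omega))

lemma log_mul_ellOf_ge {L : ℕ} (hL : 1 ≤ L) :
    101 / 100 * Real.log L ≤ Real.log ((ellOf L * L : ℕ) : ℝ) := by
  have hL0 : (0 : ℝ) < L := by exact_mod_cast hL
  have h1 : (L : ℝ) ^ ((1 : ℝ) / 100) ≤ ellOf L := by
    refine (Nat.lt_floor_add_one _).le.trans ?_
    rw [ellOf_eq]
    push_cast
    change (mOf L : ℝ) + 1 ≤ _
    linarith [Nat.cast_nonneg (α := ℝ) (mOf L)]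
  have h2 : (0 : ℝ) < (L : ℝ) ^ ((1 : ℝ) / 100) := by positivity
  have h3 := Real.log_le_log h2 h1
  rw [Real.log_rpow hL0] at h3
  rw [Nat.cast_mul, Real.log_mul (h2.trans_le h1).ne' hL0.ne']
  linarith

lemma log_Lseq_pos {L0 : ℕ} (h : 0 < Real.log L0) (n : ℕ) : 0 < Real.log (Lseq L0 n) := by
  refine h.trans_le (Real.log_le_log ?_ (by exact_mod_cast le_Lseq L0 n))
  rcases Nat.eq_zero_or_pos L0 with rfl | h'
  · simp at h
  · exact_mod_cast h'

lemma one_add_inv_log_inv_mem {L0 : ℕ} (h : 0 < Real.log L0) (n : ℕ) :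
    0 < (1 + 1 / Real.log (Lseq L0 n))⁻¹ ∧ (1 + 1 / Real.log (Lseq L0 n))⁻¹ ≤ 1 := by
  have h1 : 0 < 1 / Real.log (Lseq L0 n) := one_div_pos.2 (log_Lseq_pos h n)
  exact ⟨by positivity, inv_le_one_of_one_le₀ (by linarith)⟩

lemma useq_mem {L0 : ℕ} (h : 0 < Real.log L0) {u0 : ℝ} (hu : 0 ≤ u0) (n : ℕ) :
    0 ≤ useq L0 u0 n ∧ useq L0 u0 n ≤ u0 := by
  induction n with
  | zero => exact ⟨hu, le_rfl⟩
  | succ n ih =>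
    obtain ⟨h1, h2⟩ := one_add_inv_log_inv_mem h n
    exact ⟨mul_nonneg h1.le ih.1, (mul_le_of_le_one_left ih.1 h2).trans ih.2⟩

lemma useq_eq_mul_prod (L0 : ℕ) (u0 : ℝ) (n : ℕ) :
    useq L0 u0 n = u0 * ∏ i ∈ Finset.range n, (1 + 1 / Real.log (Lseq L0 i))⁻¹ := by
  induction n with
  | zero => simp [useq]
  | succ n ih => rw [useq, ih, Finset.prod_range_succ]; ring

lemma mul_exp_le_useq {L0 : ℕ} (h : 0 < Real.log L0) {u0 : ℝ} (hu : 0 ≤ u0) (n : ℕ) :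
    u0 * Real.exp (-(101 / Real.log L0 - 101 / Real.log (Lseq L0 n))) ≤ useq L0 u0 n := by
  induction n with
  | zero => simp [Lseq, useq]
  | succ n ih =>
    have hl := log_Lseq_pos h n
    have hl' := log_Lseq_pos h (n + 1)
    have hL1 : 1 ≤ Lseq L0 n := by
      rcases Nat.eq_zero_or_pos (Lseq L0 n) with h' | h'
      · simp [h'] at hl
      · exact h'
    have hgrow : 101 / 100 * Real.log (Lseq L0 n) ≤ Real.log (Lseq L0 (n + 1)) :=
      log_mul_ellOf_ge hL1
    have h1 : 101 / Real.log (Lseq L0 (n + 1)) ≤ 100 / Real.log (Lseq L0 n) := by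
      rw [div_le_div_iff₀ hl' hl]
      linarith
    have h2 : Real.exp (-(1 / Real.log (Lseq L0 n))) ≤ (1 + 1 / Real.log (Lseq L0 n))⁻¹ := by
      rw [Real.exp_neg]
      refine inv_anti₀ (by positivity) ?_
      rw [add_comm]
      exact Real.add_one_le_exp _
    have h3 : (101 : ℝ) / Real.log (Lseq L0 n) =
        100 / Real.log (Lseq L0 n) + 1 / Real.log (Lseq L0 n) := by ring
    calc u0 * Real.exp (-(101 / Real.log L0 - 101 / Real.log (Lseq L0 (n + 1))))
        ≤ u0 * Real.exp (-(1 / Real.log (Lseq L0 n)) +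
            -(101 / Real.log L0 - 101 / Real.log (Lseq L0 n))) := by
          refine mul_le_mul_of_nonneg_left (Real.exp_le_exp.2 ?_) hu
          linarith
      _ = Real.exp (-(1 / Real.log (Lseq L0 n))) *
          (u0 * Real.exp (-(101 / Real.log L0 - 101 / Real.log (Lseq L0 n)))) := by
          rw [Real.exp_add]; ring
      _ ≤ (1 + 1 / Real.log (Lseq L0 n))⁻¹ * useq L0 u0 n := by gcongr

lemma div_four_le_useq {L0 : ℕ} (h : 101 ≤ Real.log L0) {u0 : ℝ} (hu : 0 ≤ u0) (n : ℕ) :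
    u0 / 4 ≤ useq L0 u0 n := by
  have h0 : 0 < Real.log L0 := by linarith
  refine le_trans ?_ (mul_exp_le_useq h0 hu n)
  rw [div_eq_mul_inv]
  refine mul_le_mul_of_nonneg_left ?_ hu
  have h1 : 101 / Real.log L0 ≤ 1 := (div_le_one h0).2 h
  have h2 : 0 ≤ 101 / Real.log (Lseq L0 n) := div_nonneg (by norm_num) (log_Lseq_pos h0 n).le
  have h3 : (4 : ℝ)⁻¹ ≤ Real.exp (-1) := by
    rw [Real.exp_neg]
    exact inv_anti₀ (Real.exp_pos _) (by linarith [Real.exp_one_lt_three])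
  exact h3.trans (Real.exp_le_exp.2 (by linarith))

lemma log_Lseq_sq_mul_le {L0 : ℕ} (h1 : 1 ≤ L0) (h : ∀ L ≥ L0, ellOf L ≤ L) (n : ℕ) :
    (Real.log (Lseq L0 n)) ^ 2 * L0 ≤ (Real.log L0) ^ 2 * Lseq L0 n := by
  induction n with
  | zero => exact le_rfl
  | succ n ih =>
    have hL := h _ (le_Lseq L0 n)
    have hL1 : 1 ≤ Lseq L0 n := h1.trans (le_Lseq L0 n)
    have hLr : (1 : ℝ) ≤ Lseq L0 n := by exact_mod_cast hL1
    have hℓ : (4 : ℝ) ≤ ellOf (Lseq L0 n) := by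
      have := one_le_mOf hL1
      rw [ellOf_eq]
      exact_mod_cast (by omega : 4 ≤ 100 * mOf (Lseq L0 n) + 1)
    have hlog : Real.log (Lseq L0 (n + 1)) ≤ 2 * Real.log (Lseq L0 n) := by
      have : Real.log (ellOf (Lseq L0 n)) ≤ Real.log (Lseq L0 n) :=
        Real.log_le_log (by linarith) (by exact_mod_cast hL)
      rw [Lseq, Nat.cast_mul, Real.log_mul (by linarith) (by linarith)]
      linarith
    have hlog0 : 0 ≤ Real.log (Lseq L0 (n + 1)) :=
      Real.log_nonneg (by exact_mod_cast h1.trans (le_Lseq L0 (n + 1)))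
    calc (Real.log (Lseq L0 (n + 1))) ^ 2 * L0 ≤ (2 * Real.log (Lseq L0 n)) ^ 2 * L0 := by gcongr
      _ = 4 * ((Real.log (Lseq L0 n)) ^ 2 * L0) := by ring
      _ ≤ ellOf (Lseq L0 n) * ((Real.log L0) ^ 2 * Lseq L0 n) := by gcongr
      _ = (Real.log L0) ^ 2 * Lseq L0 (n + 1) := by rw [Lseq]; push_cast; ring

lemma mul_tprod_mem {L0 : ℕ} (h : 101 ≤ Real.log L0) {u0 : ℝ} (hu : 0 < u0) (hu1 : u0 ≤ 1) :
    0 < u0 * ∏' n : ℕ, (1 + 1 / Real.log (Lseq L0 n))⁻¹ ∧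
      u0 * ∏' n : ℕ, (1 + 1 / Real.log (Lseq L0 n))⁻¹ ≤ 1 := by
  by_cases hm : Multipliable fun n : ℕ => (1 + 1 / Real.log (Lseq L0 n))⁻¹
  · have ht := (hm.hasProd.tendsto_prod_nat).const_mul u0
    simp_rw [← useq_eq_mul_prod] at ht
    refine ⟨?_, ?_⟩
    · exact lt_of_lt_of_le (by positivity : 0 < u0 / 4)
        (ge_of_tendsto' ht fun n => div_four_le_useq h hu.le n)
    · exact (le_of_tendsto' ht fun n => (useq_mem (by linarith) hu.le n).2).trans hu1
  · rw [tprod_eq_one_of_not_multipliable hm, mul_one]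
    exact ⟨hu, hu1⟩

end Sequences

end RI

open RI MeasureTheory Filter

/-- **Propagation of the controls along the scales** (Theorem 2.5).
There are dimension-dependent constants `c₇, c₁, c₂ > 0` such that, for an integer
`L₀ ≥ c₇`, with `u₀ = (4/c₂)(log L₀)² L₀^{-(d-2)}` and `u_{n+1} = (1 + 1/log L_n)⁻¹ u_n`:
if `c₁ ℓ₀² q₀(u₀) ≤ L₀⁻¹` then `c₁ ℓ_n² q_n(u_n) ≤ L_n⁻¹` for all `n`, where each
`q_n(u_n)` is computed with respect to any vacant-set law at level `u_n`; moreover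
`u_∞ = u₀ ∏_{n≥0} (1 + 1/log L_n)⁻¹ ∈ (0,1]`. -/
theorem renormalization_scheme (d : ℕ) (hd : 3 ≤ d) :
    ∃ c7 c1 c2 : ℝ, 0 < c7 ∧ 0 < c1 ∧ 0 < c2 ∧
      ∀ L0 : ℕ, c7 ≤ (L0 : ℝ) →
        ∀ (P : Zd d → Measure (ℕ → Zd d)), IsSRW d P →
          ∀ Q : ℕ → Measure (Zd d → Bool),
            (∀ n : ℕ, IsVacantLaw P
              (useq L0 (4 / c2 * (Real.log L0) ^ 2 * (L0 : ℝ) ^ (-((d : ℝ) - 2))) n) (Q n)) →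
            c1 * (ellOf L0 : ℝ) ^ 2 * (Q 0 (qEvent d L0)).toReal ≤ (L0 : ℝ)⁻¹ →
            (∀ n : ℕ,
              c1 * (ellOf (Lseq L0 n) : ℝ) ^ 2 * (Q n (qEvent d (Lseq L0 n))).toReal
                ≤ ((Lseq L0 n : ℝ))⁻¹) ∧
            (0 < (4 / c2 * (Real.log L0) ^ 2 * (L0 : ℝ) ^ (-((d : ℝ) - 2))) *
                  ∏' n : ℕ, (1 + 1 / Real.log (Lseq L0 n))⁻¹ ∧
              (4 / c2 * (Real.log L0) ^ 2 * (L0 : ℝ) ^ (-((d : ℝ) - 2))) *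
                  ∏' n : ℕ, (1 + 1 / Real.log (Lseq L0 n))⁻¹ ≤ 1) := by
  obtain ⟨κ, hκ, hstep⟩ := scale_step hd
  obtain ⟨N, hN⟩ := eventually_atTop.1 (((hstep.and eventually_ellOf_sq_le).and
    (tendsto_log_natCast.eventually_ge_atTop 101)).and
    ((eventually_mul_log_le (1 + 4 / κ) (s := 1 / 2) (by norm_num) (by positivity)).and
      (eventually_ge_atTop 1)))
  refine ⟨N + 1, 480, κ, by positivity, by norm_num, hκ, ?_⟩
  intro L0 hL0 P hP Q hQ h0
  have hNL : N ≤ L0 := by exact_mod_cast (by linarith : (N : ℝ) ≤ L0)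
  obtain ⟨⟨-, hlog⟩, hlogle, hL1⟩ := hN L0 hNL
  have hLr : (1 : ℝ) ≤ L0 := by exact_mod_cast hL1
  have hL0pos : (0 : ℝ) < L0 := by linarith
  have hlog0 : 0 < Real.log L0 := by linarith
  have hpow : (L0 : ℝ) ^ (-((d : ℝ) - 2)) = ((L0 : ℝ) ^ (d - 2))⁻¹ := by
    rw [Real.rpow_neg hL0pos.le, ← Real.rpow_natCast]
    push_cast [Nat.cast_sub (by omega : 2 ≤ d)]
    rfl
  set u0 : ℝ := 4 / κ * (Real.log L0) ^ 2 * (L0 : ℝ) ^ (-((d : ℝ) - 2)) with hu0def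
  have hu0 : 0 < u0 := by positivity
  have hu1 : u0 ≤ 1 := by
    rw [hu0def, hpow, ← div_eq_mul_inv, div_le_one (by positivity)]
    have h1 : 4 / κ ≤ (1 + 4 / κ) ^ 2 := by
      have : 0 < 4 / κ := by positivity
      nlinarith
    calc 4 / κ * (Real.log L0) ^ 2 ≤ (1 + 4 / κ) ^ 2 * (Real.log L0) ^ 2 := by gcongr
      _ = ((1 + 4 / κ) * Real.log L0) ^ 2 := by ring
      _ ≤ ((L0 : ℝ) ^ (1 / 2 : ℝ)) ^ 2 := by gcongr
      _ = (L0 : ℝ) ^ 1 := by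
          rw [← Real.rpow_natCast, ← Real.rpow_mul hL0pos.le]
          norm_num
      _ ≤ (L0 : ℝ) ^ (d - 2) := pow_le_pow_right₀ hLr (by omega)
  have hell : ∀ L ≥ L0, ellOf L ≤ L := by
    intro L hL
    have h1 := (hN L (hNL.trans hL)).1.1.2
    have h2 : ellOf L ^ 2 ≤ L := by exact_mod_cast h1
    exact (Nat.le_self_pow (by norm_num) _).trans h2
  refine ⟨fun n => ?_, mul_tprod_mem hlog hu0 hu1⟩
  induction n with
  | zero => exact h0
  | succ n ih =>
    have hl := log_Lseq_pos hlog0 n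
    obtain ⟨hun0, hun1⟩ := useq_mem hlog0 hu0.le (n + 1)
    refine (hN (Lseq L0 n) (hNL.trans (le_Lseq L0 n))).1.1.1 P (Q n) (Q (n + 1))
      (useq L0 u0 n) (useq L0 u0 (n + 1)) hP (hQ n) (hQ (n + 1)) hun0 (hun1.trans hu1) ?_ ?_ ih
    · rw [useq, mul_inv_cancel_left₀ (by positivity)]
    · have h1 : (1 : ℝ) ≤ (Lseq L0 n : ℝ) / L0 := by
        rw [one_le_div hL0pos]
        exact_mod_cast le_Lseq L0 n
      calc (Real.log (Lseq L0 n)) ^ 2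
          ≤ (Real.log L0) ^ 2 * ((Lseq L0 n : ℝ) / L0) := by
            rw [← mul_div_assoc, le_div_iff₀ hL0pos]
            exact log_Lseq_sq_mul_le hL1 hell n
        _ ≤ (Real.log L0) ^ 2 * ((Lseq L0 n : ℝ) / L0) ^ (d - 2) := by
            gcongr
            exact le_self_pow₀ h1 (by omega)
        _ = κ * (u0 / 4) * (Lseq L0 n : ℝ) ^ (d - 2) := by
            rw [hu0def, hpow, div_pow]
            field_simp
        _ ≤ κ * useq L0 u0 (n + 1) * (Lseq L0 n : ℝ) ^ (d - 2) := by
            gcongr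
            exact div_four_le_useq hlog hu0.le _
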